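/- For every positive integer n, there exist only finitely many imaginary n-quadratic fields K (realized as subfields of ℂ) such that the exponent of Cl(K) divides 3. -/

import Mathlib

open NumberField

/-- `Qsqrt m` is the subfield `ℚ(√m)` of `ℂ`, generated by a square root of `m`. -/
noncomputable def Qsqrt (m : ℤ) : IntermediateField ℚ ℂ :=
  IntermediateField.adjoin ℚ {(m : ℂ) ^ ((1 : ℂ) / 2)}

/-- `m` belongs to `P* = {8, -4, -8} ∪ {p* : p odd prime}` where `p* = (-1)^((p-1)/2) * p`. -/
def Pstar (m : ℤ) : Prop :=
  m = 8 ∨ m = -4 ∨ m = -8 ∨ ∃ p : ℕ, p.Prime ∧ Odd p ∧ m = (-1) ^ ((p - 1) / 2) * (p : ℤ)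

/-- An `n`-quadratic field realized as a subfield of `ℂ`. -/
def IsNQuadratic (n : ℕ) (K : IntermediateField ℚ ℂ) : Prop :=
  FiniteDimensional ℚ K ∧ IsGalois ℚ K ∧
    Nonempty ((K ≃ₐ[ℚ] K) ≃* (Fin n → Multiplicative (ZMod 2)))

/-- A subfield of `ℂ` is imaginary if it is not contained in `ℝ`. -/
def IsImaginary (K : IntermediateField ℚ ℂ) : Prop :=
  ∃ x : K, (x : ℂ).im ≠ 0

/-- The exponent `E(K)` of the class group of a subfield `K` of `ℂ`. -/
noncomputable def Efield (K : IntermediateField ℚ ℂ) : ℕ :=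
  Monoid.exponent (ClassGroup (𝓞 K))

section
open Finset
namespace HB

/-- divisor bound -/
theorem div_bound (ε : ℝ) (hε : 0 < ε) :
    ∃ C : ℝ, 1 ≤ C ∧ ∀ n : ℕ, n ≠ 0 → (n.divisors.card : ℝ) ≤ C * (n : ℝ) ^ ε := by
  obtain ⟨N, hN⟩ : ∃ N : ℕ, ∀ p : ℕ, N ≤ p → (2:ℝ) ≤ (p:ℝ) ^ ε := by
    have := (tendsto_rpow_atTop hε).comp (tendsto_natCast_atTop_atTop (R := ℝ))
    have h2 := this.eventually_ge_atTop 2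
    obtain ⟨N, hN⟩ := Filter.eventually_atTop.1 h2
    exact ⟨N, fun p hp => hN p hp⟩
  set t : ℝ := (2:ℝ) ^ ε - 1 with ht
  have ht0 : 0 < t := by
    have := Real.one_lt_rpow (x := 2) (by norm_num) hε
    linarith
  set K : ℝ := 1 / t + 1 with hK
  have hK1 : 1 ≤ K := by
    have : 0 < 1 / t := by positivity
    linarith
  have key : ∀ p a : ℕ, p.Prime → (a + 1 : ℝ) ≤ (if p < N then K else 1) * ((p:ℝ) ^ a) ^ ε := by
    intro p a hp
    have hp2 : (2:ℝ) ≤ p := by exact_mod_cast hp.two_le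
    have hsw : ((p:ℝ) ^ a) ^ ε = ((p:ℝ) ^ ε) ^ a := by
      rw [← Real.rpow_natCast, ← Real.rpow_natCast, ← Real.rpow_mul (by positivity),
        ← Real.rpow_mul (by positivity), mul_comm]
    rw [hsw]
    split_ifs with h
    · have h1 : (1 + t) ^ a ≤ ((p:ℝ) ^ ε) ^ a := by
        apply pow_le_pow_left₀ (by positivity)
        have := Real.rpow_le_rpow (by norm_num) hp2 hε.le
        linarith
      have h2 := one_add_mul_le_pow (a := t) (by linarith) a
      have h3 : K * (1 + a * t) ≤ K * ((p:ℝ) ^ ε) ^ a :=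
        mul_le_mul_of_nonneg_left (h2.trans h1) (by linarith)
      have h4 : (a + 1 : ℝ) ≤ K * (1 + a * t) := by
        have : K * (1 + a * t) = K + a * 1 + a * t := by
          rw [hK]; field_simp
          ring
        rw [this]
        have : 0 ≤ a * t := by positivity
        linarith
      linarith
    · have h1 : (2:ℝ) ^ a ≤ ((p:ℝ) ^ ε) ^ a :=
        pow_le_pow_left₀ (by positivity) (hN p (not_lt.1 h)) a
      have h2 : (a + 1 : ℝ) ≤ 2 ^ a := by
        exact_mod_cast Nat.lt_two_pow_self
      linarith
  refine ⟨K ^ N, one_le_pow₀ hK1, fun n hn => ?_⟩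
  rw [Nat.card_divisors hn]
  push_cast
  have hn' : (n:ℝ) ^ ε = ∏ p ∈ n.primeFactors, ((p:ℝ) ^ (n.factorization p)) ^ ε := by
    conv_lhs => rw [← Nat.prod_factorization_pow_eq_self hn]
    rw [Finsupp.prod, Nat.support_factorization]
    push_cast
    rw [Real.finsetProd_rpow]
    intros; positivity
  have h1 : ∏ p ∈ n.primeFactors, ((n.factorization p : ℝ) + 1) ≤
      ∏ p ∈ n.primeFactors, ((if p < N then K else 1) * ((p:ℝ) ^ (n.factorization p)) ^ ε) := by
    apply Finset.prod_le_prod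
    · intros; positivity
    · intro p hp
      exact key p _ (Nat.prime_of_mem_primeFactors hp)
  rw [Finset.prod_mul_distrib, ← hn'] at h1
  refine h1.trans (mul_le_mul_of_nonneg_right ?_ (by positivity))
  rw [Finset.prod_ite, Finset.prod_const_one, mul_one, Finset.prod_const]
  apply pow_le_pow_right₀ hK1
  calc _ ≤ (Finset.range N).card := by
        apply Finset.card_le_card
        intro p hp
        simp at hp ⊢
        exact hp.2
    _ = N := by simp

theorem pow_omega_le (j q : ℕ) (hq : q ≠ 0) :
    (2 ^ j) ^ q.primeFactors.card ≤ q.divisors.card ^ j := by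
  have h : 2 ^ q.primeFactors.card ≤ q.divisors.card := by
    rw [Nat.card_divisors hq, ← Finset.prod_const]
    apply Finset.prod_le_prod' 
    intro p hp
    have := (Nat.mem_primeFactors.1 hp)
    have := this.1.factorization_pos_of_dvd hq this.2.1
    omega
  calc (2 ^ j) ^ q.primeFactors.card = (2 ^ q.primeFactors.card) ^ j := by
        rw [← pow_mul, ← pow_mul, mul_comm]
    _ ≤ _ := Nat.pow_le_pow_left h j

end HB
end

section
open Finset
namespace HB
section Stepanov
open Polynomial

variable {p : ℕ} [Fact p.Prime]

noncomputable def dl (f : (ZMod p)[X]) (c : ℕ) : (ZMod p)[X] →ₗ[ZMod p] (ZMod p)[X] :=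
  LinearMap.mulLeft (ZMod p) ((c : (ZMod p)[X]) * derivative f) +
    (LinearMap.mulLeft (ZMod p) f) ∘ₗ derivative

theorem dl_apply (f : (ZMod p)[X]) (c : ℕ) (r : (ZMod p)[X]) :
    dl f c r = (c : (ZMod p)[X]) * derivative f * r + f * derivative r := by
  simp [dl, mul_assoc]

noncomputable def dit (f : (ZMod p)[X]) (c : ℕ) : ℕ → ((ZMod p)[X] →ₗ[ZMod p] (ZMod p)[X])
  | 0 => LinearMap.id
  | k + 1 => dl f (c - k) ∘ₗ dit f c k

theorem dit_succ (f : (ZMod p)[X]) (c k : ℕ) (r : (ZMod p)[X]) :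
    dit f c (k + 1) r = dl f (c - k) (dit f c k r) := rfl

theorem natDegree_dl (f : (ZMod p)[X]) (c : ℕ) (r : (ZMod p)[X]) (m B : ℕ) (hf : f.natDegree ≤ m)
    (hr : r.natDegree ≤ B) : (dl f c r).natDegree ≤ B + m := by
  rw [dl_apply]
  refine (natDegree_add_le _ _).trans (max_le ?_ ?_)
  · refine natDegree_mul_le.trans ?_
    have h1 : ((c : (ZMod p)[X]) * derivative f).natDegree ≤ m := by
      refine natDegree_mul_le.trans ?_
      have := natDegree_derivative_le f
      simp
      omega
    omega
  · refine natDegree_mul_le.trans ?_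
    have := natDegree_derivative_le r
    omega

theorem natDegree_dit (f : (ZMod p)[X]) (c k : ℕ) (r : (ZMod p)[X]) (m B : ℕ)
    (hf : f.natDegree ≤ m) (hr : r.natDegree ≤ B) : (dit f c k r).natDegree ≤ B + k * m := by
  induction k with
  | zero => simpa [dit] using hr
  | succ k ih =>
    rw [dit_succ]
    have := natDegree_dl f (c - k) _ m _ hf ih
    calc _ ≤ _ := this
      _ = _ := by ring

theorem iter_deriv (f : (ZMod p)[X]) (c j k : ℕ) (hk : k ≤ c) (r : (ZMod p)[X]) :
    derivative^[k] (f ^ c * r * X ^ (p * j)) = f ^ (c - k) * dit f c k r * X ^ (p * j) := by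
  induction k with
  | zero => simp [dit]
  | succ k ih =>
    rw [Function.iterate_succ_apply', ih (by omega), dit_succ, dl_apply]
    obtain ⟨d, hd⟩ : ∃ d, c - k = d + 1 := ⟨c - k - 1, by omega⟩
    have hd' : c - (k + 1) = d := by omega
    rw [hd, hd']
    have hX : derivative (X ^ (p * j) : (ZMod p)[X]) = 0 := by
      rw [derivative_X_pow]; simp
    rw [derivative_mul, hX, derivative_mul, derivative_pow]
    simp
    ring

/-- nonvanishing -/
theorem stepanov_ne_zero (hp2 : p ≠ 2) (f : (ZMod p)[X]) (m A J : ℕ) (hf : f.natDegree ≤ m)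
    (hA : 2 * A + m < p) (x0 : ZMod p) (hx0 : f.rootMultiplicity x0 = 1) (hf0 : f.coeff 0 ≠ 0)
    (r s : ℕ → (ZMod p)[X]) (hr : ∀ j, (r j).natDegree ≤ A) (hs : ∀ j, (s j).natDegree ≤ A)
    (hne : ∃ j, j < J ∧ (r j ≠ 0 ∨ s j ≠ 0)) :
    ∑ j ∈ range J, (r j + s j * f ^ (p / 2)) * X ^ (p * j) ≠ 0 := by
  classical
  intro h0
  have hP : ∃ j, r j ≠ 0 ∨ s j ≠ 0 := by
    obtain ⟨j, _, h⟩ := hne; exact ⟨j, h⟩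
  set k := Nat.find hP with hk
  have hk1 := Nat.find_spec hP
  have hk2 : ∀ j, j < k → r j = 0 ∧ s j = 0 := by
    intro j hj
    have := Nat.find_min hP hj
    push Not at this
    exact this
  rw [← hk] at hk1
  have hkJ : k < J := by
    obtain ⟨j, hj, h⟩ := hne
    exact lt_of_le_of_lt (Nat.find_min' hP h) hj
  have hp : p.Prime := Fact.out
  -- divisibility
  have hdiv : X ^ p ∣ r k + s k * f ^ (p / 2) := by
    have h1 : (X:(ZMod p)[X]) ^ (p * (k + 1)) ∣ (r k + s k * f ^ (p / 2)) * X ^ (p * k) := by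
      have h2 : (r k + s k * f ^ (p / 2)) * X ^ (p * k) =
          - ∑ j ∈ (range J).erase k, (r j + s j * f ^ (p / 2)) * X ^ (p * j) := by
        rw [← Finset.add_sum_erase _ _ (Finset.mem_range.2 hkJ)] at h0
        exact eq_neg_of_add_eq_zero_left h0
      rw [h2]
      apply (dvd_neg).2
      apply Finset.dvd_sum
      intro j hj
      rw [Finset.mem_erase] at hj
      rcases lt_or_gt_of_ne hj.1 with h | h
      · rw [(hk2 j h).1, (hk2 j h).2]; simp
      · apply Dvd.dvd.mul_left
        apply pow_dvd_pow
        exact Nat.mul_le_mul_left _ h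
    rw [mul_add, mul_one, pow_add, mul_comm (X ^ (p * k))] at h1
    exact (mul_dvd_mul_iff_right (pow_ne_zero _ X_ne_zero)).1 h1
  have hfp : X ^ p ∣ f ^ p - C (f.coeff 0) := by
    have h1 : X ∣ f - C (f.coeff 0) := by
      rw [X_dvd_iff]; simp
    have h2 := pow_dvd_pow_of_dvd h1 p
    rw [sub_pow_char] at h2
    rwa [← C_pow, ZMod.pow_card] at h2
  have hodd : p / 2 + p / 2 + 1 = p := by
    have := hp.odd_of_ne_two hp2
    obtain ⟨t, ht⟩ := this
    omega
  have hdiv2 : X ^ p ∣ (r k) ^ 2 * f - (s k) ^ 2 * C (f.coeff 0) := by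
    have : (r k) ^ 2 * f - (s k) ^ 2 * C (f.coeff 0) =
        (r k + s k * f ^ (p / 2)) * ((r k - s k * f ^ (p / 2)) * f) +
          (f ^ p - C (f.coeff 0)) * (s k) ^ 2 := by
      have : f ^ p = f ^ (p / 2) * f ^ (p / 2) * f := by
        rw [← pow_add, ← pow_succ, hodd]
      rw [this]; ring
    rw [this]
    exact dvd_add (hdiv.mul_right _) (hfp.mul_right _)
  have heq : (r k) ^ 2 * f - (s k) ^ 2 * C (f.coeff 0) = 0 := by
    by_contra hne0
    have h1 := natDegree_le_of_dvd hdiv2 hne0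
    rw [natDegree_X_pow] at h1
    have h2 : ((r k) ^ 2 * f - (s k) ^ 2 * C (f.coeff 0)).natDegree ≤ 2 * A + m := by
      refine (natDegree_sub_le _ _).trans (max_le ?_ ?_)
      · refine natDegree_mul_le.trans ?_
        have := natDegree_pow_le_of_le 2 (hr k)
        omega
      · refine natDegree_mul_le.trans ?_
        have := natDegree_pow_le_of_le 2 (hs k)
        rw [natDegree_C]
        omega
    omega
  rw [sub_eq_zero] at heq
  have hf1 : f ≠ 0 := by rintro rfl; simp at hf0
  have hC : C (f.coeff 0) ≠ 0 := by simpa using hf0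
  by_cases hrk : r k = 0
  · rw [hrk] at heq
    have : s k = 0 := by
      simp at heq
      tauto
    tauto
  · have hsk : s k ≠ 0 := by
      intro hsk
      rw [hsk] at heq
      simp at heq
      tauto
    have h3 := congrArg (rootMultiplicity x0) heq
    rw [sq, sq, rootMultiplicity_mul (mul_ne_zero (mul_ne_zero hrk hrk) hf1),
      rootMultiplicity_mul (mul_ne_zero (mul_ne_zero hsk hsk) hC),
      rootMultiplicity_mul (mul_ne_zero hrk hrk), rootMultiplicity_mul (mul_ne_zero hsk hsk), hx0,
      rootMultiplicity_C] at h3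
    omega

end Stepanov
end HB
end

section
open Finset
namespace HB
section Stepanov
open Polynomial

variable {p : ℕ} [Fact p.Prime]

theorem stepanov_exists (f : (ZMod p)[X]) (a : ZMod p) (m A J l h : ℕ) (hf : f.natDegree ≤ m)
    (hdim : l * (A + J + l * m) < 2 * ((A + 1) * J)) :
    ∃ r s : ℕ → (ZMod p)[X], (∀ j, (r j).natDegree ≤ A) ∧ (∀ j, (s j).natDegree ≤ A) ∧
      (∃ j, j < J ∧ (r j ≠ 0 ∨ s j ≠ 0)) ∧
      ∀ k < l, ∑ j ∈ range J, (dit f l k (r j) + C a * dit f (l + h) k (s j)) * X ^ j = 0 := by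
  classical
  set N := A + J + l * m with hN
  set V := (Fin J → degreeLT (ZMod p) (A + 1)) × (Fin J → degreeLT (ZMod p) (A + 1)) with hV
  let Ψ : Fin l → V →ₗ[ZMod p] (ZMod p)[X] := fun k =>
    ∑ j : Fin J, (LinearMap.mulRight (ZMod p) (X ^ (j:ℕ))) ∘ₗ
      ((dit f l k) ∘ₗ (degreeLT (ZMod p) (A + 1)).subtype ∘ₗ LinearMap.proj j ∘ₗ LinearMap.fst _ _ _
      + (LinearMap.mulLeft (ZMod p) (C a)) ∘ₗ (dit f (l + h) k) ∘ₗ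
        (degreeLT (ZMod p) (A + 1)).subtype ∘ₗ LinearMap.proj j ∘ₗ LinearMap.snd _ _ _)
  have hΨ : ∀ k v, Ψ k v = ∑ j : Fin J, (dit f l k (v.1 j : (ZMod p)[X]) +
      C a * dit f (l + h) k (v.2 j : (ZMod p)[X])) * X ^ (j:ℕ) := by
    intro k v
    simp only [Ψ, LinearMap.sum_apply]
    rfl
  let Φ : V →ₗ[ZMod p] (Fin l × Fin N → ZMod p) :=
    LinearMap.pi fun kn => (lcoeff (ZMod p) (kn.2 : ℕ)) ∘ₗ Ψ kn.1
  have hfin : Module.Finite (ZMod p) (degreeLT (ZMod p) (A + 1)) :=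
    Module.Finite.equiv (degreeLTEquiv (ZMod p) (A + 1)).symm
  have hfr : Module.finrank (ZMod p) (degreeLT (ZMod p) (A + 1)) = A + 1 := by
    rw [(degreeLTEquiv (ZMod p) (A + 1)).finrank_eq]; simp
  have hdeg : ∀ w : degreeLT (ZMod p) (A + 1), (w : (ZMod p)[X]).natDegree ≤ A := by
    intro w
    have := mem_degreeLT.1 w.2
    by_cases hw : (w : (ZMod p)[X]) = 0
    · rw [hw]; simp
    · rw [degree_eq_natDegree hw] at this
      have h2 : (w : (ZMod p)[X]).natDegree < A + 1 := by exact_mod_cast this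
      omega
  have hker : LinearMap.ker Φ ≠ ⊥ := by
    apply LinearMap.ker_ne_bot_of_finrank_lt
    have h1 : Module.finrank (ZMod p) (Fin J → degreeLT (ZMod p) (A + 1)) = J * (A + 1) := by
      rw [Module.finrank_pi_fintype]
      simp [hfr]
    rw [Module.finrank_prod, h1, Module.finrank_fintype_fun_eq_card, Fintype.card_prod,
      Fintype.card_fin, Fintype.card_fin]
    linarith
  obtain ⟨v, hv, hv0⟩ := (Submodule.ne_bot_iff _).1 hker
  rw [LinearMap.mem_ker] at hv
  have hv' : ∀ k, Ψ k v = 0 := by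
    intro k
    ext n
    by_cases hn : n < N
    · have := congrFun hv (k, ⟨n, hn⟩)
      simpa [Φ] using this
    · rw [coeff_zero]
      apply coeff_eq_zero_of_natDegree_lt
      refine lt_of_lt_of_le ?_ (not_lt.1 hn)
      rw [hΨ]
      by_cases hJ : J = 0
      · subst hJ
        simp at hdim
      refine lt_of_le_of_lt (natDegree_sum_le_of_forall_le (n := N - 1) _ _ ?_) ?_
      · intro j _
        refine natDegree_mul_le.trans ?_
        rw [natDegree_X_pow]
        have hk : (k:ℕ) * m + m ≤ l * m := by
          have : (k:ℕ) + 1 ≤ l := k.2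
          calc (k:ℕ) * m + m = (k + 1) * m := by ring
            _ ≤ _ := Nat.mul_le_mul_right _ this
        have h1 : (dit f l k (v.1 j : (ZMod p)[X]) +
            C a * dit f (l + h) k (v.2 j : (ZMod p)[X])).natDegree ≤ A + k * m := by
          refine (natDegree_add_le _ _).trans (max_le ?_ ?_)
          · exact natDegree_dit _ _ _ _ _ _ hf (hdeg _)
          · refine (natDegree_C_mul_le _ _).trans ?_
            exact natDegree_dit _ _ _ _ _ _ hf (hdeg _)
        have := j.2
        omega
      · omega
  refine ⟨fun j => if hj : j < J then v.1 ⟨j, hj⟩ else 0,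
    fun j => if hj : j < J then v.2 ⟨j, hj⟩ else 0, ?_, ?_, ?_, ?_⟩
  · intro j
    dsimp only
    split_ifs
    · exact hdeg _
    · simp
  · intro j
    dsimp only
    split_ifs
    · exact hdeg _
    · simp
  · by_contra hcon
    push Not at hcon
    apply hv0
    ext j : 2
    · have := (hcon j j.2).1
      simpa using this
    · have := (hcon j j.2).2
      simpa using this
  · intro k hk
    have := hv' ⟨k, hk⟩
    rw [hΨ] at this
    rw [Finset.sum_range, ← this]
    apply Finset.sum_congr rfl
    intro j _
    simp

/-- main count -/
theorem stepanov_count (hp2 : p ≠ 2) (f : (ZMod p)[X]) (a : ZMod p) (m A J l : ℕ)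
    (hf : f.natDegree ≤ m) (hlp : l ≤ p)
    (hA : 2 * A + m < p) (x0 : ZMod p) (hx0 : f.rootMultiplicity x0 = 1) (hf0 : f.coeff 0 ≠ 0)
    (hdim : l * (A + J + l * m) < 2 * ((A + 1) * J)) :
    l * (univ.filter fun x : ZMod p => (f.eval x) ^ (p / 2) = a).card ≤
      l * m + A + m * (p / 2) + p * J := by
  classical
  obtain ⟨r, s, hr, hs, hne, hsum⟩ := stepanov_exists f a m A J l (p / 2) hf hdim
  have hnz := stepanov_ne_zero hp2 f m A J hf hA x0 hx0 hf0 r s hr hs hne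
  have hf1 : f ≠ 0 := by rintro rfl; simp at hf0
  set R : (ZMod p)[X] := ∑ j ∈ range J, (f ^ l * r j * X ^ (p * j) +
    f ^ (l + p / 2) * s j * X ^ (p * j)) with hR
  have hRe : R = f ^ l * ∑ j ∈ range J, (r j + s j * f ^ (p / 2)) * X ^ (p * j) := by
    rw [hR, Finset.mul_sum]
    apply Finset.sum_congr rfl
    intro j _
    rw [pow_add]; ring
  have hR0 : R ≠ 0 := by rw [hRe]; exact mul_ne_zero (pow_ne_zero _ hf1) hnz
  have hRdeg : R.natDegree ≤ l * m + A + m * (p / 2) + p * J := by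
    apply natDegree_sum_le_of_forall_le
    intro j hj
    have hj := Finset.mem_range.1 hj
    have hpj : p * j ≤ p * J := Nat.mul_le_mul_left _ hj.le
    have h1 := natDegree_pow_le_of_le l hf
    have h2 := natDegree_pow_le_of_le (l + p / 2) hf
    rw [add_mul, mul_comm (p/2) m] at h2
    refine (natDegree_add_le _ _).trans (max_le ?_ ?_)
    · refine natDegree_mul_le.trans ?_
      rw [natDegree_X_pow]
      have := natDegree_mul_le (p := f ^ l) (q := r j)
      have := hr j
      omega
    · refine natDegree_mul_le.trans ?_
      rw [natDegree_X_pow]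
      have := natDegree_mul_le (p := f ^ (l + p / 2)) (q := s j)
      have := hs j
      omega
  have hder : ∀ x : ZMod p, (f.eval x) ^ (p / 2) = a → ∀ k < l, (derivative^[k] R).IsRoot x := by
    intro x hx k hk
    have h1 : derivative^[k] R = ∑ j ∈ range J, (f ^ (l - k) * dit f l k (r j) * X ^ (p * j) +
        f ^ (l + p / 2 - k) * dit f (l + p / 2) k (s j) * X ^ (p * j)) := by
      rw [hR, iterate_derivative_sum]
      apply Finset.sum_congr rfl
      intro j _
      rw [iterate_map_add, iter_deriv _ _ _ _ hk.le, iter_deriv _ _ _ _ (by omega)]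
    have h2 := congrArg (eval x) (hsum k hk)
    rw [eval_finsetSum, eval_zero] at h2
    rw [IsRoot.def, h1, eval_finsetSum]
    have h3 : (f.eval x) ^ (l - k) * ∑ j ∈ range J, eval x ((dit f l k (r j) +
        C a * dit f (l + p / 2) k (s j)) * X ^ j) = 0 := by rw [h2, mul_zero]
    rw [← h3, Finset.mul_sum]
    apply Finset.sum_congr rfl
    intro j _
    have h4 : l + p / 2 - k = (l - k) + p / 2 := by omega
    simp only [eval_add, eval_mul, eval_pow, eval_X, eval_C]
    rw [h4, pow_add, hx, pow_mul, ZMod.pow_card]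
    ring
  have hmult : ∀ x : ZMod p, (f.eval x) ^ (p / 2) = a → l ≤ R.rootMultiplicity x := by
    intro x hx
    rcases Nat.eq_zero_or_pos l with h0 | h0
    · omega
    obtain ⟨l', rfl⟩ : ∃ l', l = l' + 1 := ⟨l - 1, by omega⟩
    have hfac : ((l').factorial : ZMod p) ≠ 0 := by
      rw [Ne, ZMod.natCast_eq_zero_iff, (Fact.out : p.Prime).dvd_factorial]
      omega
    exact lt_rootMultiplicity_of_isRoot_iterate_derivative_of_mem_nonZeroDivisors hR0
      (fun k hk => hder x hx k (by omega)) (mem_nonZeroDivisors_of_ne_zero hfac)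
  set S := univ.filter fun x : ZMod p => (f.eval x) ^ (p / 2) = a with hS
  calc l * S.card = ∑ x ∈ S, l := by simp [mul_comm]
    _ ≤ ∑ x ∈ S, R.roots.count x := by
        apply Finset.sum_le_sum
        intro x hx
        rw [count_roots]
        exact hmult x (Finset.mem_filter.1 hx).2
    _ ≤ ∑ x ∈ S ∪ R.roots.toFinset, R.roots.count x :=
        Finset.sum_le_sum_of_subset Finset.subset_union_left
    _ = R.roots.card := Multiset.sum_count_eq_card fun x hx => by simp [hx]
    _ ≤ R.natDegree := card_roots' R
    _ ≤ _ := hRdeg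

end Stepanov
end HB
end

section
open Finset
namespace HB
section Stepanov
open Polynomial

variable {p : ℕ} [Fact p.Prime]

theorem stepanov_num (hp : 100 ≤ p) (f : (ZMod p)[X]) (a : ZMod p)
    (hf : f.natDegree ≤ 8) (x0 : ZMod p) (hx0 : f.rootMultiplicity x0 = 1) (hf0 : f.coeff 0 ≠ 0) :
    2 * (univ.filter fun x : ZMod p => (f.eval x) ^ (p / 2) = a).card ≤
      p + 33 * Nat.sqrt p + 82 := by
  have hpp : p.Prime := Fact.out
  have hp2 : p ≠ 2 := by omega
  obtain ⟨t, ht⟩ := hpp.odd_of_ne_two hp2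
  set l := Nat.sqrt p with hl
  have h1 : l * l ≤ p := Nat.sqrt_le p
  have h2 : p < (l + 1) * (l + 1) := Nat.lt_succ_sqrt p
  have hl10 : 10 ≤ l := by
    rw [hl, Nat.le_sqrt]; omega
  have hlp : l ≤ p := Nat.sqrt_le_self p
  set N := (univ.filter fun x : ZMod p => (f.eval x) ^ (p / 2) = a).card with hN
  have hm := stepanov_count hp2 f a 8 (t - 4) (l / 2 + 12) l hf hlp (by omega) x0 hx0 hf0 (by
    have e1 : t - 4 + 1 = t - 3 := by omega
    obtain ⟨u, hu⟩ : ∃ u, t = u + 4 := ⟨t - 4, by omega⟩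
    have e2 : t - 4 = u := by omega
    have hpu : p = 2 * u + 9 := by omega
    rw [e2]
    set J := l / 2 with hJ
    have hJ1 : l ≤ 2 * J + 1 := by omega
    have hJ2 : 2 * J ≤ l := by omega
    nlinarith)
  rw [← hN] at hm
  have hp3 : p / 2 = t := by omega
  rw [hp3] at hm
  have h3 : l * N * 2 ≤ l * (p + 33 * l + 82) := by
    have h4 : p * (l / 2) * 2 ≤ p * l := by
      rw [mul_assoc]; exact Nat.mul_le_mul_left _ (by omega)
    have h5 : (l * 8 + (t - 4) + 8 * t + p * (l / 2 + 12)) * 2 ≤ 16 * l + 33 * p + p * l := by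
      have : t - 4 ≤ t := Nat.sub_le _ _
      nlinarith
    nlinarith
  have h6 : l * (2 * N) ≤ l * (p + 33 * l + 82) := by linarith
  exact Nat.le_of_mul_le_mul_left h6 (by omega)

theorem weil_aux (hp : 100 ≤ p) (S : Finset (ZMod p)) (hS : S.Nonempty) (hc : S.card ≤ 8)
    (h0 : (0 : ZMod p) ∉ S) :
    |∑ x : ZMod p, quadraticChar (ZMod p) (∏ a ∈ S, (x - a))| ≤ 42 * (Nat.sqrt p : ℤ) := by
  classical
  have hpp : p.Prime := Fact.out
  have hp2 : p ≠ 2 := by omega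
  set f : (ZMod p)[X] := ∏ a ∈ S, (X - C a) with hf
  have hdeg : f.natDegree ≤ 8 := by
    rw [hf, natDegree_finsetProd_X_sub_C_eq_card]; exact hc
  have hev : ∀ x, f.eval x = ∏ a ∈ S, (x - a) := by
    intro x; rw [hf, eval_prod]; simp
  obtain ⟨x0, hx0S⟩ := hS
  have hx0 : f.rootMultiplicity x0 = 1 := by
    rw [← count_roots, hf, roots_prod_X_sub_C]
    exact Multiset.count_eq_one_of_mem S.nodup hx0S
  have hf0 : f.coeff 0 ≠ 0 := by
    rw [coeff_zero_eq_eval_zero, hev, Finset.prod_ne_zero_iff]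
    intro a ha h
    apply h0
    have : a = 0 := by simpa using h
    rwa [← this]
  have n1 := stepanov_num hp f 1 hdeg x0 hx0 hf0
  have n2 := stepanov_num hp f (-1) hdeg x0 hx0 hf0
  have hring : ringChar (ZMod p) ≠ 2 := by rw [ZMod.ringChar_zmod_n]; exact hp2
  set N1 := (univ.filter fun x : ZMod p => (f.eval x) ^ (p / 2) = 1) with hN1
  set N2 := (univ.filter fun x : ZMod p => (f.eval x) ^ (p / 2) = -1) with hN2
  have h11 : (1 : ZMod p) ≠ -1 := fun h => (Ring.neg_one_ne_one_of_char_ne_two hring) h.symm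
  have hp20 : p / 2 ≠ 0 := by omega
  have hsum : ∑ x : ZMod p, quadraticChar (ZMod p) (∏ a ∈ S, (x - a)) = (N1.card : ℤ) - N2.card := by
    rw [hN1, hN2, Finset.card_filter, Finset.card_filter]
    push_cast
    rw [← Finset.sum_sub_distrib]
    apply Finset.sum_congr rfl
    intro x _
    rw [← hev]
    by_cases hx : f.eval x = 0
    · rw [hx]
      simp [hp20]
    · rw [quadraticChar_eq_pow_of_char_ne_two hring hx, ZMod.card]
      have := FiniteField.pow_dichotomy hring hx
      rw [ZMod.card] at this
      rcases this with h | h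
      · rw [h]; simp [h11]
      · rw [h]; simp [h11.symm]
  have htot : p ≤ N1.card + N2.card + 8 := by
    have h1 : (univ : Finset (ZMod p)) ⊆ N1 ∪ N2 ∪ S := by
      intro x _
      by_cases hx : f.eval x = 0
      · rw [hev, Finset.prod_eq_zero_iff] at hx
        obtain ⟨a, ha, hxa⟩ := hx
        have : x = a := sub_eq_zero.1 hxa
        simp [this, ha]
      · have := FiniteField.pow_dichotomy hring hx
        rw [ZMod.card] at this
        simp [hN1, hN2]
        tauto
    have h2 := Finset.card_le_card h1
    rw [Finset.card_univ, ZMod.card] at h2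
    have h3 := Finset.card_union_le (N1 ∪ N2) S
    have h4 := Finset.card_union_le N1 N2
    omega
  have hl10 : 10 ≤ Nat.sqrt p := by
    rw [Nat.le_sqrt]; omega
  rw [hsum, abs_le]
  constructor <;> omega

theorem weil8 (S : Finset (ZMod p)) (hS : S.Nonempty) (hc : S.card ≤ 8) :
    |((∑ x : ZMod p, quadraticChar (ZMod p) (∏ a ∈ S, (x - a)) : ℤ) : ℝ)| ≤ 64 * √p := by
  classical
  by_cases hp : 100 ≤ p
  · obtain ⟨c, hcS⟩ : ∃ c : ZMod p, c ∉ S := by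
      by_contra h
      push Not at h
      have : (univ : Finset (ZMod p)) ⊆ S := fun x _ => h x
      have h2 := Finset.card_le_card this
      rw [Finset.card_univ, ZMod.card] at h2
      omega
    have h1 := weil_aux hp (S.image fun a => a - c) (hS.image _)
      (Finset.card_image_le.trans hc) (by
        simp only [Finset.mem_image, not_exists, not_and]
        intro a ha h
        apply hcS
        rw [← sub_eq_zero.1 h]; exact ha)
    have h2 : ∑ x : ZMod p, quadraticChar (ZMod p) (∏ a ∈ S, (x - a)) =
        ∑ x : ZMod p, quadraticChar (ZMod p) (∏ a ∈ S.image fun a => a - c, (x - a)) := by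
      rw [← Equiv.sum_comp (Equiv.addRight c)]
      apply Finset.sum_congr rfl
      intro x _
      rw [Finset.prod_image (fun a _ b _ h => sub_left_injective h)]
      congr 1
      apply Finset.prod_congr rfl
      intro a _
      simp only [Equiv.coe_addRight]; ring
    rw [h2]
    have h3 : ((Nat.sqrt p : ℕ) : ℝ) ≤ √p := Real.nat_sqrt_le_real_sqrt
    have h4 : |((∑ x : ZMod p, quadraticChar (ZMod p)
        (∏ a ∈ S.image fun a => a - c, (x - a)) : ℤ) : ℝ)| ≤ 42 * (Nat.sqrt p : ℝ) := by
      exact_mod_cast h1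
    have := Real.sqrt_nonneg p
    linarith
  · have h1 : |∑ x : ZMod p, quadraticChar (ZMod p) (∏ a ∈ S, (x - a))| ≤ (p : ℤ) := by
      refine (Finset.abs_sum_le_sum_abs _ _).trans ?_
      calc _ ≤ ∑ x : ZMod p, (1:ℤ) := by
            apply Finset.sum_le_sum
            intro x _
            rcases quadraticChar_isQuadratic (ZMod p) (∏ a ∈ S, (x - a)) with h | h | h <;> 
            simp [h]
        _ = p := by simp [ZMod.card]
    have h2 : |((∑ x : ZMod p, quadraticChar (ZMod p) (∏ a ∈ S, (x - a)) : ℤ) : ℝ)| ≤ p := by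
      exact_mod_cast h1
    have h3 : (p : ℝ) = √p * √p := (Real.mul_self_sqrt (by positivity)).symm
    have h4 : √(p:ℝ) ≤ 64 := by
      rw [Real.sqrt_le_left (by norm_num)]
      have : (p:ℝ) ≤ 100 := by exact_mod_cast (by omega : p ≤ 100)
      linarith
    calc _ ≤ _ := h2
      _ = √p * √p := h3
      _ ≤ _ := mul_le_mul_of_nonneg_right h4 (Real.sqrt_nonneg _)

end Stepanov
end HB
end

section
open Finset
namespace HB

/-- the complete sum -/
def TT (q : ℕ) (b : Fin 8 → ℕ) : ℤ := ∑ x ∈ range q, ∏ i, jacobiSym ((x + b i : ℕ) : ℤ) q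

theorem sum_crt (m n : ℕ) (hm : m ≠ 0) (hn : n ≠ 0) (h : m.Coprime n) (G H : ℕ → ℤ) :
    ∑ x ∈ range (m * n), G (x % m) * H (x % n) = (∑ x ∈ range m, G x) * ∑ x ∈ range n, H x := by
  rw [Finset.sum_mul_sum, ← Finset.sum_product']
  refine Finset.sum_bij (fun x _ => (x % m, x % n)) ?_ ?_ ?_ ?_
  · intro x _
    simp [Nat.mod_lt _ (Nat.pos_of_ne_zero hm), Nat.mod_lt _ (Nat.pos_of_ne_zero hn)]
  · intro x hx y hy hxy
    simp only [Prod.mk.injEq] at hxy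
    have : x ≡ y [MOD m * n] := (Nat.modEq_and_modEq_iff_modEq_mul h).1 ⟨hxy.1, hxy.2⟩
    exact Nat.ModEq.eq_of_lt_of_lt this (mem_range.1 hx) (mem_range.1 hy)
  · rintro ⟨a, b⟩ hab
    simp only [mem_product, mem_range] at hab
    obtain ⟨k, hk1, hk2⟩ := Nat.chineseRemainder h a b
    refine ⟨k % (m * n), mem_range.2 (Nat.mod_lt _ (by positivity)), ?_⟩
    simp only [Nat.mod_mul_right_mod, Nat.mod_mul_left_mod, Prod.mk.injEq]
    constructor
    · rw [hk1, Nat.mod_eq_of_lt hab.1]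
    · rw [hk2, Nat.mod_eq_of_lt hab.2]
  · intro x _; rfl

theorem TT_mul (m n : ℕ) (hm : m ≠ 0) (hn : n ≠ 0) (h : m.Coprime n) (b : Fin 8 → ℕ) :
    TT (m * n) b = TT m b * TT n b := by
  unfold TT
  rw [← sum_crt m n hm hn h (fun x => ∏ i, jacobiSym ((x + b i : ℕ) : ℤ) m)
    (fun x => ∏ i, jacobiSym ((x + b i : ℕ) : ℤ) n)]
  apply Finset.sum_congr rfl
  intro x _
  rw [← Finset.prod_mul_distrib]
  apply Finset.prod_congr rfl
  intro i _
  rw [jacobiSym.mul_right' _ hm hn]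
  congr 1
  · apply jacobiSym.mod_left'
    push_cast
    simp
  · apply jacobiSym.mod_left'
    push_cast
    simp

theorem abs_jacobi_le (a : ℤ) (q : ℕ) : |jacobiSym a q| ≤ 1 := by
  rcases jacobiSym.trichotomy a q with h | h | h <;> simp [h]

theorem abs_TT_le (q : ℕ) (b : Fin 8 → ℕ) : |TT q b| ≤ q := by
  unfold TT
  refine (Finset.abs_sum_le_sum_abs _ _).trans ?_
  calc _ ≤ ∑ x ∈ range q, (1:ℤ) := by
        apply Finset.sum_le_sum
        intro x _
        rw [Finset.abs_prod]
        apply Finset.prod_le_one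
        · intros; positivity
        · intros; exact abs_jacobi_le _ _
    _ = q := by simp

theorem TT_prime (p : ℕ) [Fact p.Prime] (b : Fin 8 → ℕ) :
    TT p b = ∑ x : ZMod p, ∏ i, quadraticChar (ZMod p) (x - (-(b i : ZMod p))) := by
  unfold TT
  symm
  refine Finset.sum_bij (fun x _ => x.val) ?_ ?_ ?_ ?_
  · intro x _; exact mem_range.2 (ZMod.val_lt x)
  · intro x _ y _ h; exact ZMod.val_injective p h
  · intro k hk
    exact ⟨(k : ZMod p), mem_univ _, ZMod.val_cast_of_lt (mem_range.1 hk)⟩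
  · intro x _
    apply Finset.prod_congr rfl
    intro i _
    rw [← jacobiSym.legendreSym.to_jacobiSym, legendreSym]
    congr 1
    push_cast
    rw [ZMod.natCast_zmod_val]; ring

theorem TT_prime_bound (p : ℕ) [Fact p.Prime] (b : Fin 8 → ℕ) (i0 : Fin 8)
    (hodd : Odd (univ.filter fun j => (b j : ZMod p) = (b i0 : ZMod p)).card) :
    |(TT p b : ℝ)| ≤ 128 * √p := by
  classical
  rw [TT_prime]
  set g : Fin 8 → ZMod p := fun i => -(b i : ZMod p) with hg
  set χ := quadraticChar (ZMod p)
  set I := univ.image g with hI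
  set mu : ZMod p → ℕ := fun a => (univ.filter fun i => g i = a).card with hmu
  set S := I.filter fun a => Odd (mu a) with hS
  have hIc : I.card ≤ 8 := Finset.card_image_le.trans (by simp)
  have hSc : S.card ≤ 8 := (Finset.card_filter_le _ _).trans hIc
  have hSn : S.Nonempty := by
    refine ⟨g i0, Finset.mem_filter.2 ⟨Finset.mem_image_of_mem _ (mem_univ _), ?_⟩⟩
    have : mu (g i0) = (univ.filter fun j => (b j : ZMod p) = (b i0 : ZMod p)).card := by
      simp only [hmu, hg, neg_inj]
    rw [this]; exact hodd
  have hW := weil8 S hSn hSc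
  have hdiff : |∑ x : ZMod p, ∏ i, χ (x - g i) - ∑ x : ZMod p, χ (∏ a ∈ S, (x - a))| ≤ 8 := by
    rw [← Finset.sum_sub_distrib]
    refine (Finset.abs_sum_le_sum_abs _ _).trans ?_
    calc _ ≤ ∑ x : ZMod p, (if x ∈ I then (1:ℤ) else 0) := by
          apply Finset.sum_le_sum
          intro x _
          have h1 : ∏ i, χ (x - g i) = ∏ a ∈ I, χ (x - a) ^ mu a := by
            rw [Finset.prod_comp (fun a => χ (x - a)) g]
          have h2 : χ (∏ a ∈ S, (x - a)) = ∏ a ∈ I, if Odd (mu a) then χ (x - a) else 1 := by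
            rw [map_prod, hS, Finset.prod_filter]
          have hle : ∀ y, |χ y| ≤ 1 := by
            intro y
            rcases quadraticChar_isQuadratic (ZMod p) y with h | h | h <;> simp [χ, h]
          split_ifs with hx
          · have hz : ∏ i, χ (x - g i) = 0 := by
              obtain ⟨i, _, hi⟩ := Finset.mem_image.1 hx
              apply Finset.prod_eq_zero (mem_univ i)
              rw [hi, sub_self]
              exact quadraticChar_zero
            rw [hz, zero_sub, abs_neg]
            exact hle _
          · rw [h1, h2]
            have : ∏ a ∈ I, χ (x - a) ^ mu a = ∏ a ∈ I, if Odd (mu a) then χ (x - a) else 1 := by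
              apply Finset.prod_congr rfl
              intro a ha
              have hne : x - a ≠ 0 := by
                intro h; apply hx; rw [sub_eq_zero.1 h]; exact ha
              have hsq : χ (x - a) ^ 2 = 1 := quadraticChar_sq_one hne
              split_ifs with ho
              · obtain ⟨k, hk⟩ := ho
                rw [hk, pow_succ, pow_mul, hsq]; simp
              · obtain ⟨k, hk⟩ := Nat.not_odd_iff_even.1 ho
                rw [hk, ← two_mul, pow_mul, hsq]; simp
            rw [this]; simp
      _ = (I.card : ℤ) := by simp
      _ ≤ 8 := by exact_mod_cast hIc
  have hdiff' : |((∑ x : ZMod p, ∏ i, χ (x - g i) : ℤ) : ℝ) -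
      ((∑ x : ZMod p, χ (∏ a ∈ S, (x - a)) : ℤ) : ℝ)| ≤ 8 := by
    exact_mod_cast hdiff
  have hs1 : (1:ℝ) ≤ √p := by
    rw [Real.one_le_sqrt]
    exact_mod_cast (Fact.out : p.Prime).one_lt.le
  have := abs_sub_abs_le_abs_sub ((∑ x : ZMod p, ∏ i, χ (x - g i) : ℤ) : ℝ)
    ((∑ x : ZMod p, χ (∏ a ∈ S, (x - a)) : ℤ) : ℝ)
  linarith

/-- gcd weights -/
def GG (q c b : ℕ) : ℕ := if b = c then 1 else Nat.gcd (Int.natAbs ((b:ℤ) - c)) q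

theorem GG_pos (q c b : ℕ) : 1 ≤ GG q c b := by
  unfold GG
  split_ifs with h
  · exact le_rfl
  · apply Nat.gcd_pos_of_pos_left
    omega

theorem GG_mul (m n c b : ℕ) (h : m.Coprime n) : GG (m * n) c b = GG m c b * GG n c b := by
  unfold GG
  split_ifs
  · rfl
  · exact Nat.Coprime.gcd_mul _ h

theorem TT_prime_bound2 (p : ℕ) (hp : p.Prime) (b : Fin 8 → ℕ) (i0 : Fin 8)
    (hodd : Odd (univ.filter fun j => b j = b i0).card) :
    |(TT p b : ℝ)| ≤ 128 * √p * ∏ j, (GG p (b i0) (b j) : ℝ) := by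
  have : Fact p.Prime := ⟨hp⟩
  have hG : ∀ j, (1:ℝ) ≤ GG p (b i0) (b j) := fun j => by exact_mod_cast GG_pos _ _ _
  by_cases h : ∃ j, b j ≠ b i0 ∧ (b j : ZMod p) = b i0
  · obtain ⟨j, hj1, hj2⟩ := h
    have h1 : GG p (b i0) (b j) = p := by
      unfold GG
      rw [if_neg hj1]
      apply Nat.gcd_eq_right
      have : ((b j : ℤ) : ZMod p) = ((b i0 : ℤ) : ZMod p) := by exact_mod_cast hj2
      rw [← sub_eq_zero, ← Int.cast_sub, ZMod.intCast_zmod_eq_zero_iff_dvd] at this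
      exact Int.natCast_dvd.1 this
    have h2 : (p:ℝ) ≤ ∏ j, (GG p (b i0) (b j) : ℝ) := by
      rw [← Finset.mul_prod_erase _ _ (mem_univ j), h1]
      have : (1:ℝ) ≤ ∏ x ∈ univ.erase j, (GG p (b i0) (b x) : ℝ) := by
          apply Finset.prod_induction (fun x => (GG p (b i0) (b x) : ℝ)) (fun y => 1 ≤ y)
          · intro a b ha hb; nlinarith
          · exact le_rfl
          · intro x _; exact hG x
      nlinarith [(Nat.cast_nonneg p : (0:ℝ) ≤ p)]
    have h3 : |(TT p b : ℝ)| ≤ p := by exact_mod_cast abs_TT_le p b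
    have hs1 : (1:ℝ) ≤ √p := by
      rw [Real.one_le_sqrt]
      exact_mod_cast hp.one_lt.le
    nlinarith [(Nat.cast_nonneg p : (0:ℝ) ≤ p)]
  · push Not at h
    have h1 : (univ.filter fun j => (b j : ZMod p) = (b i0 : ZMod p)) =
        univ.filter fun j => b j = b i0 := by
      ext j
      simp only [mem_filter, mem_univ, true_and]
      constructor
      · intro hj
        by_contra hne
        exact h j hne hj
      · intro hj; rw [hj]
    have h2 := TT_prime_bound p b i0 (by rw [h1]; exact hodd)
    have h3 : (1:ℝ) ≤ ∏ j, (GG p (b i0) (b j) : ℝ) := by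
      apply Finset.prod_induction (fun x => (GG p (b i0) (b x) : ℝ)) (fun y => 1 ≤ y)
      · intro a b ha hb; nlinarith
      · exact le_rfl
      · intro x _; exact hG x
    have := Real.sqrt_nonneg p
    nlinarith

theorem TT_bound (q : ℕ) (hq : Squarefree q) (b : Fin 8 → ℕ) (i0 : Fin 8)
    (hodd : Odd (univ.filter fun j => b j = b i0).card) :
    |(TT q b : ℝ)| ≤ 128 ^ q.primeFactors.card * √q * ∏ j, (GG q (b i0) (b j) : ℝ) := by
  induction q using Nat.strong_induction_on with
  | _ q ih =>
    by_cases h1 : q = 1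
    · subst h1
      have : |(TT 1 b : ℝ)| ≤ (1:ℕ) := by exact_mod_cast abs_TT_le 1 b
      have h2 : ∀ j, GG 1 (b i0) (b j) = 1 := by
        intro j; unfold GG; split_ifs <;> simp
      simpa [h2] using this
    · have hp := Nat.minFac_prime h1
      set p := q.minFac
      obtain ⟨m, hm⟩ := Nat.minFac_dvd q
      change q = p * m at hm
      have hq0 : q ≠ 0 := hq.ne_zero
      have hm0 : m ≠ 0 := by rintro rfl; simp at hm; exact hq0 hm
      have hcop : p.Coprime m := by
        rw [hm] at hq
        exact Nat.coprime_of_squarefree_mul hq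
      have hms : Squarefree m := hq.squarefree_of_dvd ⟨p, by rw [hm, mul_comm]⟩
      have hlt : m < q := by
        rw [hm]
        have := hp.two_le
        have : 0 < m := Nat.pos_of_ne_zero hm0
        nlinarith
      have i1 := ih m hlt hms
      have i2 := TT_prime_bound2 p hp b i0 hodd
      have hc : q.primeFactors.card = m.primeFactors.card + 1 := by
        rw [hm, hcop.primeFactors_mul, Finset.card_union_of_disjoint hcop.disjoint_primeFactors,
          hp.primeFactors]
        simp [add_comm]
      rw [hc]
      have hTT : (TT q b : ℝ) = TT p b * TT m b := by
        rw [hm, TT_mul p m hp.ne_zero hm0 hcop]; push_cast; rfl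
      have hsq : √(q:ℝ) = √(p:ℝ) * √(m:ℝ) := by
        rw [hm]; push_cast; rw [Real.sqrt_mul (by positivity)]
      have hGG : ∏ j, (GG q (b i0) (b j) : ℝ) =
          (∏ j, (GG p (b i0) (b j) : ℝ)) * ∏ j, (GG m (b i0) (b j) : ℝ) := by
        rw [← Finset.prod_mul_distrib]
        apply Finset.prod_congr rfl
        intro j _
        rw [hm, GG_mul _ _ _ _ hcop]; push_cast; rfl
      rw [hTT, abs_mul, hsq, hGG]
      calc _ ≤ (128 * √p * ∏ j, (GG p (b i0) (b j) : ℝ)) *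
            (128 ^ m.primeFactors.card * √m * ∏ j, (GG m (b i0) (b j) : ℝ)) :=
            mul_le_mul i2 i1 (abs_nonneg _) (by positivity)
        _ = _ := by ring

end HB
end

section
open Finset
namespace HB

theorem card_dvd_sub (M c e : ℕ) (hc : c < M) :
    e * ((range M).filter fun b => b ≠ c ∧ e ∣ Int.natAbs ((b:ℤ) - c)).card ≤ 2 * M := by
  have h1 : ((range M).filter fun b => b ≠ c ∧ e ∣ Int.natAbs ((b:ℤ) - c)).card ≤
      ((Ioc 0 M).filter fun t => e ∣ t).card + ((Ioc 0 M).filter fun t => e ∣ t).card := by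
    have hsub : ((range M).filter fun b => b ≠ c ∧ e ∣ Int.natAbs ((b:ℤ) - c)) ⊆
        ((range M).filter fun b => c < b ∧ e ∣ b - c) ∪
        ((range M).filter fun b => b < c ∧ e ∣ c - b) := by
      intro b hb
      simp only [mem_filter, mem_union, mem_range] at hb ⊢
      rcases lt_or_gt_of_ne hb.2.1 with h | h
      · right
        refine ⟨hb.1, h, ?_⟩
        have : Int.natAbs ((b:ℤ) - c) = c - b := by omega
        rw [← this]; exact hb.2.2
      · left
        refine ⟨hb.1, h, ?_⟩
        have : Int.natAbs ((b:ℤ) - c) = b - c := by omega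
        rw [← this]; exact hb.2.2
    refine (card_le_card hsub).trans ((card_union_le _ _).trans (Nat.add_le_add ?_ ?_))
    · apply Finset.card_le_card_of_injOn (fun b => b - c)
      · intro b hb
        simp only [coe_filter, mem_range, Set.mem_ofPred_eq, mem_Ioc] at hb ⊢
        refine ⟨by omega, hb.2.2⟩
      · intro b hb b' hb' h
        simp only [coe_filter, mem_range, Set.mem_ofPred_eq] at hb hb' h
        omega
    · apply Finset.card_le_card_of_injOn (fun b => c - b)
      · intro b hb
        simp only [coe_filter, mem_range, Set.mem_ofPred_eq, mem_Ioc] at hb ⊢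
        refine ⟨by omega, hb.2.2⟩
      · intro b hb b' hb' h
        simp only [coe_filter, mem_range, Set.mem_ofPred_eq] at hb hb' h
        omega
  rw [Nat.Ioc_filter_dvd_card_eq_div] at h1
  calc _ ≤ e * (M / e + M / e) := Nat.mul_le_mul_left _ h1
    _ = 2 * (e * (M / e)) := by ring
    _ ≤ 2 * M := Nat.mul_le_mul_left _ (Nat.mul_div_le M e)

theorem sum_GG (q M c : ℕ) (hq : q ≠ 0) (hc : c < M) :
    ∑ b ∈ range M, GG q c b ≤ 3 * M * q.divisors.card := by
  have h1 : ∀ b ∈ range M, GG q c b ≤ (if b = c then 1 else 0) +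
      ∑ e ∈ q.divisors, if b ≠ c ∧ e ∣ Int.natAbs ((b:ℤ) - c) then e else 0 := by
    intro b _
    unfold GG
    split_ifs with h
    · omega
    · rw [zero_add]
      set g := Nat.gcd (Int.natAbs ((b:ℤ) - c)) q with hg
      have hgq : g ∈ q.divisors := Nat.mem_divisors.2 ⟨Nat.gcd_dvd_right _ _, hq⟩
      have := Finset.single_le_sum (f := fun e => if b ≠ c ∧ e ∣ Int.natAbs ((b:ℤ) - c) then e else 0)
        (fun _ _ => Nat.zero_le _) hgq
      refine le_trans ?_ this
      rw [if_pos ⟨h, Nat.gcd_dvd_left _ _⟩]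
  have hd : 1 ≤ q.divisors.card := Finset.card_pos.2 ⟨1, by simp [hq]⟩
  calc _ ≤ _ := Finset.sum_le_sum h1
    _ = 1 + ∑ e ∈ q.divisors, e *
        ((range M).filter fun b => b ≠ c ∧ e ∣ Int.natAbs ((b:ℤ) - c)).card := by
        rw [Finset.sum_add_distrib, Finset.sum_comm]
        congr 1
        · simp [hc]
        · apply Finset.sum_congr rfl
          intro e _
          rw [← Finset.sum_filter, Finset.sum_const, smul_eq_mul, mul_comm]
    _ ≤ 1 + ∑ e ∈ q.divisors, 2 * M := by
        apply Nat.add_le_add_left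
        apply Finset.sum_le_sum
        intro e _
        exact card_dvd_sub M c e hc
    _ = 1 + q.divisors.card * (2 * M) := by simp
    _ ≤ 3 * M * q.divisors.card := by
        have : 1 ≤ M := by omega
        nlinarith

theorem sum_tuple_GG (q M : ℕ) (hq : q ≠ 0) (i0 : Fin 8) :
    ∑ b ∈ Fintype.piFinset (fun _ : Fin 8 => range M), ∏ j, (GG q (b i0) (b j) : ℝ) ≤
      M * (3 * M * q.divisors.card : ℝ) ^ 7 := by
  classical
  have h1 : ∀ b ∈ Fintype.piFinset (fun _ : Fin 8 => range M),
      ∏ j, (GG q (b i0) (b j) : ℝ) = ∑ c ∈ range M,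
        ∏ j, (if j = i0 then (if b j = c then (1:ℝ) else 0) else GG q c (b j)) := by
    intro b hb
    rw [Finset.sum_eq_single (b i0)]
    · apply Finset.prod_congr rfl
      intro j _
      split_ifs with h h2
      · subst h; simp [GG]
      · subst h; exact absurd rfl h2
      · rfl
    · intro c _ hc
      apply Finset.prod_eq_zero (mem_univ i0)
      simp [hc.symm]
    · intro h
      exact absurd (Fintype.mem_piFinset.1 hb i0) h
  rw [Finset.sum_congr rfl h1, Finset.sum_comm]
  have h2 : ∀ c ∈ range M, ∑ b ∈ Fintype.piFinset (fun _ : Fin 8 => range M),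
      ∏ j, (if j = i0 then (if b j = c then (1:ℝ) else 0) else GG q c (b j)) ≤
      (3 * M * q.divisors.card : ℝ) ^ 7 := by
    intro c hc
    rw [← Finset.prod_univ_sum (fun _ : Fin 8 => range M)
      (fun j y => if j = i0 then (if y = c then (1:ℝ) else 0) else (GG q c y : ℝ))]
    rw [← Finset.mul_prod_erase _ _ (mem_univ i0)]
    have e1 : ∑ y ∈ range M, (if i0 = i0 then (if y = c then (1:ℝ) else 0) else (GG q c y : ℝ)) = 1 := by
      simp only [if_true, Finset.sum_ite_eq', if_pos hc]
    rw [e1, one_mul]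
    have e2 : ((univ : Finset (Fin 8)).erase i0).card = 7 := by simp
    rw [← e2, ← Finset.prod_const]
    apply Finset.prod_le_prod
    · intro j _
      apply Finset.sum_nonneg
      intro y _
      split_ifs <;> positivity
    · intro j hj
      have hj' : j ≠ i0 := (Finset.mem_erase.1 hj).1
      simp only [if_neg hj']
      exact_mod_cast sum_GG q M c hq (mem_range.1 hc)
  calc _ ≤ ∑ c ∈ range M, (3 * M * q.divisors.card : ℝ) ^ 7 := Finset.sum_le_sum h2
    _ = _ := by simp

theorem count_even_tuples (M : ℕ) (hM : 0 < M) :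
    ((Fintype.piFinset (fun _ : Fin 8 => range M)).filter
      fun b => ∀ i0, ¬ Odd (univ.filter fun j => b j = b i0).card).card ≤ 4 ^ 8 * M ^ 4 := by
  classical
  set E := (Fintype.piFinset (fun _ : Fin 8 => range M)).filter
      fun b => ∀ i0, ¬ Odd (univ.filter fun j => b j = b i0).card with hE
  have hsub : E ⊆ ((univ : Finset (Fin 8 → Fin 4)) ×ˢ
      (Fintype.piFinset (fun _ : Fin 4 => range M))).image (fun gc => gc.2 ∘ gc.1) := by
    intro b hb
    rw [hE, mem_filter, Fintype.mem_piFinset] at hb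
    obtain ⟨hb1, hb2⟩ := hb
    set I := univ.image b with hI
    have hcard : I.card ≤ 4 := by
      have h1 : (univ : Finset (Fin 8)).card = ∑ y ∈ I, (univ.filter fun j => b j = y).card :=
        Finset.card_eq_sum_card_image b univ
      have h2 : ∑ y ∈ I, 2 ≤ ∑ y ∈ I, (univ.filter fun j => b j = y).card := by
        apply Finset.sum_le_sum
        intro y hy
        obtain ⟨i, _, rfl⟩ := Finset.mem_image.1 hy
        have h3 := Nat.not_odd_iff_even.1 (hb2 i)
        have h4 : 0 < (univ.filter fun j => b j = b i).card :=
          Finset.card_pos.2 ⟨i, by simp⟩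
        obtain ⟨k, hk⟩ := h3
        omega
      rw [← h1] at h2
      simp at h2
      omega
    obtain ⟨e⟩ : Nonempty (I ↪ Fin 4) := by
      apply Function.Embedding.nonempty_of_card_le
      simpa using hcard
    have hbI : ∀ i, b i ∈ I := fun i => Finset.mem_image_of_mem _ (mem_univ i)
    refine Finset.mem_image.2 ⟨(fun i => e ⟨b i, hbI i⟩,
      fun t => if h : ∃ y : I, e y = t then (h.choose : ℕ) else 0), ?_, ?_⟩
    · simp only [mem_product, mem_univ, true_and, Fintype.mem_piFinset]
      intro t
      split_ifs with h
      · obtain ⟨i, _, hi⟩ := Finset.mem_image.1 h.choose.2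
        rw [← hi]; exact hb1 i
      · exact mem_range.2 hM
    · ext i
      simp only [Function.comp]
      have h : ∃ y : I, e y = e ⟨b i, hbI i⟩ := ⟨_, rfl⟩
      rw [dif_pos h]
      have := e.injective h.choose_spec
      rw [this]
  refine (card_le_card hsub).trans (card_image_le.trans ?_)
  rw [card_product]
  simp

theorem moment8 (q M : ℕ) (hq : Squarefree q) (hM : 0 < M) :
    ∑ x ∈ range q, ((∑ b ∈ range M, jacobiSym ((x + b : ℕ) : ℤ) q : ℤ) : ℝ) ^ 8 ≤
      65536 * (M:ℝ) ^ 4 * q + 17496 * (M:ℝ) ^ 8 * √q * (q.divisors.card : ℝ) ^ 14 := by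
  classical
  have hq0 : q ≠ 0 := hq.ne_zero
  have h1 : ∑ x ∈ range q, ((∑ b ∈ range M, jacobiSym ((x + b : ℕ) : ℤ) q : ℤ) : ℝ) ^ 8 =
      ∑ b ∈ Fintype.piFinset (fun _ : Fin 8 => range M), (TT q b : ℝ) := by
    unfold TT
    push_cast
    rw [Finset.sum_comm]
    apply Finset.sum_congr rfl
    intro x _
    rw [Finset.sum_pow']
  rw [h1]
  set D := 128 ^ q.primeFactors.card * √(q:ℝ) with hD
  have hD0 : 0 ≤ D := by positivity
  set P := Fintype.piFinset (fun _ : Fin 8 => range M) with hP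
  have h2 : ∀ b ∈ P, (TT q b : ℝ) ≤
      (if ∀ i0, ¬ Odd (univ.filter fun j => b j = b i0).card then (q:ℝ) else 0) +
      ∑ i0, D * ∏ j, (GG q (b i0) (b j) : ℝ) := by
    intro b _
    have hnn : ∀ i0, 0 ≤ D * ∏ j, (GG q (b i0) (b j) : ℝ) := fun i0 => by positivity
    split_ifs with h
    · have h3 : |(TT q b : ℝ)| ≤ q := by exact_mod_cast abs_TT_le q b
      have := Finset.sum_nonneg (s := univ) (fun i0 _ => hnn i0)
      have := le_abs_self (TT q b : ℝ)
      linarith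
    · push Not at h
      obtain ⟨i0, hi0⟩ := h
      have h3 := TT_bound q hq b i0 hi0
      have h4 := Finset.single_le_sum (f := fun i0 => D * ∏ j, (GG q (b i0) (b j) : ℝ))
        (fun i _ => hnn i) (mem_univ i0)
      have := le_abs_self (TT q b : ℝ)
      linarith
  refine (Finset.sum_le_sum h2).trans ?_
  rw [Finset.sum_add_distrib, ← Finset.sum_filter, Finset.sum_const, nsmul_eq_mul, Finset.sum_comm]
  have h3 : ((P.filter fun b => ∀ i0, ¬ Odd (univ.filter fun j => b j = b i0).card).card : ℝ) ≤
      65536 * (M:ℝ) ^ 4 := by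
    have := count_even_tuples M hM
    rw [show (4 ^ 8 : ℕ) = 65536 by norm_num] at this
    exact_mod_cast this
  have h4 : ∑ i0 : Fin 8, ∑ b ∈ P, D * ∏ j, (GG q (b i0) (b j) : ℝ) ≤
      ∑ i0 : Fin 8, D * (M * (3 * M * q.divisors.card : ℝ) ^ 7) := by
    apply Finset.sum_le_sum
    intro i0 _
    rw [← Finset.mul_sum]
    exact mul_le_mul_of_nonneg_left (sum_tuple_GG q M hq0 i0) hD0
  have h5 : D ≤ (q.divisors.card : ℝ) ^ 7 * √q := by
    apply mul_le_mul_of_nonneg_right _ (Real.sqrt_nonneg _)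
    have := pow_omega_le 7 q hq0
    norm_num at this
    exact_mod_cast this
  have h6 : D * (M * (3 * M * q.divisors.card : ℝ) ^ 7) ≤
      ((q.divisors.card : ℝ) ^ 7 * √q) * (M * (3 * M * q.divisors.card : ℝ) ^ 7) :=
    mul_le_mul_of_nonneg_right h5 (by positivity)
  rw [Finset.sum_const, Finset.card_univ, Fintype.card_fin, nsmul_eq_mul] at h4
  have h7 := mul_le_mul_of_nonneg_right h3 (Nat.cast_nonneg (α := ℝ) q)
  refine (add_le_add h7 h4).trans ?_
  have : (8:ℕ) * (((q.divisors.card : ℝ) ^ 7 * √q) * (M * (3 * M * q.divisors.card : ℝ) ^ 7)) =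
      17496 * (M:ℝ) ^ 8 * √q * (q.divisors.card : ℝ) ^ 14 := by push_cast; ring
  rw [← this]
  have : ((8:ℕ):ℝ) * (D * (M * (3 * M * q.divisors.card : ℝ) ^ 7)) ≤
    (8:ℕ) * (((q.divisors.card : ℝ) ^ 7 * √q) * (M * (3 * M * q.divisors.card : ℝ) ^ 7)) :=
    mul_le_mul_of_nonneg_left h6 (by positivity)
  linarith

end HB
end

section
open Finset
namespace HB

/-- residues -/
noncomputable def xx (q H a n : ℕ) : ℕ := (((H + n : ℕ) : ZMod q) * (a : ZMod q)⁻¹).val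

theorem xx_lt (q H a n : ℕ) (hq : q ≠ 0) : xx q H a n < q := by
  have : NeZero q := ⟨hq⟩
  exact ZMod.val_lt _

theorem mul_xx (q H a n : ℕ) (hq : q ≠ 0) (ha : a.Coprime q) :
    ((a * xx q H a n : ℕ) : ZMod q) = ((H + n : ℕ) : ZMod q) := by
  have : NeZero q := ⟨hq⟩
  unfold xx
  rw [Nat.cast_mul, ZMod.natCast_zmod_val, mul_comm, mul_assoc, mul_comm (_)⁻¹,
    ZMod.coe_mul_inv_eq_one a ha, mul_one]

theorem jac_shift (q H a n b : ℕ) (hq : q ≠ 0) (ha : a.Coprime q) :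
    jacobiSym ((H + n + a * b : ℕ) : ℤ) q =
      jacobiSym (a : ℤ) q * jacobiSym ((xx q H a n + b : ℕ) : ℤ) q := by
  rw [← jacobiSym.mul_left]
  apply jacobiSym.mod_left'
  have h := mul_xx q H a n hq ha
  have h2 : ((H + n + a * b : ℕ) : ZMod q) = ((a * (xx q H a n + b) : ℕ) : ZMod q) := by
    rw [Nat.cast_add (H + n), ← h]; push_cast; ring
  rw [ZMod.natCast_eq_natCast_iff] at h2
  have h3 := (Int.natCast_modEq_iff).2 h2
  push_cast at h3 ⊢
  exact h3

theorem card_modeq_le (N d : ℕ) (Z : Finset ℕ) (hZ : Z ⊆ range N)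
    (h : ∀ x ∈ Z, ∀ y ∈ Z, x % d = y % d) : Z.card ≤ N / d + 1 := by
  have : Z.card ≤ (range (N / d + 1)).card := by
    apply Finset.card_le_card_of_injOn (fun n => n / d)
    · intro x hx
      have := mem_range.1 (hZ hx)
      simp only [coe_range, Set.mem_Iio]
      have := Nat.div_le_div_right (c := d) this.le
      omega
    · intro x hx y hy hxy
      have h1 := h x hx y hy
      simp only at hxy
      rw [← Nat.div_add_mod x d, ← Nat.div_add_mod y d, hxy, h1]
  simpa using this

/-- pairs for fixed a, a' -/
theorem card_pairs (q H A N a a' : ℕ) (hq : q ≠ 0) (ha : a.Coprime q) (ha' : a'.Coprime q)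
    (ha0 : 0 < a) (ha0' : 0 < a') (haA : a ≤ A) (haA' : a' ≤ A) (hAN : 2 * A * N ≤ q) :
    (((range N ×ˢ range N).filter fun nn => xx q H a nn.1 = xx q H a' nn.2).card : ℝ) ≤
      N * (Nat.gcd a a' : ℝ) / a + 1 := by
  classical
  set Z := (range N ×ˢ range N).filter fun nn => xx q H a nn.1 = xx q H a' nn.2 with hZ
  set g := Nat.gcd a a' with hg
  have hg0 : 0 < g := Nat.gcd_pos_of_pos_left _ ha0
  have key : ∀ u ∈ Z, ∀ v ∈ Z, (a' : ℤ) * (u.1 - v.1) = a * ((u.2 : ℤ) - v.2) := by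
    intro u hu v hv
    have hrel : ∀ u ∈ Z, ((a' * (H + u.1) : ℕ) : ZMod q) = ((a * (H + u.2) : ℕ) : ZMod q) := by
      intro u hu
      have h1 := (mem_filter.1 hu).2
      have h2 := mul_xx q H a u.1 hq ha
      have h3 := mul_xx q H a' u.2 hq ha'
      rw [Nat.cast_mul, Nat.cast_mul, ← h2, ← h3, h1]
      push_cast; ring
    have hu1 := hrel u hu
    have hv1 := hrel v hv
    have hd : (((a' : ℤ) * (u.1 - v.1) - a * ((u.2 : ℤ) - v.2) : ℤ) : ZMod q) = 0 := by
      push_cast at hu1 hv1 ⊢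
      linear_combination hu1 - hv1
    rw [ZMod.intCast_zmod_eq_zero_iff_dvd] at hd
    have hub := mem_product.1 (mem_filter.1 hu).1
    have hvb := mem_product.1 (mem_filter.1 hv).1
    simp only [mem_range] at hub hvb
    have b1 : |(a' : ℤ) * (u.1 - v.1)| < A * N := by
      rw [abs_mul]
      have e1 : |(a':ℤ)| ≤ A := by rw [abs_of_nonneg (by positivity)]; exact_mod_cast haA'
      have e2 : |((u.1 : ℤ) - v.1)| < N := by rw [abs_lt]; constructor <;> omega
      have e3 : (0:ℤ) < A := by omega
      nlinarith [abs_nonneg ((u.1 : ℤ) - v.1), abs_nonneg (a':ℤ)]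
    have b2 : |(a : ℤ) * (u.2 - v.2)| < A * N := by
      rw [abs_mul]
      have e1 : |(a:ℤ)| ≤ A := by rw [abs_of_nonneg (by positivity)]; exact_mod_cast haA
      have e2 : |((u.2 : ℤ) - v.2)| < N := by rw [abs_lt]; constructor <;> omega
      have e3 : (0:ℤ) < A := by omega
      nlinarith [abs_nonneg ((u.2 : ℤ) - v.2), abs_nonneg (a:ℤ)]
    have hqq : (2 * A * N : ℤ) ≤ q := by exact_mod_cast hAN
    have hz := Int.eq_zero_of_abs_lt_dvd hd (by
      rw [abs_lt] at *
      constructor <;> linarith [b1.1, b1.2, b2.1, b2.2])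
    linarith
  have hinj : Set.InjOn Prod.fst (Z : Set (ℕ × ℕ)) := by
    intro u hu v hv huv
    have h1 := key u hu v hv
    rw [huv] at h1
    have h2 : (a:ℤ) * ((u.2 : ℤ) - v.2) = 0 := by rw [← h1]; ring
    have h3 : ((u.2 : ℤ) - v.2) = 0 := by
      rcases mul_eq_zero.1 h2 with h | h
      · omega
      · exact h
    ext
    · exact huv
    · omega
  have hc : Z.card ≤ N / (a / g) + 1 := by
    rw [← Finset.card_image_of_injOn hinj]
    apply card_modeq_le N (a / g)
    · intro x hx
      obtain ⟨u, hu, rfl⟩ := mem_image.1 hx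
      exact (mem_product.1 (mem_filter.1 hu).1).1
    · intro x hx y hy
      obtain ⟨u, hu, rfl⟩ := mem_image.1 hx
      obtain ⟨v, hv, rfl⟩ := mem_image.1 hy
      have h1 := key u hu v hv
      obtain ⟨s, hs⟩ := Nat.gcd_dvd_left a a'
      obtain ⟨t, ht⟩ := Nat.gcd_dvd_right a a'
      rw [← hg] at hs ht
      have hcop : Nat.Coprime (a / g) (a' / g) := Nat.coprime_div_gcd_div_gcd hg0
      have hs' : a / g = s := by rw [hs]; exact Nat.mul_div_cancel_left _ hg0
      have ht' : a' / g = t := by rw [ht]; exact Nat.mul_div_cancel_left _ hg0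
      rw [hs', ht'] at hcop
      rw [hs']
      have h2 : (t : ℤ) * (u.1 - v.1) = s * ((u.2 : ℤ) - v.2) := by
        have h3 : (g:ℤ) ≠ 0 := by exact_mod_cast hg0.ne'
        apply mul_left_cancel₀ h3
        have e1 : (a:ℤ) = g * s := by exact_mod_cast hs
        have e2 : (a':ℤ) = g * t := by exact_mod_cast ht
        rw [e1, e2] at h1
        linarith
      have h4 : (s:ℤ) ∣ (u.1 - v.1 : ℤ) := by
        apply IsCoprime.dvd_of_dvd_mul_left (Nat.isCoprime_iff_coprime.2 hcop)
        exact ⟨_, h2⟩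
      have h5 : (v.1 : ℤ) ≡ u.1 [ZMOD s] := (Int.modEq_iff_dvd).2 h4
      exact ((Int.natCast_modEq_iff).1 h5).symm
  have h6 : (Z.card : ℝ) ≤ ((N / (a / g) : ℕ) : ℝ) + 1 := by exact_mod_cast hc
  refine h6.trans ((add_le_add_iff_right 1).2 ?_)
  refine Nat.cast_div_le.trans ?_
  rw [Nat.cast_div (Nat.gcd_dvd_left _ _) (by exact_mod_cast hg0.ne')]
  rw [div_div_eq_mul_div]

theorem sum_gcd_le (A a : ℕ) (ha : 0 < a) :
    ∑ a' ∈ Icc 1 A, Nat.gcd a a' ≤ A * a.divisors.card := by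
  have h1 : ∀ a' ∈ Icc 1 A, Nat.gcd a a' ≤ ∑ g ∈ a.divisors, if g ∣ a' then g else 0 := by
    intro a' _
    have hg : Nat.gcd a a' ∈ a.divisors := Nat.mem_divisors.2 ⟨Nat.gcd_dvd_left _ _, ha.ne'⟩
    have := Finset.single_le_sum (f := fun g => if g ∣ a' then g else 0) (fun _ _ => Nat.zero_le _) hg
    rw [if_pos (Nat.gcd_dvd_right _ _)] at this
    exact this
  refine (Finset.sum_le_sum h1).trans ?_
  rw [Finset.sum_comm]
  calc _ ≤ ∑ g ∈ a.divisors, A := by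
        apply Finset.sum_le_sum
        intro g _
        rw [← Finset.sum_filter, Finset.sum_const, smul_eq_mul]
        have : (Icc 1 A).filter (fun t => g ∣ t) = (Ioc 0 A).filter fun t => g ∣ t := by
          ext t; simp [Nat.succ_le_iff]
        rw [this, Nat.Ioc_filter_dvd_card_eq_div, mul_comm]
        exact Nat.mul_div_le A g
    _ = _ := by simp [mul_comm]

/-- coprime shifts -/
def AA (q A : ℕ) : Finset ℕ := (Icc 1 A).filter fun a => a.Coprime q

theorem sum_pairs_le (q H A N : ℕ) (hq : q ≠ 0) (hAN : 2 * A * N ≤ q) :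
    ∑ a ∈ AA q A, ∑ a' ∈ AA q A,
      (((range N ×ˢ range N).filter fun nn => xx q H a nn.1 = xx q H a' nn.2).card : ℝ) ≤
      A ^ 2 + N * A * ∑ a ∈ Icc 1 A, (a.divisors.card : ℝ) / a := by
  have hmem : ∀ a ∈ AA q A, 0 < a ∧ a ≤ A ∧ a.Coprime q := by
    intro a ha
    have := mem_filter.1 ha
    have h2 := mem_Icc.1 this.1
    exact ⟨h2.1, h2.2, this.2⟩
  calc _ ≤ ∑ a ∈ AA q A, ∑ a' ∈ AA q A, (N * (Nat.gcd a a' : ℝ) / a + 1) := by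
        apply Finset.sum_le_sum
        intro a ha
        apply Finset.sum_le_sum
        intro a' ha'
        have h1 := hmem a ha
        have h2 := hmem a' ha'
        exact card_pairs q H A N a a' hq h1.2.2 h2.2.2 h1.1 h2.1 h1.2.1 h2.2.1 hAN
    _ ≤ ∑ a ∈ Icc 1 A, ∑ a' ∈ Icc 1 A, (N * (Nat.gcd a a' : ℝ) / a + 1) := by
        have hs : AA q A ⊆ Icc 1 A := filter_subset _ _
        refine (Finset.sum_le_sum fun a _ => Finset.sum_le_sum_of_subset_of_nonneg hs
          (fun _ _ _ => by positivity)).trans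
          (Finset.sum_le_sum_of_subset_of_nonneg hs fun _ _ _ => ?_)
        exact Finset.sum_nonneg fun _ _ => by positivity
    _ ≤ ∑ a ∈ Icc 1 A, (N * A * ((a.divisors.card : ℝ) / a) + A) := by
        apply Finset.sum_le_sum
        intro a ha
        have ha0 := (mem_Icc.1 ha).1
        rw [Finset.sum_add_distrib]
        apply add_le_add
        · rw [← Finset.sum_div, ← Finset.mul_sum]
          have := sum_gcd_le A a ha0
          have h2 : ∑ a' ∈ Icc 1 A, (Nat.gcd a a' : ℝ) ≤ A * a.divisors.card := by exact_mod_cast this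
          calc _ ≤ N * (A * a.divisors.card : ℝ) / a := by gcongr
            _ = _ := by ring
        · simp
    _ = _ := by
        rw [Finset.sum_add_distrib, ← Finset.mul_sum]
        simp; ring

end HB
end

section
open Finset
namespace HB

theorem shift_le (f : ℕ → ℝ) (hf : ∀ n, |f n| ≤ 1) (H N h : ℕ) :
    |∑ n ∈ range N, f (H + n) - ∑ n ∈ range N, f (H + n + h)| ≤ 2 * h := by
  induction h with
  | zero => simp
  | succ h ih =>
    have h1 : ∑ n ∈ range N, f (H + n + (h + 1)) =
        ∑ n ∈ range N, f (H + n + h) + f (H + N + h) - f (H + h) := by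
      have e1 := Finset.sum_range_succ (fun n => f (H + n + h)) N
      have e2 := Finset.sum_range_succ' (fun n => f (H + n + h)) N
      have e3 : ∀ n, H + n + (h + 1) = H + (n + 1) + h := fun n => by ring
      simp only [e3]
      simp only [add_zero] at e2
      linarith
    rw [h1]
    have a1 := abs_le.1 (hf (H + N + h))
    have a2 := abs_le.1 (hf (H + h))
    have a3 := abs_le.1 ih
    push_cast
    rw [abs_le]
    constructor <;> linarith [a1.1, a1.2, a2.1, a2.2, a3.1, a3.2]

theorem alg8 (S1 S2 S4 S8 K Q : ℝ) (hK0 : 0 ≤ K) (h20 : 0 ≤ S2) (h40 : 0 ≤ S4)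
    (h1 : S1 ^ 2 ≤ K * S2) (h2 : S2 ^ 2 ≤ K * S4) (h4 : S4 ^ 2 ≤ Q * S8) :
    S1 ^ 8 ≤ K ^ 6 * Q * S8 := by
  calc S1 ^ 8 = (S1 ^ 2) ^ 4 := by ring
    _ ≤ (K * S2) ^ 4 := pow_le_pow_left₀ (by positivity) h1 4
    _ = K ^ 4 * (S2 ^ 2) ^ 2 := by ring
    _ ≤ K ^ 4 * (K * S4) ^ 2 := by gcongr
    _ = K ^ 6 * S4 ^ 2 := by ring
    _ ≤ K ^ 6 * (Q * S8) := by gcongr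
    _ = _ := by ring

theorem pair_holder {ι : Type*} (P : Finset ι) (x : ι → ℕ) (q : ℕ) (hx : ∀ i ∈ P, x i < q)
    (F : ℕ → ℝ) (hF : ∀ n, 0 ≤ F n) (Q : ℝ)
    (hQ : ∑ i ∈ P, ((P.filter fun j => x i = x j).card : ℝ) ≤ Q) :
    (∑ i ∈ P, F (x i)) ^ 8 ≤ (P.card : ℝ) ^ 6 * Q * ∑ n ∈ range q, F n ^ 8 := by
  classical
  set ν : ℕ → ℝ := fun n => ((P.filter fun j => n = x j).card : ℝ) with hν
  have hν0 : ∀ n, 0 ≤ ν n := fun n => by positivity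
  have hsum : ∀ g : ℕ → ℝ, ∑ i ∈ P, g (x i) = ∑ n ∈ range q, ν n * g n := by
    intro g
    rw [← Finset.sum_fiberwise_of_maps_to (s := P) (t := range q) (g := x)
      (fun i hi => mem_range.2 (hx i hi))]
    apply Finset.sum_congr rfl
    intro n _
    rw [Finset.sum_congr rfl (g := fun _ => g n)
      (fun i hi => by rw [(mem_filter.1 hi).2])]
    rw [Finset.sum_const, nsmul_eq_mul]
    simp only [hν, eq_comm]
  have hA : (P.card : ℝ) = ∑ n ∈ range q, ν n := by
    have := hsum fun _ => 1
    simpa using this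
  have hB : ∑ n ∈ range q, ν n ^ 2 ≤ Q := by
    have := hsum ν
    simp only [sq]
    rw [← this]; exact hQ
  have cs : ∀ u v : ℕ → ℝ, (∑ n ∈ range q, u n * v n) ^ 2 ≤
      (∑ n ∈ range q, u n ^ 2) * ∑ n ∈ range q, v n ^ 2 := fun u v =>
    Finset.sum_mul_sq_le_sq_mul_sq _ _ _
  have cs' : ∀ g : ℕ → ℝ, (∑ n ∈ range q, ν n * g n) ^ 2 ≤
      (P.card : ℝ) * ∑ n ∈ range q, ν n * g n ^ 2 := by
    intro g
    have := cs (fun n => √(ν n)) (fun n => √(ν n) * g n)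
    have e1 : ∀ n, √(ν n) * (√(ν n) * g n) = ν n * g n := by
      intro n; rw [← mul_assoc, Real.mul_self_sqrt (hν0 n)]
    have e2 : ∀ n, (√(ν n) * g n) ^ 2 = ν n * g n ^ 2 := by
      intro n; rw [mul_pow, Real.sq_sqrt (hν0 n)]
    simp only [e1, e2, Real.sq_sqrt (hν0 _)] at this
    rw [hA]; exact this
  set K : ℝ := ((P.card : ℕ) : ℝ) with hK
  have hK0 : 0 ≤ K := by positivity
  rw [hsum F]
  set S1 := ∑ n ∈ range q, ν n * F n
  set S2 := ∑ n ∈ range q, ν n * F n ^ 2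
  set S4 := ∑ n ∈ range q, ν n * F n ^ 4
  set S8 := ∑ n ∈ range q, F n ^ 8
  have h1 : S1 ^ 2 ≤ K * S2 := cs' F
  have h2 : S2 ^ 2 ≤ K * S4 := by
    have := cs' (fun n => F n ^ 2)
    simpa only [← pow_mul] using this
  have h4 : S4 ^ 2 ≤ Q * S8 := by
    have h5 := cs ν (fun n => F n ^ 4)
    simp only [← pow_mul] at h5
    exact h5.trans (mul_le_mul_of_nonneg_right hB (Finset.sum_nonneg fun n _ => pow_nonneg (hF n) _))
  have h20 : 0 ≤ S2 := Finset.sum_nonneg fun n _ => mul_nonneg (hν0 n) (by positivity)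
  have h40 : 0 ≤ S4 := Finset.sum_nonneg fun n _ => mul_nonneg (hν0 n) (by positivity)
  exact alg8 S1 S2 S4 S8 K Q hK0 h20 h40 h1 h2 h4

theorem pairs_eq (X Y : Finset ℕ) (f : ℕ × ℕ → ℕ) :
    ∑ i ∈ X ×ˢ Y, (((X ×ˢ Y).filter fun j => f i = f j).card : ℝ) =
    ∑ a ∈ X, ∑ a' ∈ X, (((Y ×ˢ Y).filter fun nn => f (a, nn.1) = f (a', nn.2)).card : ℝ) := by
  simp only [Finset.card_filter, Finset.sum_product]
  push_cast
  apply Finset.sum_congr rfl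
  intro a _
  rw [Finset.sum_comm]

theorem abs_pow8 (a : ℝ) (b : ℤ) (h : a = (b : ℝ)) : |a| ^ 8 = (b : ℝ) ^ 8 := by
  rw [h, show (8:ℕ) = 2 * 4 by norm_num, pow_mul, sq_abs, ← pow_mul]

theorem burgess_ineq (q H A M N : ℕ) (hq : Squarefree q) (hM : 0 < M) (hAN : 2 * A * N ≤ q) :
    ∃ V : ℝ, 0 ≤ V ∧
      |∑ n ∈ range N, (jacobiSym ((H + n : ℕ) : ℤ) q : ℝ)| * ((AA q A).card * M) ≤
        V + 2 * A * M * ((AA q A).card * M) ∧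
      V ^ 8 ≤ (((AA q A).card : ℝ) * N) ^ 6 *
        (A ^ 2 + N * A * ∑ a ∈ Icc 1 A, (a.divisors.card : ℝ) / a) *
        (65536 * (M:ℝ) ^ 4 * q + 17496 * (M:ℝ) ^ 8 * √q * (q.divisors.card : ℝ) ^ 14) := by
  classical
  have hq0 := hq.ne_zero
  set F : ℕ → ℝ := fun x => |∑ b ∈ range M, (jacobiSym ((x + b : ℕ) : ℤ) q : ℝ)| with hFdef
  set P := AA q A ×ˢ range N with hP
  set S := ∑ n ∈ range N, (jacobiSym ((H + n : ℕ) : ℤ) q : ℝ) with hS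
  have hmem : ∀ a ∈ AA q A, 0 < a ∧ a ≤ A ∧ a.Coprime q := by
    intro a ha
    have := mem_filter.1 ha
    have h2 := mem_Icc.1 this.1
    exact ⟨h2.1, h2.2, this.2⟩
  refine ⟨∑ i ∈ P, F (xx q H i.1 i.2), Finset.sum_nonneg fun _ _ => abs_nonneg _, ?_, ?_⟩
  · have h1 : ∀ a ∈ AA q A, ∀ b ∈ range M,
        |S - ∑ n ∈ range N, (jacobiSym ((H + n + a * b : ℕ) : ℤ) q : ℝ)| ≤ 2 * A * M := by
      intro a ha b hb
      have := shift_le (fun n => (jacobiSym ((n : ℕ) : ℤ) q : ℝ))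
        (fun n => by exact_mod_cast abs_jacobi_le _ _) H N (a * b)
      refine this.trans ?_
      have e1 : (a:ℝ) ≤ A := by exact_mod_cast (hmem a ha).2.1
      have e2 : (b:ℝ) ≤ M := by exact_mod_cast (mem_range.1 hb).le
      push_cast
      have : (a:ℝ) * b ≤ A * M := by gcongr
      linarith
    have h2 : |∑ a ∈ AA q A, ∑ b ∈ range M,
        (S - ∑ n ∈ range N, (jacobiSym ((H + n + a * b : ℕ) : ℤ) q : ℝ))| ≤
        2 * A * M * ((AA q A).card * M) := by
      refine (Finset.abs_sum_le_sum_abs _ _).trans ?_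
      calc _ ≤ ∑ a ∈ AA q A, ∑ b ∈ range M, (2 * A * M : ℝ) := by
            apply Finset.sum_le_sum
            intro a ha
            refine (Finset.abs_sum_le_sum_abs _ _).trans ?_
            exact Finset.sum_le_sum fun b hb => h1 a ha b hb
        _ = _ := by simp; ring
    have h3 : |∑ a ∈ AA q A, ∑ b ∈ range M,
        ∑ n ∈ range N, (jacobiSym ((H + n + a * b : ℕ) : ℤ) q : ℝ)| ≤
        ∑ i ∈ P, F (xx q H i.1 i.2) := by
      rw [hP, Finset.sum_product]
      refine (Finset.abs_sum_le_sum_abs _ _).trans ?_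
      apply Finset.sum_le_sum
      intro a ha
      rw [Finset.sum_comm]
      refine (Finset.abs_sum_le_sum_abs _ _).trans ?_
      apply Finset.sum_le_sum
      intro n _
      have : ∀ b, (jacobiSym ((H + n + a * b : ℕ) : ℤ) q : ℝ) =
          jacobiSym (a : ℤ) q * (jacobiSym ((xx q H a n + b : ℕ) : ℤ) q : ℝ) := by
        intro b
        rw [jac_shift q H a n b hq0 (hmem a ha).2.2]; push_cast; rfl
      simp only [this]
      rw [← Finset.mul_sum, abs_mul]
      have hj : |(jacobiSym (a : ℤ) q : ℝ)| ≤ 1 := by exact_mod_cast abs_jacobi_le _ _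
      exact mul_le_of_le_one_left (abs_nonneg _) hj
    have h4 : ∑ a ∈ AA q A, ∑ b ∈ range M,
        (S - ∑ n ∈ range N, (jacobiSym ((H + n + a * b : ℕ) : ℤ) q : ℝ)) =
        S * ((AA q A).card * M) - ∑ a ∈ AA q A, ∑ b ∈ range M,
        ∑ n ∈ range N, (jacobiSym ((H + n + a * b : ℕ) : ℤ) q : ℝ) := by
      simp only [Finset.sum_sub_distrib]
      simp; ring
    rw [h4] at h2
    have h5 : |S| * ((AA q A).card * M) = |S * ((AA q A).card * M)| := by
      rw [abs_mul, abs_of_nonneg (a := ((AA q A).card * M : ℝ)) (by positivity)]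
    rw [h5]
    have := abs_sub_abs_le_abs_sub (S * ((AA q A).card * M)) (∑ a ∈ AA q A, ∑ b ∈ range M,
        ∑ n ∈ range N, (jacobiSym ((H + n + a * b : ℕ) : ℤ) q : ℝ))
    linarith
  · have h1 := pair_holder P (fun i => xx q H i.1 i.2) q (fun i _ => xx_lt q H _ _ hq0) F
      (fun _ => abs_nonneg _) (A ^ 2 + N * A * ∑ a ∈ Icc 1 A, (a.divisors.card : ℝ) / a) (by
        refine le_trans (le_of_eq ?_) (sum_pairs_le q H A N hq0 hAN)
        exact pairs_eq (AA q A) (range N) (fun i => xx q H i.1 i.2))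
    have hc : (P.card : ℝ) = (AA q A).card * N := by
      rw [hP, card_product]; simp
    rw [hc] at h1
    refine h1.trans ?_
    apply mul_le_mul_of_nonneg_left
    · have := moment8 q M hq hM
      refine le_trans (le_of_eq ?_) this
      apply Finset.sum_congr rfl
      intro x _
      exact abs_pow8 _ _ (by push_cast; rfl)
    · have : 0 ≤ ∑ a ∈ Icc 1 A, (a.divisors.card : ℝ) / a :=
        Finset.sum_nonneg fun _ _ => by positivity
      exact mul_nonneg (pow_nonneg (mul_nonneg (Nat.cast_nonneg _) (Nat.cast_nonneg _)) _)
        (add_nonneg (sq_nonneg _) (mul_nonneg (mul_nonneg (Nat.cast_nonneg _) (Nat.cast_nonneg _)) this))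

end HB
end

section
open Finset
namespace HB

theorem moebius_ind (n P : ℕ) (hP : P ≠ 0) :
    (if n.Coprime P then (1:ℝ) else 0) =
      ∑ g ∈ P.divisors, if g ∣ n then (ArithmeticFunction.moebius g : ℝ) else 0 := by
  rw [← Finset.sum_filter]
  have h1 : P.divisors.filter (fun g => g ∣ n) = (Nat.gcd n P).divisors := by
    ext g
    simp only [mem_filter, Nat.mem_divisors]
    constructor
    · rintro ⟨⟨h1, _⟩, h2⟩
      exact ⟨Nat.dvd_gcd h2 h1, Nat.gcd_ne_zero_right hP⟩
    · rintro ⟨h1, _⟩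
      exact ⟨⟨h1.trans (Nat.gcd_dvd_right _ _), hP⟩, h1.trans (Nat.gcd_dvd_left _ _)⟩
  rw [h1]
  have h2 := congrArg (fun f : ArithmeticFunction ℤ => f (Nat.gcd n P))
    ArithmeticFunction.coe_zeta_mul_moebius
  simp only [ArithmeticFunction.coe_zeta_mul_apply, ArithmeticFunction.one_apply] at h2
  have h3 : ((∑ i ∈ (Nat.gcd n P).divisors, ArithmeticFunction.moebius i : ℤ) : ℝ) =
    ((if Nat.gcd n P = 1 then 1 else 0 : ℤ) : ℝ) := by rw [h2]
  push_cast at h3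
  rw [h3]

theorem sum_multiples (f : ℕ → ℝ) (y g : ℕ) (hg : 0 < g) :
    ∑ n ∈ Icc 1 y, (if g ∣ n then f n else 0) = ∑ n ∈ Icc 1 (y / g), f (g * n) := by
  rw [← Finset.sum_filter]
  symm
  refine Finset.sum_bij (fun n _ => g * n) ?_ ?_ ?_ ?_
  · intro n hn
    have := mem_Icc.1 hn
    refine mem_filter.2 ⟨mem_Icc.2 ⟨Nat.mul_pos hg this.1, ?_⟩, dvd_mul_right _ _⟩
    calc g * n ≤ g * (y / g) := Nat.mul_le_mul_left _ this.2
      _ ≤ y := Nat.mul_div_le _ _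
  · intro a _ b _ h
    exact Nat.eq_of_mul_eq_mul_left hg h
  · intro b hb
    have h1 := mem_filter.1 hb
    obtain ⟨c, rfl⟩ := h1.2
    have h2 := mem_Icc.1 h1.1
    refine ⟨c, mem_Icc.2 ⟨Nat.pos_of_ne_zero (by rintro rfl; simp at h2), ?_⟩, rfl⟩
    rw [Nat.le_div_iff_mul_le hg, mul_comm]; exact h2.2
  · intros; rfl

theorem sum_coprime (f : ℕ → ℝ) (P y : ℕ) (hP : P ≠ 0) :
    ∑ n ∈ Icc 1 y, (if n.Coprime P then f n else 0) =
      ∑ g ∈ P.divisors, (ArithmeticFunction.moebius g : ℝ) * ∑ n ∈ Icc 1 (y / g), f (g * n) := by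
  have h1 : ∀ n, (if n.Coprime P then f n else 0) =
      ∑ g ∈ P.divisors, (ArithmeticFunction.moebius g : ℝ) * (if g ∣ n then f n else 0) := by
    intro n
    have := moebius_ind n P hP
    calc (if n.Coprime P then f n else 0) = (if n.Coprime P then (1:ℝ) else 0) * f n := by
          split_ifs <;> simp
      _ = _ := by
          rw [this, Finset.sum_mul]
          apply Finset.sum_congr rfl
          intro g _
          split_ifs <;> simp
  simp only [h1]
  rw [Finset.sum_comm]
  apply Finset.sum_congr rfl
  intro g hg
  rw [← Finset.mul_sum, sum_multiples f y g (Nat.pos_of_mem_divisors hg)]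

/-- density of integers coprime to `P` -/
noncomputable def rho (P : ℕ) : ℝ := ∑ g ∈ P.divisors, (ArithmeticFunction.moebius g : ℝ) / g

theorem abs_moeb_le (g : ℕ) : |(ArithmeticFunction.moebius g : ℝ)| ≤ 1 := by
  exact_mod_cast ArithmeticFunction.abs_moebius_le_one

theorem count_coprime (P y : ℕ) (hP : P ≠ 0) :
    |∑ n ∈ Icc 1 y, (if n.Coprime P then (1:ℝ) else 0) - rho P * y| ≤ P.divisors.card := by
  rw [sum_coprime (fun _ => 1) P y hP, rho, Finset.sum_mul, ← Finset.sum_sub_distrib]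
  refine (Finset.abs_sum_le_sum_abs _ _).trans ?_
  have hc : ((P.divisors.card : ℕ) : ℝ) = ∑ _g ∈ P.divisors, (1:ℝ) := by simp
  rw [hc]
  apply Finset.sum_le_sum
  intro g hg
  have hg0 : (0:ℝ) < g := by exact_mod_cast Nat.pos_of_mem_divisors hg
  have : (ArithmeticFunction.moebius g : ℝ) * ∑ n ∈ Icc 1 (y / g), (1:ℝ) -
      ArithmeticFunction.moebius g / g * y =
      ArithmeticFunction.moebius g * (((y / g : ℕ) : ℝ) - (y:ℝ) / g) := by
    simp; field_simp
  rw [this, abs_mul]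
  have h2 : |((y / g : ℕ) : ℝ) - (y:ℝ) / g| ≤ 1 := by
    have h3 := Nat.cast_div_le (α := ℝ) (m := y) (n := g)
    have h4 : (y:ℝ) / g < (y / g : ℕ) + 1 := by
      rw [div_lt_iff₀ hg0]
      have := Nat.lt_mul_div_succ y (Nat.pos_of_mem_divisors hg)
      rw [mul_comm]
      exact_mod_cast this
    rw [abs_le]; constructor <;> linarith
  calc _ ≤ (1:ℝ) * 1 := mul_le_mul (abs_moeb_le g) h2 (abs_nonneg _) zero_le_one
    _ = 1 := one_mul 1

theorem rho_eq (P : ℕ) (hP : P ≠ 0) : rho P * P = (P.totient : ℝ) := by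
  have h1 := sum_coprime (fun _ => 1) P P hP
  have h2 : (P.totient : ℝ) = ∑ n ∈ Icc 1 P, (if n.Coprime P then (1:ℝ) else 0) := by
    rw [← Nat.filter_coprime_Ico_eq_totient P 1, Finset.card_filter, add_comm 1 P]
    push_cast
    apply Finset.sum_congr
    · ext; simp
    · intro x _; simp only [Nat.coprime_comm]
  rw [h2, h1, rho, Finset.sum_mul]
  apply Finset.sum_congr rfl
  intro g hg
  obtain ⟨c, hc⟩ := Nat.dvd_of_mem_divisors hg
  have hg0 : 0 < g := Nat.pos_of_mem_divisors hg
  have : P / g = c := by rw [hc, Nat.mul_div_cancel_left _ hg0]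
  have h3 : (g:ℝ) ≠ 0 := by exact_mod_cast hg0.ne'
  rw [this, hc]
  simp
  field_simp

theorem rho_ge (P : ℕ) (hP : P ≠ 0) : 1 ≤ rho P * P.divisors.card := by
  have h0 : (0:ℝ) < P := by exact_mod_cast Nat.pos_of_ne_zero hP
  have h1 : (P.totient : ℝ) = P * ∏ p ∈ P.primeFactors, (1 - (p : ℝ)⁻¹) := by
    have := Nat.totient_eq_mul_prod_factors P
    have h := congrArg (fun x : ℚ => (x:ℝ)) this
    push_cast at h
    exact h
  have h2 : rho P = ∏ p ∈ P.primeFactors, (1 - (p : ℝ)⁻¹) := by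
    have := rho_eq P hP
    rw [h1, mul_comm] at this
    exact mul_left_cancel₀ h0.ne' this
  have h3 : ((1:ℝ)/2) ^ P.primeFactors.card ≤ rho P := by
    rw [h2, ← Finset.prod_const]
    apply Finset.prod_le_prod
    · intros; norm_num
    · intro p hp
      have : (2:ℝ) ≤ p := by exact_mod_cast (Nat.prime_of_mem_primeFactors hp).two_le
      have : (p:ℝ)⁻¹ ≤ 2⁻¹ := inv_anti₀ (by norm_num) this
      linarith
  have h4 := pow_omega_le 1 P hP
  simp only [pow_one] at h4
  have h5 : (2:ℝ) ^ P.primeFactors.card ≤ P.divisors.card := by exact_mod_cast h4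
  calc (1:ℝ) = ((1:ℝ)/2) ^ P.primeFactors.card * 2 ^ P.primeFactors.card := by
        rw [← mul_pow]; norm_num
    _ ≤ _ := mul_le_mul h3 h5 (by positivity) (le_trans (by positivity) h3)

theorem rho_le (P : ℕ) (hP : P ≠ 0) : rho P ≤ 1 := by
  have h0 : (0:ℝ) < P := by exact_mod_cast Nat.pos_of_ne_zero hP
  have := rho_eq P hP
  have h2 : (P.totient : ℝ) ≤ P := by exact_mod_cast Nat.totient_le P
  rw [← this] at h2
  exact le_of_mul_le_mul_right (by linarith) h0

theorem card_AA_ge (q A : ℕ) (hq : q ≠ 0) (hA : 2 * q.divisors.card ^ 2 ≤ A) :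
    (A : ℝ) ≤ 2 * q.divisors.card * (AA q A).card := by
  have h1 := (abs_le.1 (count_coprime q A hq)).1
  have h2 := rho_ge q hq
  have h3 : ((AA q A).card : ℝ) = ∑ n ∈ Icc 1 A, (if n.Coprime q then (1:ℝ) else 0) := by
    rw [AA, Finset.card_filter]; push_cast; rfl
  rw [← h3] at h1
  have hA' : 2 * (q.divisors.card:ℝ) ^ 2 ≤ A := by exact_mod_cast hA
  set d : ℝ := (q.divisors.card:ℝ)
  have hd : 0 ≤ d := by positivity
  have : (A:ℝ) ≤ rho q * d * A := le_mul_of_one_le_left (by positivity) h2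
  nlinarith

theorem sum_inv_le (A : ℕ) : ∑ a ∈ Icc 1 A, (1:ℝ) / a ≤ 1 + Real.log A := by
  have := harmonic_le_one_add_log A
  rw [harmonic_eq_sum_Icc] at this
  push_cast at this
  simpa using this

theorem sum_div_over_le (ε : ℝ) (hε : 0 < ε) : ∃ C : ℝ, 0 < C ∧ ∀ A : ℕ,
    ∑ a ∈ Icc 1 A, (a.divisors.card : ℝ) / a ≤ C * (A:ℝ) ^ ε := by
  obtain ⟨C, hC, h⟩ := div_bound (ε/2) (by positivity)
  refine ⟨C * (1 + 1 / (ε / 2)), by positivity, fun A => ?_⟩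
  rcases Nat.eq_zero_or_pos A with rfl | hA
  · simp; positivity
  have hA1 : (1:ℝ) ≤ A := by exact_mod_cast hA
  have h1 : ∑ a ∈ Icc 1 A, (a.divisors.card : ℝ) / a ≤ ∑ a ∈ Icc 1 A, C * (A:ℝ)^(ε/2) * (1 / a) := by
    apply Finset.sum_le_sum
    intro a ha
    have ha' := mem_Icc.1 ha
    have ha0 : (0:ℝ) < a := by exact_mod_cast ha'.1
    rw [div_eq_mul_one_div]
    apply mul_le_mul_of_nonneg_right _ (by positivity)
    refine (h a (by omega)).trans ?_
    have : (a:ℝ) ≤ A := by exact_mod_cast ha'.2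
    gcongr
  refine h1.trans ?_
  rw [← Finset.mul_sum]
  have h2 := sum_inv_le A
  have h3 := Real.log_le_rpow_div (x := A) (by positivity) (ε := ε/2) (by positivity)
  have h4 : (1:ℝ) ≤ (A:ℝ)^(ε/2) := Real.one_le_rpow hA1 (by positivity)
  have h5 : (A:ℝ)^ε = (A:ℝ)^(ε/2) * (A:ℝ)^(ε/2) := by
    rw [← Real.rpow_add (by positivity)]; ring_nf
  rw [h5]
  calc _ ≤ C * (A:ℝ)^(ε/2) * ((A:ℝ)^(ε/2) * (1 + 1 / (ε / 2))) := by
        apply mul_le_mul_of_nonneg_left _ (by positivity)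
        refine h2.trans ?_
        rw [mul_add, mul_one_div]
        linarith
    _ = _ := by ring

end HB
end

section
open Finset
namespace HB

theorem burgess_real (Q A M N a V S d C1 C2 T : ℝ) (hQ : 1 ≤ Q)
    (hN : Q ^ (13/40:ℝ) ≤ N) (hM1 : Q ^ (1/8:ℝ) / 2 ≤ M) (hM2 : M ≤ Q ^ (1/8:ℝ))
    (hA1 : Q ^ (19/100:ℝ) / 2 ≤ A) (hA2 : A ≤ Q ^ (19/100:ℝ)) (ha0 : 0 < a) (ha : A ≤ 2 * d * a)
    (hd1 : 1 ≤ d) (hd : d ≤ C1 * Q ^ (1/10000:ℝ)) (hT : T ≤ C2 * A ^ (1/10000:ℝ)) (hC1 : 1 ≤ C1)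
    (hC2 : 0 ≤ C2) (hV : 0 ≤ V) (h1 : S * (a * M) ≤ V + 2 * A * M * (a * M))
    (h2 : V ^ 8 ≤ (a * N) ^ 6 * (A ^ 2 + N * A * T) *
      (65536 * M ^ 4 * Q + 17496 * M ^ 8 * √Q * d ^ 14)) :
    S ≤ ((1 + C2) * (65536 + 17496 * C1 ^ 14) * (2048 * C1 ^ 2) + 2) * (N * Q ^ (-(1/1000):ℝ)) := by
  have hQ0 : 0 < Q := by linarith
  have hpos : ∀ x : ℝ, 0 < Q ^ x := fun x => Real.rpow_pos_of_pos hQ0 x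
  have hmono : ∀ x y : ℝ, x ≤ y → Q ^ x ≤ Q ^ y := fun x y h => Real.rpow_le_rpow_of_exponent_le hQ h
  have hadd : ∀ x y : ℝ, Q ^ x * Q ^ y = Q ^ (x + y) := fun x y => (Real.rpow_add hQ0 x y).symm
  have hpw : ∀ (x : ℝ) (n : ℕ), (Q ^ x) ^ n = Q ^ (x * n) := fun x n => by
    rw [← Real.rpow_natCast, ← Real.rpow_mul hQ0.le]
  have hA0 : 0 < A := lt_of_lt_of_le (by have := hpos (19/100); linarith) hA1
  have hM0 : 0 < M := lt_of_lt_of_le (by have := hpos (1/8); linarith) hM1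
  have hN0 : 0 < N := lt_of_lt_of_le (hpos _) hN
  set C3 := (1 + C2) * (65536 + 17496 * C1 ^ 14) * (2048 * C1 ^ 2) with hC3
  have hAN : A ≤ N := hA2.trans ((hmono _ _ (by norm_num)).trans hN)
  have hAe : A ^ (1/10000:ℝ) ≤ Q ^ (1/10000:ℝ) := by
    apply Real.rpow_le_rpow hA0.le _ (by norm_num)
    calc A ≤ Q ^ (19/100:ℝ) := hA2
      _ ≤ Q ^ (1:ℝ) := hmono _ _ (by norm_num)
      _ = Q := Real.rpow_one Q
  have hT' : T ≤ C2 * Q ^ (1/10000:ℝ) := hT.trans (mul_le_mul_of_nonneg_left hAe hC2)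
  have hq1 : 1 ≤ Q ^ (1/10000:ℝ) := Real.one_le_rpow hQ (by norm_num)
  have e1 : A ^ 2 + N * A * T ≤ N * A * ((1 + C2) * Q ^ (1/10000:ℝ)) := by
    have x1 : A ^ 2 ≤ N * A * Q ^ (1/10000:ℝ) := by
      calc A ^ 2 = A * A * 1 := by ring
        _ ≤ N * A * Q ^ (1/10000:ℝ) := by gcongr
    have x2 : N * A * T ≤ N * A * (C2 * Q ^ (1/10000:ℝ)) := by gcongr
    linarith
  have hM4 : M ^ 4 * Q ≤ Q ^ (3/2:ℝ) := by
    calc M ^ 4 * Q ≤ (Q ^ (1/8:ℝ)) ^ 4 * Q ^ (1:ℝ) := by rw [Real.rpow_one]; gcongr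
      _ = Q ^ (3/2:ℝ) := by rw [hpw, hadd]; norm_num
  have hM8 : M ^ 8 * √Q ≤ Q ^ (3/2:ℝ) := by
    calc M ^ 8 * √Q ≤ (Q ^ (1/8:ℝ)) ^ 8 * Q ^ (1/2:ℝ) := by rw [Real.sqrt_eq_rpow]; gcongr
      _ = Q ^ (3/2:ℝ) := by rw [hpw, hadd]; norm_num
  have hd14 : d ^ 14 ≤ C1 ^ 14 * Q ^ (14/10000:ℝ) := by
    calc d ^ 14 ≤ (C1 * Q ^ (1/10000:ℝ)) ^ 14 := by gcongr
      _ = _ := by rw [mul_pow, hpw]; norm_num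
  have e2 : 65536 * M ^ 4 * Q + 17496 * M ^ 8 * √Q * d ^ 14 ≤
      (65536 + 17496 * C1 ^ 14) * Q ^ (15014/10000:ℝ) := by
    have x1 : 65536 * M ^ 4 * Q ≤ 65536 * Q ^ (15014/10000:ℝ) := by
      have := hmono (3/2) (15014/10000) (by norm_num)
      linarith
    have x2 : 17496 * M ^ 8 * √Q * d ^ 14 ≤ 17496 * C1 ^ 14 * Q ^ (15014/10000:ℝ) := by
      calc 17496 * M ^ 8 * √Q * d ^ 14 = 17496 * (M ^ 8 * √Q) * d ^ 14 := by ring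
        _ ≤ 17496 * Q ^ (3/2:ℝ) * (C1 ^ 14 * Q ^ (14/10000:ℝ)) := by gcongr
        _ = 17496 * C1 ^ 14 * (Q ^ (3/2:ℝ) * Q ^ (14/10000:ℝ)) := by ring
        _ = _ := by rw [hadd]; norm_num
    linarith
  have e3 : V ^ 8 ≤ (a * N) ^ 6 * (N * A * ((1 + C2) * Q ^ (1/10000:ℝ))) *
      ((65536 + 17496 * C1 ^ 14) * Q ^ (15014/10000:ℝ)) := by
    refine h2.trans ?_
    have : 0 ≤ 65536 * M ^ 4 * Q + 17496 * M ^ 8 * √Q * d ^ 14 := by positivity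
    calc _ ≤ (a * N) ^ 6 * (N * A * ((1 + C2) * Q ^ (1/10000:ℝ))) *
      (65536 * M ^ 4 * Q + 17496 * M ^ 8 * √Q * d ^ 14) := by gcongr
      _ ≤ _ := by gcongr
  -- key
  have hM8' : Q ^ (1:ℝ) ≤ 256 * M ^ 8 := by
    calc Q ^ (1:ℝ) = (Q ^ (1/8:ℝ)) ^ 8 := by rw [hpw]; norm_num
      _ ≤ (2 * M) ^ 8 := by gcongr; linarith
      _ = _ := by ring
  have ha2 : A * Q ^ (19/100:ℝ) ≤ 8 * C1 ^ 2 * Q ^ (2/10000:ℝ) * a ^ 2 := by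
    calc A * Q ^ (19/100:ℝ) ≤ A * (2 * A) := by gcongr; linarith
      _ = 2 * A ^ 2 := by ring
      _ ≤ 2 * (2 * d * a) ^ 2 := by gcongr
      _ = 8 * d ^ 2 * a ^ 2 := by ring
      _ ≤ 8 * (C1 * Q ^ (1/10000:ℝ)) ^ 2 * a ^ 2 := by gcongr
      _ = _ := by
          have : (Q ^ (1/10000:ℝ)) ^ 2 = Q ^ (2/10000:ℝ) := by rw [hpw]; norm_num
          rw [mul_pow, this]; ring
  have key : A * (Q ^ (1/10000:ℝ) * Q ^ (15014/10000:ℝ)) ≤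
      2048 * C1 ^ 2 * (N * a ^ 2 * M ^ 8 * Q ^ (-(8/1000):ℝ)) := by
    have x1 : A * (Q ^ (1/10000:ℝ) * Q ^ (15014/10000:ℝ)) ≤
        (A * Q ^ (19/100:ℝ)) * (Q ^ (13/40:ℝ) * Q ^ (1:ℝ) * Q ^ (-(8/1000):ℝ) * Q ^ (-(2/10000):ℝ)) := by
      have : (A * Q ^ (19/100:ℝ)) * (Q ^ (13/40:ℝ) * Q ^ (1:ℝ) * Q ^ (-(8/1000):ℝ) * Q ^ (-(2/10000):ℝ))
        = A * (Q ^ (19/100:ℝ) * (Q ^ (13/40:ℝ) * Q ^ (1:ℝ) * Q ^ (-(8/1000):ℝ) * Q ^ (-(2/10000):ℝ))) := by ring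
      rw [this]
      apply mul_le_mul_of_nonneg_left _ hA0.le
      simp only [hadd]
      apply hmono; norm_num
    refine x1.trans ?_
    calc _ ≤ (8 * C1 ^ 2 * Q ^ (2/10000:ℝ) * a ^ 2) *
          (N * (256 * M ^ 8) * Q ^ (-(8/1000):ℝ) * Q ^ (-(2/10000):ℝ)) := by gcongr
      _ = 2048 * C1 ^ 2 * (N * a ^ 2 * M ^ 8 * Q ^ (-(8/1000):ℝ)) *
          (Q ^ (2/10000:ℝ) * Q ^ (-(2/10000):ℝ)) := by ring
      _ = _ := by rw [hadd]; norm_num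
  have hC3' : 1 ≤ C3 := by
    rw [hC3]
    have : 1 ≤ C1 ^ 14 := one_le_pow₀ hC1
    have h3 : 1 ≤ C1 ^ 2 := one_le_pow₀ hC1
    apply one_le_mul_of_one_le_of_one_le
    · apply one_le_mul_of_one_le_of_one_le <;> linarith
    · linarith
  have e4 : V ^ 8 ≤ (C3 * (N * Q ^ (-(1/1000):ℝ)) * (a * M)) ^ 8 := by
    calc V ^ 8 ≤ _ := e3
      _ = (a * N) ^ 6 * N * (1 + C2) * (65536 + 17496 * C1 ^ 14) *
          (A * (Q ^ (1/10000:ℝ) * Q ^ (15014/10000:ℝ))) := by ring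
      _ ≤ (a * N) ^ 6 * N * (1 + C2) * (65536 + 17496 * C1 ^ 14) *
          (2048 * C1 ^ 2 * (N * a ^ 2 * M ^ 8 * Q ^ (-(8/1000):ℝ))) := by gcongr
      _ = C3 * (N ^ 8 * Q ^ (-(8/1000):ℝ) * (a * M) ^ 8) := by rw [hC3]; ring
      _ ≤ C3 ^ 8 * (N ^ 8 * Q ^ (-(8/1000):ℝ) * (a * M) ^ 8) := by
          gcongr
          exact le_self_pow₀ hC3' (by norm_num)
      _ = _ := by
          have : Q ^ (-(8/1000):ℝ) = (Q ^ (-(1/1000):ℝ)) ^ 8 := by rw [hpw]; norm_num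
          rw [this]; ring
  have e5 : V ≤ C3 * (N * Q ^ (-(1/1000):ℝ)) * (a * M) :=
    le_of_pow_le_pow_left₀ (by norm_num) (by positivity) e4
  have e6 : 2 * A * M ≤ 2 * (N * Q ^ (-(1/1000):ℝ)) := by
    have : A * M ≤ N * Q ^ (-(1/1000):ℝ) := by
      calc A * M ≤ Q ^ (19/100:ℝ) * Q ^ (1/8:ℝ) := by gcongr
        _ ≤ Q ^ (13/40:ℝ) * Q ^ (-(1/1000):ℝ) := by rw [hadd, hadd]; apply hmono; norm_num
        _ ≤ _ := by gcongr
    linarith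
  have haM : 0 < a * M := by positivity
  have : S * (a * M) ≤ (C3 + 2) * (N * Q ^ (-(1/1000):ℝ)) * (a * M) := by
    calc _ ≤ _ := h1
      _ ≤ C3 * (N * Q ^ (-(1/1000):ℝ)) * (a * M) + 2 * (N * Q ^ (-(1/1000):ℝ)) * (a * M) := by gcongr
      _ = _ := by ring
  exact le_of_mul_le_mul_right this haM

theorem burgess0 : ∃ C : ℝ, 1 ≤ C ∧ ∀ q H : ℕ, Squarefree q →
    |∑ n ∈ range ⌈(q:ℝ) ^ (13/40:ℝ)⌉₊, (jacobiSym ((H + n : ℕ) : ℤ) q : ℝ)| ≤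
      C * (⌈(q:ℝ) ^ (13/40:ℝ)⌉₊ * (q:ℝ) ^ (-(1/1000):ℝ)) := by
  obtain ⟨C1, hC1, hd⟩ := div_bound (1/10000) (by norm_num)
  obtain ⟨C2, hC2, hT⟩ := sum_div_over_le (1/10000) (by norm_num)
  have ev : ∀ᶠ Q : ℝ in Filter.atTop, 4 * Q ^ (515/1000:ℝ) ≤ Q ∧
      4 * C1 ^ 2 * Q ^ (2/10000:ℝ) ≤ Q ^ (19/100:ℝ) ∧ 1 ≤ Q := by
    have t1 := (tendsto_rpow_atTop (y := 485/1000) (by norm_num)).eventually_ge_atTop (4:ℝ)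
    have t2 := (tendsto_rpow_atTop (y := 1898/10000) (by norm_num)).eventually_ge_atTop (4 * C1 ^ 2)
    filter_upwards [t1, t2, Filter.eventually_ge_atTop 1] with Q h1 h2 h3
    have hQ0 : 0 < Q := by linarith
    refine ⟨?_, ?_, h3⟩
    · calc 4 * Q ^ (515/1000:ℝ) ≤ Q ^ (485/1000:ℝ) * Q ^ (515/1000:ℝ) := by gcongr
        _ = Q := by rw [← Real.rpow_add hQ0]; norm_num
    · calc 4 * C1 ^ 2 * Q ^ (2/10000:ℝ) ≤ Q ^ (1898/10000:ℝ) * Q ^ (2/10000:ℝ) := by gcongr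
        _ = _ := by rw [← Real.rpow_add hQ0]; norm_num
  obtain ⟨Q0, hQ0⟩ := Filter.eventually_atTop.1 ev
  set Ca := (1 + C2) * (65536 + 17496 * C1 ^ 14) * (2048 * C1 ^ 2) + 2 with hCa
  refine ⟨max 1 (max Ca Q0), le_max_left _ _, fun q H hq => ?_⟩
  set Q : ℝ := (q:ℝ) with hQdef
  have hq0 := hq.ne_zero
  have hQ1 : 1 ≤ Q := by rw [hQdef]; exact_mod_cast Nat.pos_of_ne_zero hq0
  set N := ⌈Q ^ (13/40:ℝ)⌉₊ with hN
  by_cases hlt : Q < Q0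
  · have h1 : |∑ n ∈ range N, (jacobiSym ((H + n : ℕ) : ℤ) q : ℝ)| ≤ N := by
      refine (Finset.abs_sum_le_sum_abs _ _).trans ?_
      calc _ ≤ ∑ n ∈ range N, (1:ℝ) := Finset.sum_le_sum fun n _ => by exact_mod_cast abs_jacobi_le _ _
        _ = N := by simp
    refine h1.trans ?_
    have h2 : 1 ≤ max 1 (max Ca Q0) * Q ^ (-(1/1000):ℝ) := by
      calc 1 = Q ^ (1/1000:ℝ) * Q ^ (-(1/1000):ℝ) := by
            rw [← Real.rpow_add (by linarith)]; norm_num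
        _ ≤ max 1 (max Ca Q0) * Q ^ (-(1/1000):ℝ) := by
            gcongr
            calc Q ^ (1/1000:ℝ) ≤ Q ^ (1:ℝ) := Real.rpow_le_rpow_of_exponent_le hQ1 (by norm_num)
              _ = Q := Real.rpow_one _
              _ ≤ Q0 := hlt.le
              _ ≤ _ := (le_max_right _ _).trans (le_max_right _ _)
    calc (N:ℝ) = N * 1 := by ring
      _ ≤ N * (max 1 (max Ca Q0) * Q ^ (-(1/1000):ℝ)) := by gcongr
      _ = _ := by ring
  push Not at hlt
  obtain ⟨g1, g2, -⟩ := hQ0 Q hlt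
  set A := ⌊Q ^ (19/100:ℝ)⌋₊ with hA
  set M := ⌊Q ^ (1/8:ℝ)⌋₊ with hM
  have fl : ∀ x : ℝ, 1 ≤ x → x / 2 ≤ (⌊x⌋₊ : ℝ) ∧ (⌊x⌋₊ : ℝ) ≤ x := by
    intro x hx
    have h1 := Nat.lt_floor_add_one x
    have h2 : (1:ℝ) ≤ ⌊x⌋₊ := by exact_mod_cast (Nat.le_floor (by exact_mod_cast hx) : 1 ≤ ⌊x⌋₊)
    exact ⟨by linarith, Nat.floor_le (by linarith)⟩
  have one_le : ∀ x : ℝ, 0 ≤ x → 1 ≤ Q ^ x := fun x hx => Real.one_le_rpow hQ1 hx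
  obtain ⟨hA1, hA2⟩ := fl _ (one_le (19/100) (by norm_num))
  obtain ⟨hM1, hM2⟩ := fl _ (one_le (1/8) (by norm_num))
  rw [← hA] at hA1 hA2
  rw [← hM] at hM1 hM2
  have hM0 : 0 < M := by
    have := one_le (1/8) (by norm_num)
    have h3 : (0:ℝ) < M := by linarith
    exact_mod_cast h3
  have hN1 : Q ^ (13/40:ℝ) ≤ N := Nat.le_ceil _
  have hN2 : (N:ℝ) ≤ 2 * Q ^ (13/40:ℝ) := by
    have := (Nat.ceil_lt_add_one (a := Q ^ (13/40:ℝ)) (by positivity)).le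
    have h3 := one_le (13/40) (by norm_num)
    rw [← hN] at this
    linarith
  have hAN : 2 * A * N ≤ q := by
    have : (2:ℝ) * A * N ≤ Q := by
      calc (2:ℝ) * A * N ≤ 2 * Q ^ (19/100:ℝ) * (2 * Q ^ (13/40:ℝ)) := by gcongr
        _ = 4 * (Q ^ (19/100:ℝ) * Q ^ (13/40:ℝ)) := by ring
        _ = 4 * Q ^ (515/1000:ℝ) := by rw [← Real.rpow_add (by linarith)]; norm_num
        _ ≤ Q := g1
    rw [hQdef] at this
    exact_mod_cast this
  have hdq := hd q hq0
  have hd2 : 2 * q.divisors.card ^ 2 ≤ A := by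
    have : (2:ℝ) * (q.divisors.card:ℝ) ^ 2 ≤ A := by
      calc (2:ℝ) * (q.divisors.card:ℝ) ^ 2 ≤ 2 * (C1 * Q ^ (1/10000:ℝ)) ^ 2 := by gcongr
        _ = (4 * C1 ^ 2 * Q ^ (2/10000:ℝ)) / 2 := by
            rw [mul_pow, ← Real.rpow_natCast (Q ^ _), ← Real.rpow_mul (by linarith)]
            norm_num; ring
        _ ≤ Q ^ (19/100:ℝ) / 2 := by linarith
        _ ≤ A := hA1
    exact_mod_cast this
  have ha := card_AA_ge q A hq0 hd2
  have hdpos : 1 ≤ (q.divisors.card : ℝ) := by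
    have : 0 < q.divisors.card := Finset.card_pos.2 (Nat.nonempty_divisors.2 hq0)
    exact_mod_cast this
  have hA0 : (0:ℝ) < A := by
    have := one_le (19/100) (by norm_num); linarith
  have ha0 : (0:ℝ) < (AA q A).card := by
    by_contra hcon
    push Not at hcon
    have h0 : ((AA q A).card : ℝ) = 0 := le_antisymm hcon (by positivity)
    rw [h0] at ha; linarith
  obtain ⟨V, hV0, hV1, hV2⟩ := burgess_ineq q H A M N hq hM0 hAN
  have fin := burgess_real Q A M N (AA q A).card V _ q.divisors.card C1 C2 _ hQ1 hN1 hM1 hM2 hA1 hA2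
    ha0 ha hdpos hdq (hT A) hC1 hC2.le hV0 hV1 hV2
  refine fin.trans ?_
  rw [← hCa]
  apply mul_le_mul_of_nonneg_right _ (by positivity)
  exact (le_max_left _ _).trans (le_max_right _ _)

end HB
end

section
open Finset
namespace HB

theorem jac_prime_sum (p : ℕ) [Fact p.Prime] (hp : p ≠ 2) :
    ∑ x ∈ range p, jacobiSym (x : ℤ) p = 0 := by
  have h1 := quadraticChar_sum_zero (F := ZMod p) (by rw [ZMod.ringChar_zmod_n]; exact hp)
  rw [← h1]
  have : NeZero p := ⟨(Fact.out : p.Prime).ne_zero⟩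
  refine Finset.sum_bij (fun x _ => (x : ZMod p)) (fun _ _ => mem_univ _) ?_ ?_ ?_
  · intro a ha b hb h
    have := (ZMod.natCast_eq_natCast_iff' a b p).1 h
    rwa [Nat.mod_eq_of_lt (mem_range.1 ha), Nat.mod_eq_of_lt (mem_range.1 hb)] at this
  · intro b _
    exact ⟨b.val, mem_range.2 (ZMod.val_lt b), ZMod.natCast_zmod_val b⟩
  · intro a _
    rw [← jacobiSym.legendreSym.to_jacobiSym]
    simp [legendreSym]

theorem jac_period_zero (q : ℕ) (hq : Squarefree q) (ho : Odd q) (h1 : 1 < q) :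
    ∑ x ∈ range q, jacobiSym (x : ℤ) q = 0 := by
  obtain ⟨p, hp, r, rfl⟩ := Nat.exists_prime_and_dvd (n := q) (by omega)
  have : Fact p.Prime := ⟨hp⟩
  have hr : r ≠ 0 := by rintro rfl; simp at h1
  have hcop := Nat.coprime_of_squarefree_mul hq
  have hp2 : p ≠ 2 := by
    rintro rfl
    exact absurd (Nat.odd_mul.1 ho).1 (by decide)
  have h := sum_crt p r hp.ne_zero hr hcop (fun x => jacobiSym (x:ℤ) p) (fun x => jacobiSym (x:ℤ) r)
  rw [jac_prime_sum p hp2, zero_mul] at h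
  rw [← h]
  apply Finset.sum_congr rfl
  intro x _
  rw [jacobiSym.mul_right' _ hp.ne_zero hr]
  push_cast
  rw [← jacobiSym.mod_left, ← jacobiSym.mod_left]

theorem sum_period_shift (f : ℕ → ℝ) (q : ℕ) (hf : ∀ n, f (n + q) = f n) (H : ℕ) :
    ∑ n ∈ range q, f (H + n) = ∑ n ∈ range q, f n := by
  induction H with
  | zero => simp
  | succ H ih =>
    rw [← ih]
    have e1 := Finset.sum_range_succ (fun n => f (H + n)) q
    have e2 := Finset.sum_range_succ' (fun n => f (H + n)) q
    have e3 := hf H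
    have : ∀ n, H + 1 + n = H + (n + 1) := fun n => by ring
    simp only [this]
    simp only [add_zero] at e2
    linarith

theorem sum_reduce (f : ℕ → ℝ) (q : ℕ) (hq : 0 < q) (hf : ∀ n, f (n + q) = f n)
    (hz : ∑ n ∈ range q, f n = 0) (H N : ℕ) :
    ∑ n ∈ range N, f (H + n) = ∑ n ∈ range (N % q), f (H + n) := by
  induction N using Nat.strong_induction_on with
  | _ N ih =>
    rcases lt_or_ge N q with h | h
    · rw [Nat.mod_eq_of_lt h]
    · obtain ⟨k, rfl⟩ := Nat.exists_eq_add_of_le h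
      rw [add_comm q k, Finset.sum_range_add, ih k (by omega), Nat.add_mod_right]
      have := sum_period_shift f q hf (H + k)
      rw [hz] at this
      simp only [← add_assoc]
      rw [this, add_zero]

theorem jac_periodic (q n : ℕ) : (jacobiSym ((n + q : ℕ) : ℤ) q : ℝ) = jacobiSym (n : ℤ) q := by
  congr 1
  apply jacobiSym.mod_left'
  simp

/-- Burgess bound. -/
theorem burgess : ∃ C : ℝ, 1 ≤ C ∧ ∀ q : ℕ, Squarefree q → Odd q → 1 < q → ∀ H N : ℕ,
    |∑ n ∈ range N, (jacobiSym ((H + n : ℕ) : ℤ) q : ℝ)| ≤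
      C * ((N:ℝ) ^ (999/1000:ℝ) * (q:ℝ) ^ (13/40000:ℝ)) := by
  obtain ⟨C, hC, hb⟩ := burgess0
  refine ⟨C + 2, by linarith, fun q hq ho h1 H N => ?_⟩
  set Q : ℝ := (q:ℝ) with hQ
  have hQ1 : 1 ≤ Q := by rw [hQ]; exact_mod_cast h1.le
  have hQ0 : 0 < Q := by linarith
  have hred := sum_reduce (fun n => (jacobiSym (n : ℤ) q : ℝ)) q (by omega) (jac_periodic q)
    (by exact_mod_cast jac_period_zero q hq ho h1) H N
  rw [hred]
  set N1 := N % q with hN1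
  have hN1N : (N1:ℝ) ≤ N := by exact_mod_cast Nat.mod_le _ _
  have hN1q : (N1:ℝ) ≤ Q := by rw [hQ]; exact_mod_cast (Nat.mod_lt _ (by omega)).le
  have main : |∑ n ∈ range N1, (jacobiSym ((H + n : ℕ) : ℤ) q : ℝ)| ≤
      (C + 2) * ((N1:ℝ) ^ (999/1000:ℝ) * Q ^ (13/40000:ℝ)) := by
    set N0 := ⌈Q ^ (13/40:ℝ)⌉₊ with hN0
    have triv : ∀ H n : ℕ, |∑ n ∈ range n, (jacobiSym ((H + n : ℕ) : ℤ) q : ℝ)| ≤ n := by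
      intro H n
      refine (Finset.abs_sum_le_sum_abs _ _).trans ?_
      calc _ ≤ ∑ n ∈ range n, (1:ℝ) := Finset.sum_le_sum fun n _ => by exact_mod_cast abs_jacobi_le _ _
        _ = n := by simp
    have hN0pos : 0 < N0 := Nat.ceil_pos.2 (by positivity)
    have step : ∀ n H : ℕ, |∑ n ∈ range n, (jacobiSym ((H + n : ℕ) : ℤ) q : ℝ)| ≤
        C * (n * Q ^ (-(1/1000):ℝ)) + N0 := by
      intro n
      induction n using Nat.strong_induction_on with
      | _ n ih =>
        intro H
        rcases lt_or_ge n N0 with h | h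
        · refine (triv H n).trans ?_
          have : (n:ℝ) ≤ N0 := by exact_mod_cast h.le
          have h2 : 0 ≤ C * (n * Q ^ (-(1/1000):ℝ)) := by positivity
          linarith
        · obtain ⟨k, rfl⟩ := Nat.exists_eq_add_of_le h
          rw [Finset.sum_range_add]
          have a1 := hb q H hq
          rw [← hQ, ← hN0] at a1
          have a2 := ih k (by omega) (H + N0)
          simp only [← add_assoc]
          refine (abs_add_le _ _).trans ?_
          push_cast at a1 a2 ⊢
          rw [add_mul, mul_add]
          linarith
    rcases le_or_gt (N1:ℝ) (Q ^ (13/40:ℝ)) with hs | hl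
    · have e1 : (N1:ℝ) ≤ (N1:ℝ) ^ (999/1000:ℝ) * Q ^ (13/40000:ℝ) := by
        rcases Nat.eq_zero_or_pos N1 with h0 | h0
        · rw [h0]; simp
        have h0' : (0:ℝ) < N1 := by exact_mod_cast h0
        calc (N1:ℝ) = (N1:ℝ) ^ (999/1000:ℝ) * (N1:ℝ) ^ (1/1000:ℝ) := by
              rw [← Real.rpow_add h0']; norm_num
          _ ≤ (N1:ℝ) ^ (999/1000:ℝ) * (Q ^ (13/40:ℝ)) ^ (1/1000:ℝ) := by gcongr
          _ = _ := by rw [← Real.rpow_mul hQ0.le]; norm_num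
      refine (triv H N1).trans (e1.trans ?_)
      exact le_mul_of_one_le_left (by positivity) (by linarith)
    · have h0' : (0:ℝ) < N1 := lt_trans (by positivity) hl
      refine (step N1 H).trans ?_
      have b1 : (N1:ℝ) * Q ^ (-(1/1000):ℝ) ≤ (N1:ℝ) ^ (999/1000:ℝ) * Q ^ (13/40000:ℝ) := by
        calc (N1:ℝ) * Q ^ (-(1/1000):ℝ) = (N1:ℝ) ^ (999/1000:ℝ) * (N1:ℝ) ^ (1/1000:ℝ) * Q ^ (-(1/1000):ℝ) := by
              rw [← Real.rpow_add h0']; norm_num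
          _ ≤ (N1:ℝ) ^ (999/1000:ℝ) * Q ^ (1/1000:ℝ) * Q ^ (-(1/1000):ℝ) := by gcongr
          _ = (N1:ℝ) ^ (999/1000:ℝ) * 1 := by rw [mul_assoc, ← Real.rpow_add hQ0]; norm_num
          _ ≤ _ := by gcongr; exact Real.one_le_rpow hQ1 (by norm_num)
      have b2 : (N0:ℝ) ≤ 2 * ((N1:ℝ) ^ (999/1000:ℝ) * Q ^ (13/40000:ℝ)) := by
        have h3 := (Nat.ceil_lt_add_one (a := Q ^ (13/40:ℝ)) (by positivity)).le
        have h4 := Real.one_le_rpow hQ1 (z := 13/40) (by norm_num)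
        rw [← hN0] at h3
        calc (N0:ℝ) ≤ 2 * Q ^ (13/40:ℝ) := by linarith
          _ = 2 * ((Q ^ (13/40:ℝ)) ^ (999/1000:ℝ) * Q ^ (13/40000:ℝ)) := by
              rw [← Real.rpow_mul hQ0.le, ← Real.rpow_add hQ0]; norm_num
          _ ≤ _ := by gcongr
      have b3 : C * ((N1:ℝ) * Q ^ (-(1/1000):ℝ)) ≤ C * ((N1:ℝ) ^ (999/1000:ℝ) * Q ^ (13/40000:ℝ)) := by
        gcongr
      linarith
  refine main.trans ?_
  gcongr

end HB
end

section
open Finset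
namespace HB

/-- Dirichlet convolution -/
def cv (α β : ℕ → ℝ) (n : ℕ) : ℝ := ∑ p ∈ n.divisorsAntidiagonal, α p.1 * β p.2

theorem sum_cv (α β : ℕ → ℝ) (x : ℕ) :
    ∑ n ∈ Icc 1 x, cv α β n =
      ∑ p ∈ (Icc 1 x ×ˢ Icc 1 x).filter (fun p => p.1 * p.2 ≤ x), α p.1 * β p.2 := by
  unfold cv
  rw [Finset.sum_sigma']
  refine Finset.sum_bij (fun z _ => z.2) ?_ ?_ ?_ ?_
  · rintro ⟨n, p⟩ h
    simp only [mem_sigma, mem_Icc, Nat.mem_divisorsAntidiagonal] at h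
    obtain ⟨⟨h1, h2⟩, h3, h4⟩ := h
    have hp1 : 0 < p.1 := Nat.pos_of_ne_zero (by rintro h; rw [h] at h3; simp at h3; omega)
    have hp2 : 0 < p.2 := Nat.pos_of_ne_zero (by rintro h; rw [h] at h3; simp at h3; omega)
    simp only [mem_filter, mem_product, mem_Icc]
    refine ⟨⟨⟨hp1, ?_⟩, hp2, ?_⟩, by omega⟩
    · nlinarith
    · nlinarith
  · rintro ⟨n, p⟩ h ⟨n', p'⟩ h' heq
    simp only [mem_sigma, mem_Icc, Nat.mem_divisorsAntidiagonal] at h h'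
    simp only at heq
    subst heq
    have : n = n' := by rw [← h.2.1, ← h'.2.1]
    subst this; rfl
  · rintro p h
    simp only [mem_filter, mem_product, mem_Icc] at h
    refine ⟨⟨p.1 * p.2, p⟩, ?_, rfl⟩
    simp only [mem_sigma, mem_Icc, Nat.mem_divisorsAntidiagonal]
    have : 0 < p.1 * p.2 := Nat.mul_pos h.1.1.1 h.1.2.1
    exact ⟨⟨this, h.2⟩, trivial, this.ne'⟩
  · intros; rfl

theorem hyperbola (α β : ℕ → ℝ) (x E : ℕ) :
    ∑ n ∈ Icc 1 x, cv α β n =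
      ∑ e ∈ Icc 1 E, α e * ∑ f ∈ Icc 1 (x / e), β f +
      ∑ f ∈ Icc 1 (x / (E + 1)), β f * ∑ e ∈ Ioc E (x / f), α e := by
  rw [sum_cv, ← Finset.sum_filter_add_sum_filter_not _ (fun p => p.1 ≤ E)]
  congr 1
  · simp only [Finset.mul_sum]
    rw [Finset.sum_sigma']
    refine Finset.sum_bij (fun z _ => ⟨z.1, z.2⟩) ?_ ?_ ?_ ?_
    · rintro p h
      simp only [mem_filter, mem_product, mem_Icc] at h
      simp only [mem_sigma, mem_Icc]
      refine ⟨⟨h.1.1.1.1, h.2⟩, h.1.1.2.1, ?_⟩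
      rw [Nat.le_div_iff_mul_le h.1.1.1.1, mul_comm]; exact h.1.2
    · rintro ⟨a, b⟩ _ ⟨c, d⟩ _ h
      simp only [Sigma.mk.injEq, heq_eq_eq] at h
      exact Prod.ext h.1 h.2
    · rintro ⟨a, b⟩ h
      simp only [mem_sigma, mem_Icc] at h
      refine ⟨(a, b), ?_, rfl⟩
      have h2 := h.2.2
      rw [Nat.le_div_iff_mul_le h.1.1] at h2
      simp only [mem_filter, mem_product, mem_Icc]
      refine ⟨⟨⟨⟨h.1.1, ?_⟩, h.2.1, ?_⟩, by rw [mul_comm]; exact h2⟩, h.1.2⟩ <;> nlinarith [h.1.1, h.2.1]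
    · intros; rfl
  · simp only [Finset.mul_sum]
    rw [Finset.sum_sigma']
    refine Finset.sum_bij (fun z _ => ⟨z.2, z.1⟩) ?_ ?_ ?_ ?_
    · rintro p h
      simp only [mem_filter, mem_product, mem_Icc, not_le] at h
      simp only [mem_sigma, mem_Icc, mem_Ioc]
      refine ⟨⟨h.1.1.2.1, ?_⟩, h.2, ?_⟩
      · rw [Nat.le_div_iff_mul_le (by omega)]
        nlinarith [h.2, h.1.2]
      · rw [Nat.le_div_iff_mul_le h.1.1.2.1]; exact h.1.2
    · rintro ⟨a, b⟩ _ ⟨c, d⟩ _ h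
      simp only [Sigma.mk.injEq, heq_eq_eq] at h
      exact Prod.ext h.2 h.1
    · rintro ⟨a, b⟩ h
      simp only [mem_sigma, mem_Icc, mem_Ioc] at h
      refine ⟨(b, a), ?_, rfl⟩
      have h2 := h.2.2
      rw [Nat.le_div_iff_mul_le h.1.1] at h2
      simp only [mem_filter, mem_product, mem_Icc, not_le]
      have hb : 1 ≤ b := by omega
      refine ⟨⟨⟨⟨hb, ?_⟩, h.1.1, ?_⟩, h2⟩, h.2.1⟩ <;> nlinarith [h.1.1, hb]
    · intro p _; exact mul_comm _ _

theorem cv_wt (α β : ℕ → ℝ) (s : ℝ) (n : ℕ) :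
    cv (fun n => α n * (n:ℝ) ^ (-s)) (fun n => β n * (n:ℝ) ^ (-s)) n = cv α β n * (n:ℝ) ^ (-s) := by
  unfold cv
  rw [Finset.sum_mul]
  apply Finset.sum_congr rfl
  intro p hp
  rw [← (Nat.mem_divisorsAntidiagonal.1 hp).1]
  push_cast
  rw [Real.mul_rpow (by positivity) (by positivity)]
  ring

theorem abel_step (θ s : ℝ) (hθ : 0 ≤ θ) (hs : θ < s) (n : ℕ) (hn : 0 < n) :
    (n:ℝ) ^ θ * ((n:ℝ) ^ (-s) - ((n + 1 : ℕ):ℝ) ^ (-s)) ≤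
      s / (s - θ) * ((n:ℝ) ^ (θ - s) - ((n + 1 : ℕ):ℝ) ^ (θ - s)) := by
  have hn0 : (0:ℝ) < n := by exact_mod_cast hn
  have hn1 : (0:ℝ) < ((n + 1 : ℕ):ℝ) := by positivity
  set u : ℝ := (n:ℝ) / ((n + 1 : ℕ):ℝ) with hu
  have hu0 : 0 < u := by positivity
  have hsθ : 0 < s - θ := by linarith
  have e1 : ((n + 1 : ℕ):ℝ) ^ (-s) = (n:ℝ) ^ (-s) * u ^ s := by
    rw [hu, Real.div_rpow hn0.le hn1.le, Real.rpow_neg hn0.le, Real.rpow_neg hn1.le]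
    have := (Real.rpow_pos_of_pos hn0 s).ne'
    field_simp
  have e2 : ((n + 1 : ℕ):ℝ) ^ (θ - s) = (n:ℝ) ^ (θ - s) * u ^ (s - θ) := by
    have : θ - s = -(s - θ) := by ring
    rw [this, hu, Real.div_rpow hn0.le hn1.le, Real.rpow_neg hn0.le, Real.rpow_neg hn1.le]
    have := (Real.rpow_pos_of_pos hn0 (s - θ)).ne'
    field_simp
  have e3 : (n:ℝ) ^ (θ - s) = (n:ℝ) ^ θ * (n:ℝ) ^ (-s) := by
    rw [← Real.rpow_add hn0]; ring_nf
  set p := s / (s - θ) with hp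
  have hp1 : 1 ≤ p := by rw [hp, one_le_div hsθ]; linarith
  set v := u ^ (s - θ) with hv
  have hv0 : 0 < v := Real.rpow_pos_of_pos hu0 _
  have hvp : v ^ p = u ^ s := by
    rw [hv, ← Real.rpow_mul hu0.le, hp]; congr 1; field_simp
  have ber := one_add_mul_self_le_rpow_one_add (s := v - 1) (by linarith) hp1
  have : (1 + (v - 1)) = v := by ring
  rw [this, hvp] at ber
  rw [e1, e2, e3]
  have hpos : 0 < (n:ℝ) ^ θ * (n:ℝ) ^ (-s) := by positivity
  nlinarith

theorem rpow_neg_anti (s : ℝ) (hs : 0 ≤ s) (a b : ℝ) (ha : 0 < a) (hab : a ≤ b) :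
    b ^ (-s) ≤ a ^ (-s) := Real.rpow_le_rpow_of_nonpos ha hab (by linarith)

theorem abel (f : ℕ → ℝ) (B θ s : ℝ) (hθ : 0 ≤ θ) (hs : θ < s)
    (hf : ∀ y : ℕ, 0 < y → |∑ n ∈ Icc 1 y, f n| ≤ B * (y:ℝ) ^ θ) (E y : ℕ) :
    |∑ n ∈ Ioc E y, f n * (n:ℝ) ^ (-s)| ≤
      B * (2 + s / (s - θ)) * ((E + 1 : ℕ) : ℝ) ^ (θ - s) := by
  have hB : 0 ≤ B := by
    have := hf 1 one_pos
    simp at this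
    exact (abs_nonneg _).trans this
  have hsθ : 0 < s - θ := by linarith
  have hp0 : 0 ≤ s / (s - θ) := div_nonneg (by linarith) hsθ.le
  rcases le_or_gt y E with h | h
  · rw [Ioc_eq_empty (by omega)]
    simp only [sum_empty, abs_zero]
    positivity
  set S : ℕ → ℝ := fun y => ∑ n ∈ Icc 1 y, f n with hS
  have hSs : ∀ n, S (n + 1) = S n + f (n + 1) := by
    intro n
    simp only [hS]
    rw [Finset.sum_Icc_succ_top (by omega)]
  have key : ∀ k : ℕ, |∑ n ∈ Ioc E (E + 1 + k), f n * (n:ℝ) ^ (-s) -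
      S (E + 1 + k) * ((E + 1 + k : ℕ):ℝ) ^ (-s) + S E * ((E + 1 : ℕ):ℝ) ^ (-s)| ≤
      B * (s / (s - θ) * (((E + 1 : ℕ):ℝ) ^ (θ - s) - ((E + 1 + k : ℕ):ℝ) ^ (θ - s))) := by
    intro k
    induction k with
    | zero =>
      simp only [add_zero, sub_self, mul_zero]
      rw [hSs E]
      simp
      ring_nf
      done
    | succ k ih =>
      rw [← add_assoc, ← Finset.insert_Ioc_right_eq_Ioc_add_one (by omega), Finset.sum_insert (by simp)]
      rw [hSs (E + 1 + k)]
      set m := E + 1 + k with hm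
      have hm0 : 0 < m := by omega
      have e1 : f (m + 1) * ((m + 1 : ℕ):ℝ) ^ (-s) + ∑ n ∈ Ioc E m, f n * (n:ℝ) ^ (-s) -
        (S m + f (m + 1)) * ((m + 1 : ℕ):ℝ) ^ (-s) + S E * ((E + 1 : ℕ):ℝ) ^ (-s) =
        (∑ n ∈ Ioc E m, f n * (n:ℝ) ^ (-s) - S m * (m:ℝ) ^ (-s) + S E * ((E + 1 : ℕ):ℝ) ^ (-s)) +
        S m * ((m:ℝ) ^ (-s) - ((m + 1 : ℕ):ℝ) ^ (-s)) := by ring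
      rw [e1]
      refine (abs_add_le _ _).trans ?_
      have e2 : |S m * ((m:ℝ) ^ (-s) - ((m + 1 : ℕ):ℝ) ^ (-s))| ≤
          B * (s / (s - θ) * ((m:ℝ) ^ (θ - s) - ((m + 1 : ℕ):ℝ) ^ (θ - s))) := by
        have h0 : 0 ≤ (m:ℝ) ^ (-s) - ((m + 1 : ℕ):ℝ) ^ (-s) := by
          have := rpow_neg_anti s (by linarith) (m:ℝ) ((m + 1 : ℕ):ℝ) (by exact_mod_cast hm0)
            (by push_cast; linarith)
          linarith
        rw [abs_mul, abs_of_nonneg h0]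
        calc |S m| * _ ≤ B * (m:ℝ) ^ θ * ((m:ℝ) ^ (-s) - ((m + 1 : ℕ):ℝ) ^ (-s)) := by
              gcongr; exact hf m hm0
          _ = B * ((m:ℝ) ^ θ * ((m:ℝ) ^ (-s) - ((m + 1 : ℕ):ℝ) ^ (-s))) := by ring
          _ ≤ _ := by
              apply mul_le_mul_of_nonneg_left (abel_step θ s hθ hs m hm0) hB
      refine (add_le_add ih e2).trans (le_of_eq ?_)
      ring
  obtain ⟨k, rfl⟩ := Nat.exists_eq_add_of_le (show E + 1 ≤ y by omega)
  have hk := key k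
  set m := E + 1 + k with hm
  have hE0 : (0:ℝ) < ((E + 1 : ℕ):ℝ) := by positivity
  have hm0 : 0 < m := by omega
  have hm0' : (0:ℝ) < (m:ℝ) := by exact_mod_cast hm0
  have hEm : ((E + 1 : ℕ):ℝ) ≤ m := by exact_mod_cast (show E + 1 ≤ m by omega)
  have t1 : |S m * (m:ℝ) ^ (-s)| ≤ B * (m:ℝ) ^ (θ - s) := by
    rw [abs_mul, abs_of_nonneg (a := (m:ℝ) ^ (-s)) (by positivity)]
    calc _ ≤ B * (m:ℝ) ^ θ * (m:ℝ) ^ (-s) := by gcongr; exact hf m hm0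
      _ = B * (m:ℝ) ^ (θ - s) := by rw [mul_assoc, ← Real.rpow_add hm0']; ring_nf
  have t1' : B * (m:ℝ) ^ (θ - s) ≤ B * ((E + 1 : ℕ):ℝ) ^ (θ - s) := by
    have := rpow_neg_anti (s - θ) hsθ.le _ _ hE0 hEm
    rw [neg_sub] at this
    gcongr
  have t2 : |S E * ((E + 1 : ℕ):ℝ) ^ (-s)| ≤ B * ((E + 1 : ℕ):ℝ) ^ (θ - s) := by
    rw [abs_mul, abs_of_nonneg (a := ((E + 1 : ℕ):ℝ) ^ (-s)) (by positivity)]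
    have hSE : |S E| ≤ B * ((E + 1 : ℕ):ℝ) ^ θ := by
      rcases Nat.eq_zero_or_pos E with rfl | h0
      · simp [hS]; exact hB
      · refine (hf E h0).trans ?_
        gcongr; omega
    calc _ ≤ B * ((E + 1 : ℕ):ℝ) ^ θ * ((E + 1 : ℕ):ℝ) ^ (-s) := by gcongr
      _ = _ := by rw [mul_assoc, ← Real.rpow_add hE0]; ring_nf
  have t3 : B * (s / (s - θ) * (((E + 1 : ℕ):ℝ) ^ (θ - s) - (m:ℝ) ^ (θ - s))) ≤
      B * (s / (s - θ)) * ((E + 1 : ℕ):ℝ) ^ (θ - s) := by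
    rw [mul_assoc]
    apply mul_le_mul_of_nonneg_left _ hB
    apply mul_le_mul_of_nonneg_left _ hp0
    have : 0 ≤ (m:ℝ) ^ (θ - s) := by positivity
    linarith
  have fin : ∀ T u v : ℝ, |T| ≤ |T - u + v| + |u| + |v| := by
    intro T u v
    have := abs_add_le (T - u + v + u) (-v)
    have h2 := abs_add_le (T - u + v) u
    rw [abs_neg] at this
    have h3 : T - u + v + u + -v = T := by ring
    rw [h3] at this
    linarith
  refine (fin _ (S m * (m:ℝ) ^ (-s)) (S E * ((E + 1 : ℕ):ℝ) ^ (-s))).trans ?_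
  linarith

end HB
end

section
open Finset Filter Topology
namespace HB

/-- partial sums of Dirichlet series -/
noncomputable def PS (f : ℕ → ℝ) (s : ℝ) (y : ℕ) : ℝ := ∑ n ∈ Icc 1 y, f n * (n:ℝ) ^ (-s)

/-- Dirichlet series (conditionally convergent) -/
noncomputable def LS (f : ℕ → ℝ) (s : ℝ) : ℝ := limUnder atTop (PS f s)

theorem PS_sub (f : ℕ → ℝ) (s : ℝ) (a b : ℕ) (h : a ≤ b) :
    PS f s b - PS f s a = ∑ n ∈ Ioc a b, f n * (n:ℝ) ^ (-s) := by
  unfold PS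
  have h1 : Icc 1 b = Icc 1 a ∪ Ioc a b := by
    ext x; simp only [mem_Icc, mem_union, mem_Ioc]; omega
  rw [h1, Finset.sum_union]
  · ring
  · rw [Finset.disjoint_left]; intro x; simp only [mem_Icc, mem_Ioc]; omega

theorem tendsto_pow0 (c : ℝ) (hc : c < 0) (K : ℝ) :
    Tendsto (fun N : ℕ => K * ((N + 1 : ℕ) : ℝ) ^ c) atTop (𝓝 0) := by
  have h1 := tendsto_rpow_neg_atTop (y := -c) (by linarith)
  rw [neg_neg] at h1
  have h2 : Tendsto (fun N : ℕ => ((N + 1 : ℕ) : ℝ)) atTop atTop :=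
    tendsto_natCast_atTop_atTop.comp (tendsto_add_atTop_nat 1)
  have := (h1.comp h2).const_mul K
  simpa using this

theorem LS_tendsto (f : ℕ → ℝ) (B θ s : ℝ) (hθ : 0 ≤ θ) (hs : θ < s)
    (hf : ∀ y : ℕ, 0 < y → |∑ n ∈ Icc 1 y, f n| ≤ B * (y:ℝ) ^ θ) :
    Tendsto (PS f s) atTop (𝓝 (LS f s)) := by
  have : CauchySeq (PS f s) := by
    refine cauchySeq_of_le_tendsto_0
      (fun N : ℕ => (2 * (B * (2 + s / (s - θ)))) * ((N + 1 : ℕ) : ℝ) ^ (θ - s)) ?_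
      (tendsto_pow0 _ (by linarith) _)
    intro n m N hn hm
    have e : ∀ k, N ≤ k → |PS f s k - PS f s N| ≤
        B * (2 + s / (s - θ)) * ((N + 1 : ℕ) : ℝ) ^ (θ - s) := by
      intro k hk
      rw [PS_sub f s N k hk]
      exact abel f B θ s hθ hs hf N k
    rw [Real.dist_eq]
    have h3 := e n hn
    have h4 := e m hm
    have := abs_sub_le (PS f s n) (PS f s N) (PS f s m)
    rw [abs_sub_comm (PS f s N)] at this
    linarith
  obtain ⟨a, ha⟩ := cauchySeq_tendsto_of_complete this
  exact tendsto_nhds_limUnder ⟨a, ha⟩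

theorem LS_tail (f : ℕ → ℝ) (B θ s : ℝ) (hθ : 0 ≤ θ) (hs : θ < s)
    (hf : ∀ y : ℕ, 0 < y → |∑ n ∈ Icc 1 y, f n| ≤ B * (y:ℝ) ^ θ) (y : ℕ) :
    |LS f s - PS f s y| ≤ B * (2 + s / (s - θ)) * ((y + 1 : ℕ) : ℝ) ^ (θ - s) := by
  have h1 := ((LS_tendsto f B θ s hθ hs hf).sub_const (PS f s y)).abs
  refine le_of_tendsto h1 ?_
  filter_upwards [eventually_ge_atTop y] with k hk
  rw [PS_sub f s y k hk]
  exact abel f B θ s hθ hs hf y k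

theorem LS_tail0 (f : ℕ → ℝ) (q s : ℝ) (hs : 0 < s)
    (hf : ∀ y : ℕ, |∑ n ∈ Icc 1 y, f n| ≤ q) (y : ℕ) :
    |LS f s - PS f s y| ≤ 3 * q * ((y + 1 : ℕ) : ℝ) ^ (-s) := by
  have := LS_tail f q 0 s le_rfl hs (fun y _ => by simpa using hf y) y
  rw [sub_zero, div_self hs.ne', zero_sub] at this
  refine this.trans (le_of_eq ?_)
  ring

theorem LS_cont (f : ℕ → ℝ) (q b : ℝ) (hb : 0 < b)
    (hf : ∀ y : ℕ, |∑ n ∈ Icc 1 y, f n| ≤ q) : ContinuousOn (LS f) (Set.Ici b) := by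
  have hq : 0 ≤ q := (abs_nonneg _).trans (hf 0)
  have hU : TendstoUniformlyOn (fun y s => PS f s y) (LS f) atTop (Set.Ici b) := by
    rw [Metric.tendstoUniformlyOn_iff]
    intro ε hε
    have ht := tendsto_pow0 (-b) (by linarith) (3 * q)
    filter_upwards [ht.eventually (gt_mem_nhds hε)] with y hy s hs
    have hs' : b ≤ s := hs
    rw [Real.dist_eq]
    refine lt_of_le_of_lt (LS_tail0 f q s (by linarith) hf y) (lt_of_le_of_lt ?_ hy)
    gcongr
    · exact_mod_cast Nat.succ_le_succ (Nat.zero_le y)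
  refine hU.continuousOn (Frequently.of_forall fun y => ?_)
  unfold PS
  apply continuousOn_finsetSum
  intro n hn
  have hn0 : (n:ℝ) ≠ 0 := by
    have := (mem_Icc.1 hn).1
    exact_mod_cast (show n ≠ 0 by omega)
  apply ContinuousOn.mul continuousOn_const
  exact (Real.continuous_const_rpow hn0).comp_continuousOn continuousOn_neg

theorem tangent (p a b : ℝ) (hp0 : 0 ≤ p) (hp1 : p ≤ 1) (ha : 0 < a) (hb : 0 < b) :
    b ^ p ≤ a ^ p + p * a ^ (p - 1) * (b - a) := by
  have h := rpow_one_add_le_one_add_mul_self (s := (b - a) / a) (p := p)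
    (by rw [le_div_iff₀ ha]; linarith) hp0 hp1
  have e1 : 1 + (b - a) / a = b / a := by field_simp; ring
  rw [e1, Real.div_rpow hb.le ha.le, div_le_iff₀ (by positivity)] at h
  have e2 : a ^ (p - 1) = a ^ p / a := by rw [Real.rpow_sub ha, Real.rpow_one]
  rw [e2]
  refine h.trans (le_of_eq ?_)
  field_simp

/-- generalised `ζ(β)` -/
theorem zeta_ex (β : ℝ) (h0 : 0 < β) (h1 : β < 1) : ∃ z : ℝ, z ≤ -β / (1 - β) ∧ -1 / (1 - β) ≤ z ∧
    (∀ Y : ℕ, 0 < Y → ∑ n ∈ Icc 1 Y, (n:ℝ) ^ (-β) ≤ (Y:ℝ) ^ (1 - β) / (1 - β)) ∧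
    ∀ (Y : ℕ) (y : ℝ), 0 < Y → (Y:ℝ) ≤ y → y ≤ Y + 1 →
      |∑ n ∈ Icc 1 Y, (n:ℝ) ^ (-β) - y ^ (1 - β) / (1 - β) - z| ≤ 4 * y ^ (-β) := by
  have hp : 0 < 1 - β := by linarith
  set u : ℕ → ℝ := fun k => ∑ n ∈ Icc 1 (k + 1), (n:ℝ) ^ (-β) - ((k + 1 : ℕ):ℝ) ^ (1 - β) / (1 - β) with hu
  set v : ℕ → ℝ := fun k => u k - ((k + 1 : ℕ):ℝ) ^ (-β) with hv
  have tan : ∀ a b : ℝ, 0 < a → 0 < b → b ^ (1 - β) / (1 - β) ≤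
      a ^ (1 - β) / (1 - β) + a ^ (-β) * (b - a) := by
    intro a b ha hb
    have := tangent (1 - β) a b hp.le (by linarith) ha hb
    have e : 1 - β - 1 = -β := by ring
    rw [e] at this
    rw [div_le_iff₀ hp]
    refine this.trans (le_of_eq ?_)
    field_simp
  have hus : ∀ k, u (k + 1) = u k + ((k + 1 + 1 : ℕ):ℝ) ^ (-β) -
      (((k + 1 + 1 : ℕ):ℝ) ^ (1 - β) / (1 - β) - ((k + 1 : ℕ):ℝ) ^ (1 - β) / (1 - β)) := by
    intro k
    simp only [hu]
    rw [Finset.sum_Icc_succ_top (by omega)]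
    ring
  have hpk : ∀ k : ℕ, (0:ℝ) < ((k + 1 : ℕ):ℝ) := fun k => by positivity
  have huA : Antitone u := antitone_nat_of_succ_le fun k => by
    rw [hus]
    have := tan _ _ (hpk (k + 1)) (hpk k)
    push_cast at this ⊢
    linarith
  have hvM : Monotone v := monotone_nat_of_le_succ fun k => by
    simp only [hv]
    rw [hus]
    have := tan _ _ (hpk k) (hpk (k + 1))
    push_cast at this ⊢
    linarith
  have hvu : ∀ i j, v i ≤ u j := by
    intro i j
    have h2 := hvM (le_max_left i j)
    have h3 := huA (le_max_right i j)
    have h4 : v (max i j) ≤ u (max i j) := by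
      simp only [hv]
      have : (0:ℝ) ≤ ((max i j + 1 : ℕ):ℝ) ^ (-β) := by positivity
      linarith
    linarith
  have hu0 : u 0 = -β / (1 - β) := by
    simp [hu]; field_simp; ring
  have hv0 : v 0 = -1 / (1 - β) := by
    simp only [hv]; rw [hu0]; simp; field_simp; ring
  have hbdd : BddAbove (Set.range v) := ⟨u 0, by rintro _ ⟨i, rfl⟩; exact hvu i 0⟩
  have hz1 : ∀ k, v k ≤ ⨆ i, v i := fun k => le_ciSup hbdd k
  have hz2 : ∀ k, (⨆ i, v i) ≤ u k := fun k => ciSup_le fun i => hvu i k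
  refine ⟨⨆ i, v i, by rw [← hu0]; exact hz2 0, by rw [← hv0]; exact hz1 0, ?_, ?_⟩
  · intro Y hY
    obtain ⟨k, rfl⟩ : ∃ k, Y = k + 1 := ⟨Y - 1, by omega⟩
    have h3 := huA (Nat.zero_le k)
    rw [hu0] at h3
    have : -β / (1 - β) ≤ 0 := div_nonpos_of_nonpos_of_nonneg (by linarith) hp.le
    simp only [hu] at h3
    linarith
  · intro Y y hY hy1 hy2
    obtain ⟨k, rfl⟩ : ∃ k, Y = k + 1 := ⟨Y - 1, by omega⟩
    have a1 := hz1 k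
    have a2 := hz2 k
    have hy0 : 0 < y := lt_of_lt_of_le (hpk k) hy1
    have a3 := tan _ _ (hpk k) hy0
    have a4 : ((k + 1 : ℕ):ℝ) ^ (-β) ≤ 2 * y ^ (-β) := by
      have hY1 : (1:ℝ) ≤ ((k + 1 : ℕ):ℝ) := by exact_mod_cast hY
      have : (2 * ((k + 1 : ℕ):ℝ)) ^ (-β) ≤ y ^ (-β) := rpow_neg_anti β h0.le _ _ hy0 (by linarith)
      rw [Real.mul_rpow (by norm_num) (by positivity)] at this
      have h2 : (1/2:ℝ) ≤ 2 ^ (-β) := by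
        calc (1/2:ℝ) = 2 ^ (-1:ℝ) := by rw [Real.rpow_neg_one]; norm_num
          _ ≤ 2 ^ (-β) := Real.rpow_le_rpow_of_exponent_le (by norm_num) (by linarith)
      have h3 : (0:ℝ) ≤ ((k + 1 : ℕ):ℝ) ^ (-β) := by positivity
      nlinarith
    have a5 : ((k + 1 : ℕ):ℝ) ^ (1 - β) / (1 - β) ≤ y ^ (1 - β) / (1 - β) := by
      gcongr
    have a6 : ((k + 1 : ℕ):ℝ) ^ (-β) * (y - ((k + 1 : ℕ):ℝ)) ≤ ((k + 1 : ℕ):ℝ) ^ (-β) := by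
      apply mul_le_of_le_one_right (by positivity)
      linarith
    simp only [hv, hu] at a1 a2
    rw [abs_le]
    constructor <;> linarith

end HB
end

section
open Finset Filter Topology
namespace HB

theorem abel0 (f : ℕ → ℝ) (q s : ℝ) (hs : 0 < s)
    (hf : ∀ y : ℕ, |∑ n ∈ Icc 1 y, f n| ≤ q) (E y : ℕ) :
    |∑ n ∈ Ioc E y, f n * (n:ℝ) ^ (-s)| ≤ 3 * q * ((E + 1 : ℕ) : ℝ) ^ (-s) := by
  have := abel f q 0 s le_rfl hs (fun y _ => by simpa using hf y) E y
  rw [sub_zero, div_self hs.ne', zero_sub] at this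
  refine this.trans (le_of_eq ?_)
  ring

theorem lemA_sum (f : ℕ → ℝ) (h1 : ∀ n, |f n| ≤ 1) (β z : ℝ)
    (hz : ∀ (Y : ℕ) (y : ℝ), 0 < Y → (Y:ℝ) ≤ y → y ≤ Y + 1 →
      |∑ n ∈ Icc 1 Y, (n:ℝ) ^ (-β) - y ^ (1 - β) / (1 - β) - z| ≤ 4 * y ^ (-β))
    (x E : ℕ) (hE : E ≤ x) :
    |∑ e ∈ Icc 1 E, f e * (e:ℝ) ^ (-β) * ∑ k ∈ Icc 1 (x / e), (k:ℝ) ^ (-β) -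
      ((x:ℝ) ^ (1 - β) / (1 - β) * PS f 1 E + z * PS f β E)| ≤ E * (4 * (x:ℝ) ^ (-β)) := by
  unfold PS
  rw [Finset.mul_sum, Finset.mul_sum, ← Finset.sum_add_distrib, ← Finset.sum_sub_distrib]
  refine (Finset.abs_sum_le_sum_abs _ _).trans ?_
  have : (E:ℝ) * (4 * (x:ℝ) ^ (-β)) = ∑ e ∈ Icc 1 E, 4 * (x:ℝ) ^ (-β) := by simp
  rw [this]
  apply Finset.sum_le_sum
  intro e he
  obtain ⟨he1, he2⟩ := mem_Icc.1 he
  have he0 : (0:ℝ) < e := by exact_mod_cast he1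
  have hx0 : (0:ℝ) < x := by exact_mod_cast (show 0 < x by omega)
  have hY : 0 < x / e := Nat.div_pos (by omega) (by omega)
  have h := hz (x / e) ((x:ℝ) / e) hY Nat.cast_div_le (by
    have := Nat.lt_floor_add_one ((x:ℝ) / e)
    rw [Nat.floor_div_natCast, Nat.floor_natCast] at this
    exact this.le)
  set Z := ∑ k ∈ Icc 1 (x / e), (k:ℝ) ^ (-β)
  have e1 : ((x:ℝ) / e) ^ (1 - β) * (e:ℝ) ^ (-β) = (x:ℝ) ^ (1 - β) * (e:ℝ) ^ (-1:ℝ) := by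
    rw [Real.div_rpow hx0.le he0.le, div_mul_eq_mul_div, mul_div_assoc, ← Real.rpow_sub he0]
    congr 2; ring
  have e2 : ((x:ℝ) / e) ^ (-β) * (e:ℝ) ^ (-β) = (x:ℝ) ^ (-β) := by
    rw [← Real.mul_rpow (by positivity) he0.le]
    congr 1; field_simp
  have e3 : f e * (e:ℝ) ^ (-β) * Z - ((x:ℝ) ^ (1 - β) / (1 - β) * (f e * (e:ℝ) ^ (-1:ℝ)) +
      z * (f e * (e:ℝ) ^ (-β))) =
      f e * ((e:ℝ) ^ (-β) * (Z - ((x:ℝ) / e) ^ (1 - β) / (1 - β) - z)) := by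
    have : (x:ℝ) ^ (1 - β) / (1 - β) * (f e * (e:ℝ) ^ (-1:ℝ)) =
      f e * (((x:ℝ) / e) ^ (1 - β) * (e:ℝ) ^ (-β)) / (1 - β) := by rw [e1]; ring
    rw [this]; ring
  rw [e3, abs_mul, abs_mul, abs_of_nonneg (by positivity : (0:ℝ) ≤ (e:ℝ) ^ (-β))]
  calc |f e| * ((e:ℝ) ^ (-β) * |Z - ((x:ℝ) / e) ^ (1 - β) / (1 - β) - z|)
      ≤ 1 * ((e:ℝ) ^ (-β) * (4 * ((x:ℝ) / e) ^ (-β))) := by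
        gcongr
        exact h1 e
    _ = 4 * (x:ℝ) ^ (-β) := by rw [← e2]; ring

theorem sqrt_bounds (x : ℕ) : (Nat.sqrt x : ℝ) ≤ (x:ℝ) ^ (1/2:ℝ) ∧
    (x:ℝ) ^ (1/2:ℝ) ≤ ((Nat.sqrt x + 1 : ℕ) : ℝ) := by
  rw [← Real.sqrt_eq_rpow]
  constructor
  · exact Real.nat_sqrt_le_real_sqrt
  · have := Real.real_sqrt_le_nat_sqrt_succ (a := x)
    push_cast; exact this

theorem lemA (f : ℕ → ℝ) (h1 : ∀ n, |f n| ≤ 1) (q : ℝ) (hq : 1 ≤ q)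
    (hf : ∀ y : ℕ, |∑ n ∈ Icc 1 y, f n| ≤ q) (β : ℝ) (hβ : 1/2 < β) (hβ1 : β < 1) :
    ∃ z : ℝ, z ≤ -β / (1 - β) ∧ -1 / (1 - β) ≤ z ∧ ∀ x : ℕ, 0 < x →
      |PS (cv f (fun _ => 1)) β x - (LS f 1 * ((x:ℝ) ^ (1 - β) / (1 - β)) + z * LS f β)| ≤
        (4 + 9 / (1 - β)) * q * (x:ℝ) ^ (1/2 - β) := by
  have hβ0 : 0 < β := by linarith
  obtain ⟨z, hz1, hz2, hz3, hz4⟩ := zeta_ex β hβ0 hβ1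
  refine ⟨z, hz1, hz2, fun x hx => ?_⟩
  have hp : 0 < 1 - β := by linarith
  have hx0 : (0:ℝ) < x := by exact_mod_cast hx
  have hx1 : (1:ℝ) ≤ x := by exact_mod_cast hx
  set E := Nat.sqrt x with hE
  obtain ⟨s1, s2⟩ := sqrt_bounds x
  rw [← hE] at s1 s2
  have hEpos : 0 < E := Nat.sqrt_pos.2 hx
  have hEx : E ≤ x := Nat.sqrt_le_self x
  have hdiv : x / (E + 1) ≤ E := by
    apply Nat.lt_succ_iff.1
    rw [Nat.div_lt_iff_lt_mul (by omega)]
    exact Nat.lt_succ_sqrt x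
  have hyp := hyperbola (fun n => f n * (n:ℝ) ^ (-β)) (fun n => 1 * (n:ℝ) ^ (-β)) x E
  have e1 : PS (cv f (fun _ => 1)) β x =
    ∑ n ∈ Icc 1 x, cv (fun n => f n * (n:ℝ) ^ (-β)) (fun n => 1 * (n:ℝ) ^ (-β)) n := by
    unfold PS
    apply Finset.sum_congr rfl
    intro n _
    rw [cv_wt f (fun _ => 1)]
  rw [e1, hyp]
  simp only [one_mul]
  have A := lemA_sum f h1 β z hz4 x E hEx
  set S1 := ∑ e ∈ Icc 1 E, f e * (e:ℝ) ^ (-β) * ∑ k ∈ Icc 1 (x / e), (k:ℝ) ^ (-β)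
  have B : |∑ k ∈ Icc 1 (x / (E + 1)), (k:ℝ) ^ (-β) * ∑ e ∈ Ioc E (x / k), f e * (e:ℝ) ^ (-β)| ≤
      3 * q * ((E + 1 : ℕ):ℝ) ^ (-β) * ((E:ℝ) ^ (1 - β) / (1 - β)) := by
    calc _ ≤ ∑ k ∈ Icc 1 (x / (E + 1)), (k:ℝ) ^ (-β) * (3 * q * ((E + 1 : ℕ):ℝ) ^ (-β)) := by
          refine (Finset.abs_sum_le_sum_abs _ _).trans (Finset.sum_le_sum fun k _ => ?_)
          rw [abs_mul, abs_of_nonneg (by positivity : (0:ℝ) ≤ (k:ℝ) ^ (-β))]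
          gcongr
          exact abel0 f q β hβ0 hf E _
      _ ≤ ∑ k ∈ Icc 1 E, (k:ℝ) ^ (-β) * (3 * q * ((E + 1 : ℕ):ℝ) ^ (-β)) := by
          apply Finset.sum_le_sum_of_subset_of_nonneg
          · exact Finset.Icc_subset_Icc_right hdiv
          · intros; positivity
      _ = (∑ k ∈ Icc 1 E, (k:ℝ) ^ (-β)) * (3 * q * ((E + 1 : ℕ):ℝ) ^ (-β)) := by
          rw [Finset.sum_mul]
      _ ≤ ((E:ℝ) ^ (1 - β) / (1 - β)) * (3 * q * ((E + 1 : ℕ):ℝ) ^ (-β)) := by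
          gcongr
          exact hz3 E hEpos
      _ = _ := by ring
  set S2 := ∑ k ∈ Icc 1 (x / (E + 1)), (k:ℝ) ^ (-β) * ∑ e ∈ Ioc E (x / k), f e * (e:ℝ) ^ (-β)
  have C1 := LS_tail0 f q 1 one_pos hf E
  have C2 := LS_tail0 f q β hβ0 hf E
  set X := (x:ℝ) ^ (1/2 - β) with hX
  have hxp : ∀ c : ℝ, 0 < (x:ℝ) ^ c := fun c => by positivity
  have mono : ∀ c : ℝ, 0 ≤ c → ((E + 1 : ℕ):ℝ) ^ (-c) ≤ (x:ℝ) ^ (-c/2) := by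
    intro c hc
    calc ((E + 1 : ℕ):ℝ) ^ (-c) ≤ ((x:ℝ) ^ (1/2:ℝ)) ^ (-c) := rpow_neg_anti c hc _ _ (hxp _) s2
      _ = (x:ℝ) ^ (-c/2) := by rw [← Real.rpow_mul hx0.le]; congr 1; ring
  have m1 := mono 1 one_pos.le
  have m2 := mono β hβ0.le
  have b1 : (E:ℝ) * (4 * (x:ℝ) ^ (-β)) ≤ 4 * X := by
    calc (E:ℝ) * (4 * (x:ℝ) ^ (-β)) ≤ (x:ℝ) ^ (1/2:ℝ) * (4 * (x:ℝ) ^ (-β)) := by gcongr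
      _ = 4 * ((x:ℝ) ^ (1/2:ℝ) * (x:ℝ) ^ (-β)) := by ring
      _ = 4 * X := by rw [← Real.rpow_add hx0, hX]; rfl
  have b2 : 3 * q * ((E + 1 : ℕ):ℝ) ^ (-β) * ((E:ℝ) ^ (1 - β) / (1 - β)) ≤ 3 * q / (1 - β) * X := by
    have h3 : (E:ℝ) ^ (1 - β) ≤ (x:ℝ) ^ ((1 - β)/2) := by
      calc (E:ℝ) ^ (1 - β) ≤ ((x:ℝ) ^ (1/2:ℝ)) ^ (1 - β) := by gcongr
        _ = _ := by rw [← Real.rpow_mul hx0.le]; congr 1; ring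
    calc _ ≤ 3 * q * (x:ℝ) ^ (-β/2) * ((x:ℝ) ^ ((1 - β)/2) / (1 - β)) := by gcongr
      _ = 3 * q / (1 - β) * ((x:ℝ) ^ (-β/2) * (x:ℝ) ^ ((1 - β)/2)) := by ring
      _ = _ := by rw [← Real.rpow_add hx0, hX]; congr 2; ring
  have b3 : (x:ℝ) ^ (1 - β) / (1 - β) * |LS f 1 - PS f 1 E| ≤ 3 * q / (1 - β) * X := by
    calc _ ≤ (x:ℝ) ^ (1 - β) / (1 - β) * (3 * q * (x:ℝ) ^ (-1/2:ℝ)) := by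
          gcongr
          exact C1.trans (by gcongr)
      _ = 3 * q / (1 - β) * ((x:ℝ) ^ (1 - β) * (x:ℝ) ^ (-1/2:ℝ)) := by ring
      _ = _ := by rw [← Real.rpow_add hx0, hX]; congr 2; ring
  have b4 : |z| * |LS f β - PS f β E| ≤ 3 * q / (1 - β) * X := by
    have hz : |z| ≤ 1 / (1 - β) := by
      rw [abs_le]
      refine ⟨by rw [← neg_div]; exact hz2, hz1.trans ?_⟩
      gcongr; linarith
    calc _ ≤ 1 / (1 - β) * (3 * q * (x:ℝ) ^ (-β/2)) := by
          gcongr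
          exact C2.trans (by gcongr)
      _ = 3 * q / (1 - β) * (x:ℝ) ^ (-β/2) := by ring
      _ ≤ _ := by
          gcongr
          rw [hX]
          exact Real.rpow_le_rpow_of_exponent_le hx1 (by linarith)
  have key : S1 + S2 - (LS f 1 * ((x:ℝ) ^ (1 - β) / (1 - β)) + z * LS f β) =
    (S1 - ((x:ℝ) ^ (1 - β) / (1 - β) * PS f 1 E + z * PS f β E)) + S2 +
      (- ((x:ℝ) ^ (1 - β) / (1 - β) * (LS f 1 - PS f 1 E))) + (- (z * (LS f β - PS f β E))) := by ring
  rw [key]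
  refine (abs_add_le _ _).trans ?_
  have t1 := abs_add_le ((S1 - ((x:ℝ) ^ (1 - β) / (1 - β) * PS f 1 E + z * PS f β E)) + S2)
    (- ((x:ℝ) ^ (1 - β) / (1 - β) * (LS f 1 - PS f 1 E)))
  have t2 := abs_add_le (S1 - ((x:ℝ) ^ (1 - β) / (1 - β) * PS f 1 E + z * PS f β E)) S2
  rw [abs_neg, abs_mul, abs_of_nonneg (by positivity : 0 ≤ (x:ℝ) ^ (1 - β) / (1 - β))] at t1
  rw [abs_neg, abs_mul]
  have hXp : 0 < X := hxp _
  have : (4 + 9 / (1 - β)) * q * X = 4 * X * q + 3 * q / (1 - β) * X + 3 * q / (1 - β) * X +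
     3 * q / (1 - β) * X := by ring
  have h4 : 4 * X ≤ 4 * X * q := le_mul_of_one_le_right (by positivity) hq
  linarith

end HB
end

section
open Finset Filter Topology
namespace HB

/-- real completely multiplicative characters with bounded partial sums -/
structure RC (χ : ℕ → ℝ) (q : ℝ) : Prop where
  one : χ 1 = 1
  mul : ∀ a b, χ (a * b) = χ a * χ b
  val : ∀ n, χ n = 0 ∨ χ n = 1 ∨ χ n = -1
  sum : ∀ y : ℕ, |∑ n ∈ Icc 1 y, χ n| ≤ q
  q1 : 1 ≤ q

theorem RC.abs {χ : ℕ → ℝ} {q : ℝ} (h : RC χ q) (n : ℕ) : |χ n| ≤ 1 := by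
  rcases h.val n with h | h | h <;> simp [h]

theorem RC.pow {χ : ℕ → ℝ} {q : ℝ} (h : RC χ q) (n k : ℕ) : χ (n ^ k) = χ n ^ k := by
  induction k with
  | zero => simp [h.one]
  | succ k ih => rw [pow_succ, h.mul, ih, pow_succ]

/-- arithmetic function attached to a sequence -/
def AF (χ : ℕ → ℝ) : ArithmeticFunction ℝ := ⟨fun n => if n = 0 then 0 else χ n, by simp⟩

theorem AF_apply (χ : ℕ → ℝ) (n : ℕ) (hn : n ≠ 0) : AF χ n = χ n := by
  show (if n = 0 then 0 else χ n) = χ n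
  simp [hn]

theorem cv_AF (α β : ℕ → ℝ) (n : ℕ) : cv α β n = (AF α * AF β) n := by
  rw [ArithmeticFunction.mul_apply]
  unfold cv
  apply Finset.sum_congr rfl
  intro p hp
  obtain ⟨h1, h2⟩ := Nat.mem_divisorsAntidiagonal.1 hp
  rw [AF_apply, AF_apply]
  · rintro h; apply h2; rw [← h1, h, mul_zero]
  · rintro h; apply h2; rw [← h1, h, zero_mul]

theorem AF_cv (α β : ℕ → ℝ) : AF (cv α β) = AF α * AF β := by
  ext n
  by_cases hn : n = 0
  · subst hn; simp
  · rw [AF_apply _ _ hn, cv_AF]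

theorem AF_mult (χ : ℕ → ℝ) (h1 : χ 1 = 1) (hm : ∀ a b, χ (a * b) = χ a * χ b) :
    (AF χ).IsMultiplicative := by
  rw [ArithmeticFunction.IsMultiplicative.iff_ne_zero]
  refine ⟨by rw [AF_apply _ _ one_ne_zero, h1], ?_⟩
  intro m n hm0 hn0 _
  rw [AF_apply _ _ hm0, AF_apply _ _ hn0, AF_apply _ _ (mul_ne_zero hm0 hn0), hm]

theorem mult_nonneg (f : ArithmeticFunction ℝ) (hf : f.IsMultiplicative)
    (h : ∀ p k : ℕ, p.Prime → 0 ≤ f (p ^ k)) (n : ℕ) : 0 ≤ f n := by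
  by_cases hn : n = 0
  · subst hn; simp
  rw [hf.multiplicative_factorization f hn]
  apply Finset.prod_nonneg
  intro p hp
  exact h p _ (Nat.prime_of_mem_primeFactors hp)

theorem cv_pp (α β : ℕ → ℝ) (p k : ℕ) (hp : p.Prime) :
    cv α β (p ^ k) = ∑ i ∈ range (k + 1), α (p ^ i) * β (p ^ (k - i)) := by
  unfold cv
  rw [Nat.sum_divisorsAntidiagonal (fun a b => α a * β b), Nat.sum_divisors_prime_pow hp]
  apply Finset.sum_congr rfl
  intro i hi
  rw [Nat.pow_div (by have := mem_range.1 hi; omega) hp.pos]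

theorem geo_nonneg (t : ℝ) (ht : t = 0 ∨ t = 1 ∨ t = -1) (k : ℕ) :
    0 ≤ ∑ i ∈ range k, t ^ i := by
  rcases ht with rfl | rfl | rfl
  · exact Finset.sum_nonneg fun i _ => by positivity
  · exact Finset.sum_nonneg fun i _ => by positivity
  · rw [neg_one_geom_sum]; split_ifs <;> norm_num

theorem geo_ge_one (t : ℝ) (ht : t = 0 ∨ t = 1 ∨ t = -1) (k : ℕ) :
    1 ≤ ∑ i ∈ range (2 * k + 1), t ^ i := by
  have : 0 ≤ t → 1 ≤ ∑ i ∈ range (2 * k + 1), t ^ i := by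
    intro h
    rw [Finset.sum_range_succ']
    have : 0 ≤ ∑ i ∈ range (2 * k), t ^ (i + 1) := Finset.sum_nonneg fun i _ => by positivity
    simp; exact this
  rcases ht with h | h | h
  · exact this (by simp [h])
  · exact this (by simp [h])
  · rw [h, neg_one_geom_sum, if_neg]
    simp

theorem cv_comm (α β : ℕ → ℝ) (n : ℕ) : cv α β n = cv β α n := by
  rw [cv_AF, cv_AF, mul_comm]

theorem r_pp {χ : ℕ → ℝ} {q : ℝ} (h : RC χ q) (p k : ℕ) (hp : p.Prime) :
    cv χ (fun _ => 1) (p ^ k) = ∑ i ∈ range (k + 1), χ p ^ i := by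
  rw [cv_pp _ _ _ _ hp]
  simp only [mul_one, h.pow]

theorem r_mult {χ : ℕ → ℝ} {q : ℝ} (h : RC χ q) : (AF χ * AF (fun _ => 1)).IsMultiplicative :=
  (AF_mult χ h.one h.mul).mul (AF_mult _ rfl (by simp))

theorem r_nonneg {χ : ℕ → ℝ} {q : ℝ} (h : RC χ q) (n : ℕ) : 0 ≤ cv χ (fun _ => 1) n := by
  rw [cv_AF]
  apply mult_nonneg _ (r_mult h)
  intro p k hp
  rw [← cv_AF, r_pp h p k hp]
  exact geo_nonneg _ (h.val p) _

theorem r_sq {χ : ℕ → ℝ} {q : ℝ} (h : RC χ q) (n : ℕ) (hn : n ≠ 0) :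
    1 ≤ cv χ (fun _ => 1) (n ^ 2) := by
  rw [cv_AF, (r_mult h).multiplicative_factorization _ (pow_ne_zero 2 hn)]
  unfold Finsupp.prod
  refine Finset.prod_induction _ (fun x : ℝ => 1 ≤ x) (fun a b ha hb => ?_) le_rfl ?_
  · nlinarith
  · intro p hp
    have hp' := Nat.prime_of_mem_primeFactors hp
    show 1 ≤ (AF χ * AF fun _ => 1) (p ^ ((n ^ 2).factorization p))
    rw [Nat.factorization_pow, ← cv_AF, r_pp h p _ hp']
    simp only [Finsupp.smul_apply, smul_eq_mul]
    exact geo_ge_one _ (h.val p) _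

/-- twisting -/
theorem cv_twist (χ α β : ℕ → ℝ) (hm : ∀ a b, χ (a * b) = χ a * χ b) (n : ℕ) :
    cv (fun n => χ n * α n) (fun n => χ n * β n) n = χ n * cv α β n := by
  unfold cv
  rw [Finset.mul_sum]
  apply Finset.sum_congr rfl
  intro p hp
  rw [← (Nat.mem_divisorsAntidiagonal.1 hp).1, hm]
  ring

theorem cv_nonneg (α β : ℕ → ℝ) (p k : ℕ) (hp : p.Prime) (ha : ∀ i, 0 ≤ α (p ^ i))
    (hb : ∀ i, 0 ≤ β (p ^ i)) : 0 ≤ cv α β (p ^ k) := by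
  rw [cv_pp _ _ _ _ hp]
  exact Finset.sum_nonneg fun i _ => mul_nonneg (ha _) (hb _)

theorem a_nonneg {χ1 χ2 : ℕ → ℝ} {q1 q2 : ℝ} (h1 : RC χ1 q1) (h2 : RC χ2 q2) (n : ℕ) :
    0 ≤ cv (cv χ2 (fun n => χ2 n * χ1 n)) (cv χ1 (fun _ => 1)) n := by
  rw [cv_AF, AF_cv, AF_cv]
  have hm12 : (AF (fun n => χ2 n * χ1 n)).IsMultiplicative :=
    AF_mult _ (by simp [h1.one, h2.one]) (fun a b => by rw [h1.mul, h2.mul]; ring)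
  apply mult_nonneg _ (((AF_mult _ h2.one h2.mul).mul hm12).mul (r_mult h1))
  intro p k hp
  have nn1 : ∀ i, 0 ≤ cv χ1 (fun _ => 1) (p ^ i) := fun i => r_nonneg h1 _
  have nn2 : ∀ i, 0 ≤ cv χ2 (fun _ => 1) (p ^ i) := fun i => r_nonneg h2 _
  by_cases hc : 0 ≤ χ2 p
  · rw [← AF_cv, ← AF_cv, ← cv_AF]
    apply cv_nonneg _ _ _ _ hp _ nn1
    intro i
    have := cv_twist χ2 (fun _ => 1) χ1 h2.mul (p ^ i)
    simp only [mul_one] at this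
    rw [show χ2 = fun n => χ2 n from rfl, this, cv_comm]
    exact mul_nonneg (by rw [h2.pow]; positivity) (nn1 i)
  by_cases hd : 0 ≤ χ1 p
  · have e : AF χ2 * AF (fun n => χ2 n * χ1 n) * (AF χ1 * AF fun _ => 1) =
      (AF χ1 * AF (fun n => χ1 n * χ2 n)) * (AF χ2 * AF fun _ => 1) := by
      simp only [mul_comm (χ1 _)]
      ring
    rw [e, ← AF_cv, ← AF_cv, ← cv_AF]
    apply cv_nonneg _ _ _ _ hp _ nn2
    intro i
    have := cv_twist χ1 (fun _ => 1) χ2 h1.mul (p ^ i)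
    simp only [mul_one] at this
    rw [show χ1 = fun n => χ1 n from rfl, this, cv_comm]
    exact mul_nonneg (by rw [h1.pow]; positivity) (nn2 i)
  · have c1 : χ1 p = -1 := by
      rcases h1.val p with h | h | h
      · exact absurd h.ge hd
      · exact absurd (by rw [h]; norm_num) hd
      · exact h
    have c2 : χ2 p = -1 := by
      rcases h2.val p with h | h | h
      · exact absurd h.ge hc
      · exact absurd (by rw [h]; norm_num) hc
      · exact h
    rw [← AF_cv, ← AF_cv, ← cv_AF]
    apply cv_nonneg _ _ _ _ hp _ nn1
    intro i
    have : cv χ2 (fun n => χ2 n * χ1 n) (p ^ i) = cv χ2 (fun _ => 1) (p ^ i) := by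
      rw [cv_pp _ _ _ _ hp, cv_pp _ _ _ _ hp]
      apply Finset.sum_congr rfl
      intro j _
      rw [h2.pow p (i - j), h1.pow p (i - j), c1, c2, ← mul_pow]
      norm_num
    rw [this]
    exact nn2 i

theorem PS_r_ge_one {χ : ℕ → ℝ} {q : ℝ} (h : RC χ q) (s : ℝ) (x : ℕ) (hx : 0 < x) :
    1 ≤ PS (cv χ (fun _ => 1)) s x := by
  unfold PS
  have : (1:ℝ) = cv χ (fun _ => 1) 1 * ((1:ℕ):ℝ) ^ (-s) := by simp [cv, h.one]
  refine this.le.trans ?_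
  apply Finset.single_le_sum (f := fun n : ℕ => cv χ (fun _ => 1) n * (n:ℝ) ^ (-s))
  · intro i _
    exact mul_nonneg (r_nonneg h i) (by positivity)
  · simp; omega

theorem PS_r_ge_sq {χ : ℕ → ℝ} {q : ℝ} (h : RC χ q) (s : ℝ) (K : ℕ) :
    ∑ k ∈ Icc 1 K, ((k ^ 2 : ℕ):ℝ) ^ (-s) ≤ PS (cv χ (fun _ => 1)) s (K ^ 2) := by
  unfold PS
  have hinj : Set.InjOn (fun k : ℕ => k ^ 2) (Icc 1 K : Finset ℕ) := by
    intro a _ b _ hab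
    exact Nat.pow_left_injective (n := 2) (by norm_num) hab
  calc ∑ k ∈ Icc 1 K, ((k ^ 2 : ℕ):ℝ) ^ (-s)
      = ∑ n ∈ (Icc 1 K).image (fun k : ℕ => (k ^ 2 : ℕ)), (n:ℝ) ^ (-s) := by
        rw [Finset.sum_image hinj]
    _ ≤ ∑ n ∈ (Icc 1 K).image (fun k : ℕ => (k ^ 2 : ℕ)), cv χ (fun _ => 1) n * (n:ℝ) ^ (-s) := by
        apply Finset.sum_le_sum
        intro n hn
        obtain ⟨k, hk, rfl⟩ := mem_image.1 hn
        have hk1 := (mem_Icc.1 hk).1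
        exact le_mul_of_one_le_left (by positivity) (r_sq h k (by omega))
    _ ≤ _ := by
        apply Finset.sum_le_sum_of_subset_of_nonneg
        · intro n hn
          obtain ⟨k, hk, rfl⟩ := mem_image.1 hn
          obtain ⟨a, b⟩ := mem_Icc.1 hk
          exact mem_Icc.2 ⟨Nat.one_le_pow _ _ (by omega), Nat.pow_le_pow_left b 2⟩
        · intro i _ _
          exact mul_nonneg (r_nonneg h i) (by positivity)

/-- bound for L(s) -/
theorem LS_abs {f : ℕ → ℝ} {q s : ℝ} (hs : 0 < s)
    (hf : ∀ y : ℕ, |∑ n ∈ Icc 1 y, f n| ≤ q) : |LS f s| ≤ 3 * q := by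
  have := LS_tail0 f q s hs hf 0
  simpa [PS] using this

theorem L1_pos {χ : ℕ → ℝ} {q : ℝ} (h : RC χ q) : 0 < LS χ 1 := by
  by_contra hneg
  have hneg : LS χ 1 ≤ 0 := not_lt.1 hneg
  have hq0 : 0 < q := lt_of_lt_of_le one_pos h.q1
  -- bound for each s
  have key : ∀ s : ℝ, 1/2 < s → s < 3/4 → ∀ K : ℕ, ∑ k ∈ Icc 1 K, ((k ^ 2 : ℕ):ℝ) ^ (-s) ≤ 12 * q := by
    intro s hs1 hs2 K
    obtain ⟨z, hz1, hz2, hz⟩ := lemA χ h.abs q h.q1 h.sum s hs1 (by linarith)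
    have hp : 0 < 1 - s := by linarith
    have hz' : |z| ≤ 4 := by
      rw [abs_le]
      constructor
      · refine le_trans ?_ hz2
        rw [le_div_iff₀ hp]; linarith
      · refine hz1.trans ?_
        rw [div_le_iff₀ hp]; linarith
    have hzL : z * LS χ s ≤ 12 * q := by
      refine (le_abs_self _).trans ?_
      rw [abs_mul]
      calc |z| * |LS χ s| ≤ 4 * (3 * q) := by
            gcongr
            exact LS_abs (by linarith) h.sum
        _ = 12 * q := by ring
    -- limit
    have lim := (tendsto_pow0 (1/2 - s) (by linarith) ((4 + 9 / (1 - s)) * q)).const_add (12 * q)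
    rw [add_zero] at lim
    refine ge_of_tendsto lim ?_
    filter_upwards [eventually_ge_atTop (K ^ 2)] with N hN
    have hA := hz (N + 1) (by omega)
    have h1 := PS_r_ge_sq h s K
    have h2 : PS (cv χ (fun _ => 1)) s (K ^ 2) ≤ PS (cv χ (fun _ => 1)) s (N + 1) := by
      unfold PS
      apply Finset.sum_le_sum_of_subset_of_nonneg
      · exact Finset.Icc_subset_Icc_right (by omega)
      · intro i _ _
        exact mul_nonneg (r_nonneg h i) (by positivity)
    have h3 : LS χ 1 * ((((N + 1 : ℕ):ℝ)) ^ (1 - s) / (1 - s)) ≤ 0 :=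
      mul_nonpos_of_nonpos_of_nonneg hneg (by positivity)
    have h4 := (abs_le.1 hA).2
    linarith
  have key2 : ∀ K : ℕ, ∑ k ∈ Icc 1 K, ((k ^ 2 : ℕ):ℝ) ^ (-(1/2:ℝ)) ≤ 12 * q := by
    intro K
    have hc : ContinuousAt (fun s : ℝ => ∑ k ∈ Icc 1 K, ((k ^ 2 : ℕ):ℝ) ^ (-s)) (1/2) := by
      apply tendsto_finsetSum
      intro k hk
      have hk0 : ((k ^ 2 : ℕ):ℝ) ≠ 0 := by
        have := (mem_Icc.1 hk).1
        exact_mod_cast pow_ne_zero 2 (show k ≠ 0 by omega)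
      exact ((Real.continuous_const_rpow hk0).comp continuous_neg).continuousAt
    have hc' : Tendsto (fun s : ℝ => ∑ k ∈ Icc 1 K, ((k ^ 2 : ℕ):ℝ) ^ (-s)) (𝓝[>] (1/2))
      (𝓝 (∑ k ∈ Icc 1 K, ((k ^ 2 : ℕ):ℝ) ^ (-(1/2:ℝ)))) := hc.tendsto.mono_left nhdsWithin_le_nhds
    refine le_of_tendsto hc' ?_
    filter_upwards [Ioo_mem_nhdsGT (show (1/2:ℝ) < 3/4 by norm_num)] with s hs
    exact key s hs.1 hs.2 K
  have hdiv := Real.tendsto_sum_range_one_div_nat_succ_atTop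
  obtain ⟨K, hK⟩ := (hdiv.eventually (eventually_gt_atTop (12 * q))).exists
  have := key2 K
  have e : ∑ k ∈ Icc 1 K, ((k ^ 2 : ℕ):ℝ) ^ (-(1/2:ℝ)) = ∑ i ∈ range K, 1 / ((i:ℝ) + 1) := by
    have : Icc 1 K = (range K).image (fun i => i + 1) := by
      ext x
      simp only [mem_Icc, mem_image, mem_range]
      constructor
      · rintro ⟨a, b⟩; exact ⟨x - 1, by omega, by omega⟩
      · rintro ⟨a, b, rfl⟩; omega
    rw [this, Finset.sum_image (by intro a _ b _ h; simpa using h)]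
    apply Finset.sum_congr rfl
    intro i _
    have h0 : (0:ℝ) < (i:ℝ) + 1 := by positivity
    push_cast
    rw [← Real.rpow_natCast, ← Real.rpow_mul h0.le]
    norm_num
    rw [Real.rpow_neg_one]
  rw [e] at this
  linarith

end HB
end

section
open Finset Filter Topology
namespace HB

theorem sqrt_div_le (x : ℕ) : x / (Nat.sqrt x + 1) ≤ Nat.sqrt x := by
  apply Nat.lt_succ_iff.1
  rw [Nat.div_lt_iff_lt_mul (by omega)]
  exact Nat.lt_succ_sqrt x

theorem sum_Ioc_eq (f : ℕ → ℝ) (a b : ℕ) (h : a ≤ b) :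
    ∑ n ∈ Ioc a b, f n = ∑ n ∈ Icc 1 b, f n - ∑ n ∈ Icc 1 a, f n := by
  have h1 : Icc 1 b = Icc 1 a ∪ Ioc a b := by
    ext x; simp only [mem_Icc, mem_union, mem_Ioc]; omega
  rw [h1, Finset.sum_union]
  · ring
  · rw [Finset.disjoint_left]; intro x; simp only [mem_Icc, mem_Ioc]; omega

theorem abs_Ioc_le (f : ℕ → ℝ) (p : ℝ) (hp : ∀ y : ℕ, |∑ n ∈ Icc 1 y, f n| ≤ p) (a b : ℕ) :
    |∑ n ∈ Ioc a b, f n| ≤ 2 * p := by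
  have h0 : 0 ≤ p := (abs_nonneg _).trans (hp 0)
  rcases le_or_gt a b with h | h
  · rw [sum_Ioc_eq f a b h]
    have := abs_sub (∑ n ∈ Icc 1 b, f n) (∑ n ∈ Icc 1 a, f n)
    have := hp a; have := hp b
    linarith
  · rw [Finset.Ioc_eq_empty (by omega)]; simp; exact h0

theorem lemB1 (f g : ℕ → ℝ) (p q : ℝ) (hf1 : ∀ n, |f n| ≤ 1) (hg1 : ∀ n, |g n| ≤ 1)
    (hf : ∀ y : ℕ, |∑ n ∈ Icc 1 y, f n| ≤ p) (hg : ∀ y : ℕ, |∑ n ∈ Icc 1 y, g n| ≤ q)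
    (hp : 1 ≤ p) (hq : 1 ≤ q) (y : ℕ) :
    |∑ n ∈ Icc 1 y, cv f g n| ≤ 3 * (p * q) * (y:ℝ) ^ (1/2:ℝ) := by
  rw [hyperbola f g y (Nat.sqrt y)]
  set E := Nat.sqrt y with hE
  have s1 := (sqrt_bounds y).1
  rw [← hE] at s1
  have A : |∑ e ∈ Icc 1 E, f e * ∑ k ∈ Icc 1 (y / e), g k| ≤ E * q := by
    refine (Finset.abs_sum_le_sum_abs _ _).trans ?_
    have : (E:ℝ) * q = ∑ e ∈ Icc 1 E, q := by simp
    rw [this]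
    apply Finset.sum_le_sum
    intro e _
    rw [abs_mul, ← one_mul q]
    exact mul_le_mul (hf1 e) (hg _) (abs_nonneg _) zero_le_one
  have B : |∑ k ∈ Icc 1 (y / (E + 1)), g k * ∑ e ∈ Ioc E (y / k), f e| ≤ E * (2 * p) := by
    refine (Finset.abs_sum_le_sum_abs _ _).trans ?_
    calc _ ≤ ∑ k ∈ Icc 1 (y / (E + 1)), 2 * p := by
          apply Finset.sum_le_sum
          intro e _
          rw [abs_mul, ← one_mul (2 * p)]
          exact mul_le_mul (hg1 e) (abs_Ioc_le f p hf _ _) (abs_nonneg _) zero_le_one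
      _ = ((y / (E + 1) : ℕ):ℝ) * (2 * p) := by simp
      _ ≤ E * (2 * p) := by
          gcongr
          exact sqrt_div_le y
  refine (abs_add_le _ _).trans ((add_le_add A B).trans ?_)
  calc (E:ℝ) * q + E * (2 * p) = E * (q + 2 * p) := by ring
    _ ≤ (y:ℝ) ^ (1/2:ℝ) * (3 * (p * q)) := by
        gcongr
        nlinarith
    _ = _ := by ring

theorem lemB2 (f g : ℕ → ℝ) (p q : ℝ) (hf1 : ∀ n, |f n| ≤ 1) (hg1 : ∀ n, |g n| ≤ 1)
    (hf : ∀ y : ℕ, |∑ n ∈ Icc 1 y, f n| ≤ p) (hg : ∀ y : ℕ, |∑ n ∈ Icc 1 y, g n| ≤ q)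
    (hp : 1 ≤ p) (hq : 1 ≤ q) (y : ℕ) (hy : 0 < y) :
    |PS (cv f g) 1 y - LS f 1 * LS g 1| ≤ 18 * (p * q) * (y:ℝ) ^ (-(1/4):ℝ) := by
  have hy0 : (0:ℝ) < y := by exact_mod_cast hy
  have hy1 : (1:ℝ) ≤ y := by exact_mod_cast hy
  have e1 : PS (cv f g) 1 y =
    ∑ n ∈ Icc 1 y, cv (fun n => f n * (n:ℝ) ^ (-1:ℝ)) (fun n => g n * (n:ℝ) ^ (-1:ℝ)) n := by
    unfold PS
    exact Finset.sum_congr rfl fun n _ => (cv_wt f g 1 n).symm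
  set E := Nat.sqrt y with hE
  rw [e1, hyperbola _ _ y E]
  obtain ⟨s1, s2⟩ := sqrt_bounds y
  rw [← hE] at s1 s2
  have hEpos : 0 < E := Nat.sqrt_pos.2 hy
  have A : |∑ e ∈ Icc 1 E, f e * (e:ℝ) ^ (-1:ℝ) * ∑ k ∈ Icc 1 (y / e), g k * (k:ℝ) ^ (-1:ℝ) -
      LS g 1 * PS f 1 E| ≤ E * (3 * q / y) := by
    unfold PS
    rw [Finset.mul_sum, ← Finset.sum_sub_distrib]
    refine (Finset.abs_sum_le_sum_abs _ _).trans ?_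
    have : (E:ℝ) * (3 * q / y) = ∑ e ∈ Icc 1 E, 3 * q / y := by simp
    rw [this]
    apply Finset.sum_le_sum
    intro e he
    have he1 := (mem_Icc.1 he).1
    have he0 : (0:ℝ) < e := by exact_mod_cast he1
    have t := LS_tail0 g q 1 one_pos hg (y / e)
    rw [abs_sub_comm] at t
    unfold PS at t
    have e3 : f e * (e:ℝ) ^ (-1:ℝ) * ∑ k ∈ Icc 1 (y / e), g k * (k:ℝ) ^ (-1:ℝ) -
      LS g 1 * (f e * (e:ℝ) ^ (-1:ℝ)) =
      f e * ((e:ℝ) ^ (-1:ℝ) * (∑ k ∈ Icc 1 (y / e), g k * (k:ℝ) ^ (-1:ℝ) - LS g 1)) := by ring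
    rw [e3, abs_mul, abs_mul, abs_of_nonneg (by positivity : (0:ℝ) ≤ (e:ℝ) ^ (-1:ℝ))]
    have t2 : (((y / e + 1 : ℕ):ℝ)) ^ (-1:ℝ) ≤ ((y:ℝ) / e) ^ (-1:ℝ) := by
      apply rpow_neg_anti 1 zero_le_one _ _ (by positivity)
      have := Nat.lt_floor_add_one ((y:ℝ) / e)
      rw [Nat.floor_div_natCast, Nat.floor_natCast] at this
      push_cast
      exact this.le
    calc _ ≤ 1 * ((e:ℝ) ^ (-1:ℝ) * (3 * q * ((y:ℝ) / e) ^ (-1:ℝ))) := by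
          gcongr
          · exact hf1 e
          · exact t.trans (by gcongr)
      _ = 3 * q / y := by
          rw [Real.rpow_neg_one, Real.rpow_neg_one]; field_simp
  set S1 := ∑ e ∈ Icc 1 E, f e * (e:ℝ) ^ (-1:ℝ) * ∑ k ∈ Icc 1 (y / e), g k * (k:ℝ) ^ (-1:ℝ)
  obtain ⟨z, -, -, hz3, -⟩ := zeta_ex (1/2) (by norm_num) (by norm_num)
  have B : |∑ k ∈ Icc 1 (y / (E + 1)), g k * (k:ℝ) ^ (-1:ℝ) * ∑ e ∈ Ioc E (y / k), f e * (e:ℝ) ^ (-1:ℝ)|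
      ≤ 3 * p * ((E + 1 : ℕ):ℝ) ^ (-1:ℝ) * (2 * (E:ℝ) ^ (1/2:ℝ)) := by
    calc _ ≤ ∑ k ∈ Icc 1 (y / (E + 1)), (k:ℝ) ^ (-(1/2):ℝ) * (3 * p * ((E + 1 : ℕ):ℝ) ^ (-1:ℝ)) := by
          refine (Finset.abs_sum_le_sum_abs _ _).trans (Finset.sum_le_sum fun k hk => ?_)
          have hk1 : (1:ℝ) ≤ k := by exact_mod_cast (mem_Icc.1 hk).1
          rw [abs_mul, abs_mul, abs_of_nonneg (by positivity : (0:ℝ) ≤ (k:ℝ) ^ (-1:ℝ))]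
          gcongr
          · calc |g k| * (k:ℝ) ^ (-1:ℝ) ≤ 1 * (k:ℝ) ^ (-(1/2):ℝ) := by
                  gcongr
                  · exact hg1 k
                  · norm_num
              _ = _ := one_mul _
          · exact abel0 f p 1 one_pos hf E _
      _ ≤ ∑ k ∈ Icc 1 E, (k:ℝ) ^ (-(1/2):ℝ) * (3 * p * ((E + 1 : ℕ):ℝ) ^ (-1:ℝ)) := by
          apply Finset.sum_le_sum_of_subset_of_nonneg
          · exact Finset.Icc_subset_Icc_right (sqrt_div_le y)
          · intros; positivity
      _ = (∑ k ∈ Icc 1 E, (k:ℝ) ^ (-(1/2):ℝ)) * (3 * p * ((E + 1 : ℕ):ℝ) ^ (-1:ℝ)) := by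
          rw [Finset.sum_mul]
      _ ≤ (2 * (E:ℝ) ^ (1/2:ℝ)) * (3 * p * ((E + 1 : ℕ):ℝ) ^ (-1:ℝ)) := by
          gcongr
          have := hz3 E hEpos
          norm_num at this ⊢
          linarith
      _ = _ := by ring
  set S2 := ∑ k ∈ Icc 1 (y / (E + 1)), g k * (k:ℝ) ^ (-1:ℝ) * ∑ e ∈ Ioc E (y / k), f e * (e:ℝ) ^ (-1:ℝ)
  have C1 := LS_tail0 f p 1 one_pos hf E
  have m1 : ((E + 1 : ℕ):ℝ) ^ (-1:ℝ) ≤ (y:ℝ) ^ (-(1/2):ℝ) := by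
    calc ((E + 1 : ℕ):ℝ) ^ (-1:ℝ) ≤ ((y:ℝ) ^ (1/2:ℝ)) ^ (-1:ℝ) :=
          rpow_neg_anti 1 zero_le_one _ _ (by positivity) s2
      _ = _ := by rw [← Real.rpow_mul hy0.le]; congr 1; norm_num
  set Y := (y:ℝ) ^ (-(1/4):ℝ) with hY
  have hYp : 0 < Y := by positivity
  have mY : (y:ℝ) ^ (-(1/2):ℝ) ≤ Y := by
    rw [hY]; exact Real.rpow_le_rpow_of_exponent_le hy1 (by norm_num)
  have b1 : (E:ℝ) * (3 * q / y) ≤ 3 * q * Y := by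
    calc (E:ℝ) * (3 * q / y) ≤ (y:ℝ) ^ (1/2:ℝ) * (3 * q / y) := by gcongr
      _ = 3 * q * ((y:ℝ) ^ (1/2:ℝ) / (y:ℝ) ^ (1:ℝ)) := by rw [Real.rpow_one]; ring
      _ = 3 * q * (y:ℝ) ^ (-(1/2):ℝ) := by rw [← Real.rpow_sub hy0]; norm_num
      _ ≤ 3 * q * Y := by gcongr
  have b2 : 3 * p * ((E + 1 : ℕ):ℝ) ^ (-1:ℝ) * (2 * (E:ℝ) ^ (1/2:ℝ)) ≤ 6 * p * Y := by
    have h3 : (E:ℝ) ^ (1/2:ℝ) ≤ (y:ℝ) ^ (1/4:ℝ) := by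
      calc (E:ℝ) ^ (1/2:ℝ) ≤ ((y:ℝ) ^ (1/2:ℝ)) ^ (1/2:ℝ) := by gcongr
        _ = _ := by rw [← Real.rpow_mul hy0.le]; congr 1; norm_num
    calc _ ≤ 3 * p * (y:ℝ) ^ (-(1/2):ℝ) * (2 * (y:ℝ) ^ (1/4:ℝ)) := by gcongr
      _ = 6 * p * ((y:ℝ) ^ (-(1/2):ℝ) * (y:ℝ) ^ (1/4:ℝ)) := by ring
      _ = _ := by rw [← Real.rpow_add hy0, hY]; norm_num
  have b3 : |LS g 1| * |LS f 1 - PS f 1 E| ≤ 9 * (p * q) * Y := by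
    calc _ ≤ (3 * q) * (3 * p * Y) := by
          gcongr
          · exact LS_abs one_pos hg
          · exact C1.trans (by gcongr; exact m1.trans mY)
      _ = _ := by ring
  have key : S1 + S2 - LS f 1 * LS g 1 = (S1 - LS g 1 * PS f 1 E) + S2 + (-(LS g 1 * (LS f 1 - PS f 1 E))) := by ring
  rw [key]
  refine (abs_add_le _ _).trans ?_
  have t2 := abs_add_le (S1 - LS g 1 * PS f 1 E) S2
  rw [abs_neg, abs_mul]
  have h1 : q * Y ≤ p * q * Y := by
    have := mul_pos (lt_of_lt_of_le one_pos hq) hYp; nlinarith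
  have h2 : p * Y ≤ p * q * Y := by
    have := mul_pos (lt_of_lt_of_le one_pos hp) hYp; nlinarith
  linarith

end HB
end

section
open Finset Filter Topology
namespace HB

theorem r_real {χ : ℕ → ℝ} {q : ℝ} (h : RC χ q) (β : ℝ) (hβ : 1/2 < β) (hβ1 : β < 1)
    (h0 : LS χ β = 0) : ∃ K : ℝ, 1 ≤ K ∧ ∀ (Y : ℕ) (y : ℝ), 0 < Y → (Y:ℝ) ≤ y → y ≤ Y + 1 →
    |PS (cv χ (fun _ => 1)) β Y - LS χ 1 * (y ^ (1 - β) / (1 - β))| ≤ K * y ^ (1/2 - β) := by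
  obtain ⟨z, -, -, hz⟩ := lemA χ h.abs q h.q1 h.sum β hβ hβ1
  have hp : 0 < 1 - β := by linarith
  have hL := L1_pos h
  have hq := h.q1
  set K0 := (4 + 9 / (1 - β)) * q with hK0
  have hK01 : 1 ≤ K0 := by
    have : 0 < 9 / (1 - β) := by positivity
    nlinarith
  refine ⟨2 * (K0 + LS χ 1), by linarith, fun Y y hY hy1 hy2 => ?_⟩
  have hY1 : (1:ℝ) ≤ Y := by exact_mod_cast hY
  have hY0 : (0:ℝ) < Y := by linarith
  have hy0 : 0 < y := by linarith
  have a1 := hz Y hY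
  rw [h0, mul_zero, add_zero] at a1
  have a2 : (Y:ℝ) ^ (1/2 - β) ≤ 2 * y ^ (1/2 - β) := by
    have e : (1/2 - β) = -(β - 1/2) := by ring
    have h1 : (2 * (Y:ℝ)) ^ (1/2 - β) ≤ y ^ (1/2 - β) := by
      rw [e]; exact rpow_neg_anti _ (by linarith) _ _ hy0 (by linarith)
    rw [Real.mul_rpow (by norm_num) hY0.le] at h1
    have h2 : (1/2:ℝ) ≤ 2 ^ (1/2 - β) := by
      calc (1/2:ℝ) = 2 ^ (-1:ℝ) := by rw [Real.rpow_neg_one]; norm_num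
        _ ≤ 2 ^ (1/2 - β) := Real.rpow_le_rpow_of_exponent_le (by norm_num) (by linarith)
    have h3 : (0:ℝ) ≤ (Y:ℝ) ^ (1/2 - β) := by positivity
    nlinarith
  have a3 := tangent (1 - β) Y y hp.le (by linarith) hY0 hy0
  have a4 : (Y:ℝ) ^ (1 - β) ≤ y ^ (1 - β) := by gcongr
  have a5 : (Y:ℝ) ^ (1 - β - 1) ≤ (Y:ℝ) ^ (1/2 - β) :=
    Real.rpow_le_rpow_of_exponent_le hY1 (by linarith)
  have a6 : y ^ (1 - β) / (1 - β) - (Y:ℝ) ^ (1 - β) / (1 - β) ≤ (Y:ℝ) ^ (1/2 - β) := by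
    rw [← sub_div, div_le_iff₀ hp]
    calc y ^ (1 - β) - (Y:ℝ) ^ (1 - β) ≤ (1 - β) * (Y:ℝ) ^ (1 - β - 1) * (y - Y) := by linarith
      _ ≤ (1 - β) * (Y:ℝ) ^ (1/2 - β) * 1 := by gcongr; linarith
      _ = _ := by ring
  have a7 : 0 ≤ y ^ (1 - β) / (1 - β) - (Y:ℝ) ^ (1 - β) / (1 - β) := by
    rw [← sub_div]; exact div_nonneg (by linarith) hp.le
  have key : PS (cv χ (fun _ => 1)) β Y - LS χ 1 * (y ^ (1 - β) / (1 - β)) =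
    (PS (cv χ (fun _ => 1)) β Y - LS χ 1 * ((Y:ℝ) ^ (1 - β) / (1 - β))) +
    -(LS χ 1 * (y ^ (1 - β) / (1 - β) - (Y:ℝ) ^ (1 - β) / (1 - β))) := by ring
  rw [key]
  refine (abs_add_le _ _).trans ?_
  rw [abs_neg, abs_mul, abs_of_pos hL, abs_of_nonneg a7]
  calc _ ≤ K0 * (2 * y ^ (1/2 - β)) + LS χ 1 * (2 * y ^ (1/2 - β)) := by
        gcongr
        · exact a1.trans (by gcongr)
        · exact a6.trans a2
    _ = _ := by ring

theorem cv_abs_le (f g : ℕ → ℝ) (hf1 : ∀ n, |f n| ≤ 1) (hg1 : ∀ n, |g n| ≤ 1) (n : ℕ) :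
    |cv f g n| ≤ n := by
  unfold cv
  refine (Finset.abs_sum_le_sum_abs _ _).trans ?_
  calc _ ≤ ∑ p ∈ n.divisorsAntidiagonal, (1:ℝ) := by
        apply Finset.sum_le_sum
        intro p _
        rw [abs_mul]
        exact mul_le_one₀ (hf1 _) (abs_nonneg _) (hg1 _)
    _ = n.divisors.card := by
        simp
        rw [← Nat.map_div_right_divisors, Finset.card_map]
    _ ≤ n := by exact_mod_cast Nat.card_divisors_le_self n

/-- The hyperbola estimate, first part. -/
theorem lemC_first (b r : ℕ → ℝ) (β L K : ℝ) (hb : ∀ n, |b n| ≤ n) (hK : 0 ≤ K)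
    (hr : ∀ (Y : ℕ) (y : ℝ), 0 < Y → (Y:ℝ) ≤ y → y ≤ Y + 1 →
      |PS r β Y - L * (y ^ (1 - β) / (1 - β))| ≤ K * y ^ (1/2 - β)) (x E : ℕ) (hE : E ≤ x) :
    |∑ e ∈ Icc 1 E, b e * (e:ℝ) ^ (-β) * PS r β (x / e) - L * ((x:ℝ) ^ (1 - β) / (1 - β)) * PS b 1 E| ≤
      E * (E * (K * (x:ℝ) ^ (1/2 - β))) := by
  unfold PS at *
  rw [Finset.mul_sum, ← Finset.sum_sub_distrib]
  refine (Finset.abs_sum_le_sum_abs _ _).trans ?_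
  have : (E:ℝ) * (E * (K * (x:ℝ) ^ (1/2 - β))) = ∑ e ∈ Icc 1 E, E * (K * (x:ℝ) ^ (1/2 - β)) := by simp
  rw [this]
  apply Finset.sum_le_sum
  intro e he
  obtain ⟨he1, he2⟩ := mem_Icc.1 he
  have he0 : (0:ℝ) < e := by exact_mod_cast he1
  have he1' : (1:ℝ) ≤ e := by exact_mod_cast he1
  have hx0 : (0:ℝ) < x := by exact_mod_cast (show 0 < x by omega)
  have hY : 0 < x / e := Nat.div_pos (by omega) (by omega)
  have h := hr (x / e) ((x:ℝ) / e) hY Nat.cast_div_le (by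
    have := Nat.lt_floor_add_one ((x:ℝ) / e)
    rw [Nat.floor_div_natCast, Nat.floor_natCast] at this
    exact this.le)
  set Z := ∑ n ∈ Icc 1 (x / e), r n * (n:ℝ) ^ (-β)
  have e1 : ((x:ℝ) / e) ^ (1 - β) * (e:ℝ) ^ (-β) = (x:ℝ) ^ (1 - β) * (e:ℝ) ^ (-1:ℝ) := by
    rw [Real.div_rpow hx0.le he0.le, div_mul_eq_mul_div, mul_div_assoc, ← Real.rpow_sub he0]
    congr 2; ring
  have e2 : ((x:ℝ) / e) ^ (1/2 - β) * (e:ℝ) ^ (-β) = (x:ℝ) ^ (1/2 - β) * (e:ℝ) ^ (-(1/2):ℝ) := by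
    rw [Real.div_rpow hx0.le he0.le, div_mul_eq_mul_div, mul_div_assoc, ← Real.rpow_sub he0]
    congr 2; ring
  have e4 : (e:ℝ) ^ (-(1/2):ℝ) ≤ 1 := Real.rpow_le_one_of_one_le_of_nonpos he1' (by norm_num)
  have e3 : b e * (e:ℝ) ^ (-β) * Z - L * ((x:ℝ) ^ (1 - β) / (1 - β)) * (b e * (e:ℝ) ^ (-1:ℝ)) =
      b e * ((e:ℝ) ^ (-β) * (Z - L * (((x:ℝ) / e) ^ (1 - β) / (1 - β)))) := by
    have : L * ((x:ℝ) ^ (1 - β) / (1 - β)) * (b e * (e:ℝ) ^ (-1:ℝ)) =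
      b e * L * (((x:ℝ) / e) ^ (1 - β) * (e:ℝ) ^ (-β)) / (1 - β) := by rw [e1]; ring
    rw [this]; ring
  rw [e3, abs_mul, abs_mul, abs_of_nonneg (by positivity : (0:ℝ) ≤ (e:ℝ) ^ (-β))]
  calc _ ≤ (E:ℝ) * ((e:ℝ) ^ (-β) * (K * ((x:ℝ) / e) ^ (1/2 - β))) := by
        gcongr
        exact (hb e).trans (by exact_mod_cast he2)
    _ = (E:ℝ) * (K * (((x:ℝ) / e) ^ (1/2 - β) * (e:ℝ) ^ (-β))) := by ring
    _ = (E:ℝ) * (K * ((x:ℝ) ^ (1/2 - β) * (e:ℝ) ^ (-(1/2):ℝ))) := by rw [e2]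
    _ ≤ (E:ℝ) * (K * ((x:ℝ) ^ (1/2 - β) * 1)) := by gcongr
    _ = _ := by ring

theorem lemC {χ1 : ℕ → ℝ} {q1 : ℝ} (h1 : RC χ1 q1) (β : ℝ) (hβ : 63/64 ≤ β) (hβ1 : β < 1)
    (h0 : LS χ1 β = 0) : ∃ C : ℝ, 1 ≤ C ∧ ∀ (χ2 : ℕ → ℝ) (q2 q12 : ℝ), RC χ2 q2 →
      RC (fun n => χ2 n * χ1 n) q12 → ∀ E : ℕ, 0 < E →
      1 ≤ C * (E:ℝ) ^ (8 * (1 - β)) * (LS χ2 1 * LS (fun n => χ2 n * χ1 n) 1) +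
        C * (q2 * q12) * (E:ℝ) ^ (-(1/8):ℝ) := by
  obtain ⟨K, hK1, hr⟩ := r_real h1 β (by linarith) hβ1 h0
  have hp : 0 < 1 - β := by linarith
  have hL := L1_pos h1
  set L := LS χ1 1 with hLdef
  set r := cv χ1 (fun _ => 1) with hrdef
  have hc1 : 0 < L / (1 - β) := by positivity
  refine ⟨K + 18 * (L / (1 - β)) + 15 * (L / (1 - β) + K), by linarith, ?_⟩
  set C := K + 18 * (L / (1 - β)) + 15 * (L / (1 - β) + K) with hC
  intro χ2 q2 q12 h2 h12 E hE
  set χ12 : ℕ → ℝ := fun n => χ2 n * χ1 n with hχ12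
  set b := cv χ2 χ12 with hbdef
  have hE1 : (1:ℝ) ≤ E := by exact_mod_cast hE
  have hE0 : (0:ℝ) < E := by linarith
  have hbabs : ∀ n, |b n| ≤ n := cv_abs_le _ _ h2.abs h12.abs
  set x := E ^ 8 with hx
  have hEx : E ≤ x := Nat.le_self_pow (by norm_num) E
  have hxr : ∀ c : ℝ, (x:ℝ) ^ c = (E:ℝ) ^ (8 * c) := by
    intro c
    rw [hx]; push_cast
    rw [← Real.rpow_natCast, ← Real.rpow_mul hE0.le]; norm_num
  have hq2 := h2.q1
  have hq12 := h12.q1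
  have hQ1 : 1 ≤ q2 * q12 := by nlinarith
  set Q := q2 * q12 with hQ
  -- lower bound
  have low : 1 ≤ PS (cv b r) β x := by
    unfold PS
    have : (1:ℝ) = cv b r 1 * ((1:ℕ):ℝ) ^ (-β) := by
      simp [hbdef, hrdef, hχ12, cv, h1.one, h2.one]
    refine this.le.trans ?_
    apply Finset.single_le_sum (f := fun n : ℕ => cv b r n * (n:ℝ) ^ (-β))
    · intro i _
      exact mul_nonneg (a_nonneg h1 h2 i) (by positivity)
    · simp; omega
  have e1 : PS (cv b r) β x =
    ∑ n ∈ Icc 1 x, cv (fun n => b n * (n:ℝ) ^ (-β)) (fun n => r n * (n:ℝ) ^ (-β)) n := by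
    unfold PS
    exact Finset.sum_congr rfl fun n _ => (cv_wt b r β n).symm
  rw [e1, hyperbola _ _ x E] at low
  have A := lemC_first b r β L K hbabs (by linarith) hr x E hEx
  unfold PS at A
  set S1 := ∑ e ∈ Icc 1 E, b e * (e:ℝ) ^ (-β) * ∑ n ∈ Icc 1 (x / e), r n * (n:ℝ) ^ (-β)
  have hB1 := lemB1 χ2 χ12 q2 q12 h2.abs h12.abs h2.sum h12.sum hq2 hq12
  have hB2 := lemB2 χ2 χ12 q2 q12 h2.abs h12.abs h2.sum h12.sum hq2 hq12 E hE
  unfold PS at hB2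
  rw [← hbdef, ← hQ] at hB2
  set T := ∑ n ∈ Icc 1 E, b n * (n:ℝ) ^ (-1:ℝ)
  -- second part
  have hR : ∑ n ∈ Icc 1 (x / (E + 1)), r n * (n:ℝ) ^ (-β) ≤ (L / (1 - β) + K) * (x:ℝ) ^ (1 - β) := by
    have hx1 : (1:ℝ) ≤ x := by rw [hx]; push_cast; exact one_le_pow₀ hE1
    have hx0 : (0:ℝ) < x := by linarith
    have hmono : ∑ n ∈ Icc 1 (x / (E + 1)), r n * (n:ℝ) ^ (-β) ≤ ∑ n ∈ Icc 1 x, r n * (n:ℝ) ^ (-β) := by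
      apply Finset.sum_le_sum_of_subset_of_nonneg
      · exact Finset.Icc_subset_Icc_right (Nat.div_le_self _ _)
      · intro i _ _
        exact mul_nonneg (r_nonneg h1 i) (by positivity)
    have t := hr x x (by omega) le_rfl (by linarith)
    unfold PS at t
    have t2 := (abs_le.1 t).2
    have t3 : (x:ℝ) ^ (1/2 - β) ≤ (x:ℝ) ^ (1 - β) := Real.rpow_le_rpow_of_exponent_le hx1 (by linarith)
    have t4 : K * (x:ℝ) ^ (1/2 - β) ≤ K * (x:ℝ) ^ (1 - β) := by gcongr
    have t5 : L * ((x:ℝ) ^ (1 - β) / (1 - β)) = L / (1 - β) * (x:ℝ) ^ (1 - β) := by ring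
    rw [t5] at t2
    rw [add_mul]
    linarith
  have hT : ∀ y, |∑ n ∈ Ioc E y, b n * (n:ℝ) ^ (-β)| ≤ 15 * Q * (E:ℝ) ^ (1/2 - β) := by
    intro y
    refine (abel b (3 * Q) (1/2) β (by norm_num) (by linarith) (fun y _ => hB1 y) E y).trans ?_
    have : β / (β - 1/2) ≤ 3 := by
      rw [div_le_iff₀ (by linarith)]; linarith
    have e : (1/2 - β) = -(β - 1/2) := by ring
    calc _ ≤ 3 * Q * (2 + 3) * (E:ℝ) ^ (1/2 - β) := by
          have hmono : ((E + 1 : ℕ):ℝ) ^ (1/2 - β) ≤ (E:ℝ) ^ (1/2 - β) := by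
            rw [e]
            exact rpow_neg_anti _ (by linarith) _ _ hE0 (by push_cast; linarith)
          gcongr
      _ = _ := by ring
  have B : |∑ k ∈ Icc 1 (x / (E + 1)), r k * (k:ℝ) ^ (-β) * ∑ e ∈ Ioc E (x / k), b e * (e:ℝ) ^ (-β)|
      ≤ (L / (1 - β) + K) * (x:ℝ) ^ (1 - β) * (15 * Q * (E:ℝ) ^ (1/2 - β)) := by
    calc _ ≤ ∑ k ∈ Icc 1 (x / (E + 1)), r k * (k:ℝ) ^ (-β) * (15 * Q * (E:ℝ) ^ (1/2 - β)) := by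
          refine (Finset.abs_sum_le_sum_abs _ _).trans (Finset.sum_le_sum fun k hk => ?_)
          have h3 : 0 ≤ r k * (k:ℝ) ^ (-β) := mul_nonneg (r_nonneg h1 k) (by positivity)
          rw [abs_mul, abs_of_nonneg h3]
          exact mul_le_mul_of_nonneg_left (hT _) h3
      _ = (∑ k ∈ Icc 1 (x / (E + 1)), r k * (k:ℝ) ^ (-β)) * (15 * Q * (E:ℝ) ^ (1/2 - β)) := by
          rw [Finset.sum_mul]
      _ ≤ _ := by gcongr
  set S2 := ∑ k ∈ Icc 1 (x / (E + 1)), r k * (k:ℝ) ^ (-β) * ∑ e ∈ Ioc E (x / k), b e * (e:ℝ) ^ (-β)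
  set X := (E:ℝ) ^ (8 * (1 - β)) with hX
  set W := (E:ℝ) ^ (-(1/8):ℝ) with hW
  have hXp : 0 < X := by positivity
  have hWp : 0 < W := by positivity
  rw [hxr] at A B
  rw [← hX] at B
  have b1 : (E:ℝ) * (E * (K * (x:ℝ) ^ (1/2 - β))) ≤ K * W := by
    rw [hxr]
    calc (E:ℝ) * (E * (K * (E:ℝ) ^ (8 * (1/2 - β)))) =
        K * ((E:ℝ) ^ (1:ℝ) * (E:ℝ) ^ (1:ℝ) * (E:ℝ) ^ (8 * (1/2 - β))) := by
          rw [Real.rpow_one]; ring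
      _ = K * (E:ℝ) ^ (1 + 1 + 8 * (1/2 - β)) := by
          rw [← Real.rpow_add hE0, ← Real.rpow_add hE0]
      _ ≤ K * W := by
          gcongr
          rw [hW]
          exact Real.rpow_le_rpow_of_exponent_le hE1 (by linarith)
  have b2 : X * (E:ℝ) ^ (1/2 - β) ≤ W := by
    rw [hX, hW, ← Real.rpow_add hE0]
    exact Real.rpow_le_rpow_of_exponent_le hE1 (by linarith)
  have b3 : X * (E:ℝ) ^ (-(1/4):ℝ) ≤ W := by
    rw [hX, hW, ← Real.rpow_add hE0]
    exact Real.rpow_le_rpow_of_exponent_le hE1 (by linarith)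
  have hLL : 0 < LS χ2 1 * LS χ12 1 := mul_pos (L1_pos h2) (L1_pos h12)
  set LL := LS χ2 1 * LS χ12 1 with hLLd
  have A2 := (abs_le.1 A).2
  rw [← hX] at A2
  have B' := (abs_le.1 B).2
  have D := (abs_le.1 hB2).2
  have D1 : L * (X / (1 - β)) * T ≤ L / (1 - β) * X * LL + 18 * (L / (1 - β)) * (Q * W) := by
    calc L * (X / (1 - β)) * T = L / (1 - β) * X * T := by ring
      _ ≤ L / (1 - β) * X * (LL + 18 * Q * (E:ℝ) ^ (-(1/4):ℝ)) := by
          gcongr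
          linarith
      _ = L / (1 - β) * X * LL + 18 * (L / (1 - β)) * (Q * (X * (E:ℝ) ^ (-(1/4):ℝ))) := by ring
      _ ≤ _ := by gcongr
  have D2 : (L / (1 - β) + K) * X * (15 * Q * (E:ℝ) ^ (1/2 - β)) ≤ 15 * (L / (1 - β) + K) * (Q * W) := by
    calc _ = 15 * (L / (1 - β) + K) * (Q * (X * (E:ℝ) ^ (1/2 - β))) := by ring
      _ ≤ _ := by gcongr
  have D3 : K * W ≤ K * (Q * W) := by
    have : W ≤ Q * W := le_mul_of_one_le_left hWp.le hQ1
    gcongr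
  have D4 : L / (1 - β) * X * LL ≤ C * X * LL := by
    gcongr
    rw [hC]; linarith
  have D5 : C * Q * W = K * (Q * W) + 18 * (L / (1 - β)) * (Q * W) + 15 * (L / (1 - β) + K) * (Q * W) := by
    rw [hC]; ring
  rw [D5]
  linarith

end HB
end

section
open Finset Filter Topology
namespace HB

theorem ev_small (K a c : ℝ) (ha : 0 < a) (hc : 0 < c) :
    ∀ᶠ m : ℕ in atTop, K * (m:ℝ) ^ (-a) ≤ c := by
  have h1 := (tendsto_rpow_neg_atTop ha).comp (tendsto_natCast_atTop_atTop (R := ℝ))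
  have h2 := h1.const_mul K
  rw [mul_zero] at h2
  filter_upwards [h2.eventually (gt_mem_nhds hc)] with m hm
  exact hm.le

theorem L1_le {χ : ℕ → ℝ} (q : ℕ) (hq : 0 < q) (h : RC χ q) : LS χ 1 ≤ 4 + Real.log q := by
  have h1 := (abs_le.1 (LS_tail0 χ q 1 one_pos h.sum q)).2
  have h2 : PS χ 1 q ≤ 1 + Real.log q := by
    refine le_trans ?_ (sum_inv_le q)
    unfold PS
    apply Finset.sum_le_sum
    intro n hn
    rw [Real.rpow_neg_one, one_div]
    exact mul_le_of_le_one_left (by positivity) ((le_abs_self _).trans (h.abs n))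
  have h3 : 3 * (q:ℝ) * ((q + 1 : ℕ):ℝ) ^ (-1:ℝ) ≤ 3 := by
    rw [Real.rpow_neg_one, ← div_eq_mul_inv, div_le_iff₀ (by positivity)]
    push_cast; linarith
  linarith

theorem zero_of_small (χ : ℕ → ℕ → ℝ) (S : Set ℕ) (h1 : ∀ m ∈ S, RC (χ m) (8 * m)) (δ η : ℝ)
    (hη : 0 < η) (hη1 : η ≤ 1/64) (hηδ : 8 * η ≤ δ) :
    ∀ᶠ m : ℕ in atTop, m ∈ S → LS (χ m) 1 < (m:ℝ) ^ (-δ) →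
      ∃ β, 1 - η ≤ β ∧ β < 1 ∧ LS (χ m) β = 0 := by
  filter_upwards [ev_small (1 / η) (4 * η) (1/4) (by linarith) (by norm_num),
    ev_small ((4 + 9 / η) * 8) (1/2) (1/4) (by norm_num) (by norm_num),
    eventually_gt_atTop 0] with m e1 e2 hm hmS hL
  have h := h1 m hmS
  have hm0 : (0:ℝ) < m := by exact_mod_cast hm
  have hm1 : (1:ℝ) ≤ m := by exact_mod_cast hm
  obtain ⟨z, hz1, hz2, hz⟩ := lemA (χ m) h.abs _ h.q1 h.sum (1 - η) (by linarith) (by linarith)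
  have hA := hz (m ^ 4) (by positivity)
  have hlow := PS_r_ge_one h (1 - η) (m ^ 4) (by positivity)
  have hx : ∀ c : ℝ, ((m ^ 4 : ℕ):ℝ) ^ c = (m:ℝ) ^ (4 * c) := by
    intro c
    push_cast
    rw [← Real.rpow_natCast, ← Real.rpow_mul hm0.le]; norm_num
  rw [hx, hx] at hA
  have es : (1 - (1 - η)) = η := by ring
  rw [es] at hA hz1
  have A2 := (abs_le.1 hA).2
  have b1 : LS (χ m) 1 * ((m:ℝ) ^ (4 * η) / η) ≤ 1/4 := by
    calc _ ≤ (m:ℝ) ^ (-δ) * ((m:ℝ) ^ (4 * η) / η) := by gcongr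
      _ = 1 / η * ((m:ℝ) ^ (-δ) * (m:ℝ) ^ (4 * η)) := by ring
      _ = 1 / η * (m:ℝ) ^ (-δ + 4 * η) := by rw [← Real.rpow_add hm0]
      _ ≤ 1 / η * (m:ℝ) ^ (-(4 * η)) := by
          gcongr
          linarith
      _ ≤ 1/4 := e1
  have b2 : (4 + 9 / η) * (8 * m) * (m:ℝ) ^ (4 * (1/2 - (1 - η))) ≤ 1/4 := by
    calc _ = (4 + 9 / η) * 8 * ((m:ℝ) ^ (1:ℝ) * (m:ℝ) ^ (4 * (1/2 - (1 - η)))) := by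
          rw [Real.rpow_one]; ring
      _ = (4 + 9 / η) * 8 * (m:ℝ) ^ (1 + 4 * (1/2 - (1 - η))) := by rw [← Real.rpow_add hm0]
      _ ≤ (4 + 9 / η) * 8 * (m:ℝ) ^ (-(1/2):ℝ) := by
          gcongr
          linarith
      _ ≤ 1/4 := e2
  have hzL : 1/2 ≤ z * LS (χ m) (1 - η) := by linarith
  have hzneg : z < 0 := lt_of_le_of_lt hz1 (div_neg_of_neg_of_pos (by linarith) hη)
  have hneg : LS (χ m) (1 - η) ≤ 0 := by
    by_contra hc
    have := mul_neg_of_neg_of_pos hzneg (not_le.1 hc)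
    linarith
  have hcont : ContinuousOn (LS (χ m)) (Set.Icc (1 - η) 1) :=
    (LS_cont (χ m) _ (1 - η) (by linarith) h.sum).mono Set.Icc_subset_Ici_self
  have hpos := L1_pos h
  obtain ⟨β, hβ, hβ0⟩ := intermediate_value_Icc (by linarith : 1 - η ≤ 1) hcont
    (show (0:ℝ) ∈ Set.Icc (LS (χ m) (1 - η)) (LS (χ m) 1) from ⟨hneg, hpos.le⟩)
  refine ⟨β, hβ.1, lt_of_le_of_ne hβ.2 ?_, hβ0⟩
  rintro rfl
  linarith

theorem siegel (S : Set ℕ) (χ : ℕ → ℕ → ℝ) (h1 : ∀ m ∈ S, RC (χ m) (8 * m))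
    (h2 : ∀ m ∈ S, ∀ m' ∈ S, m ≠ m' → RC (fun n => χ m n * χ m' n) (8 * m * m' : ℕ))
    (δ : ℝ) (hδ : 0 < δ) : ∀ᶠ m : ℕ in atTop, m ∈ S → (m:ℝ) ^ (-δ) ≤ LS (χ m) 1 := by
  set η := min (1/64) (δ / 544) with hη
  have hη0 : 0 < η := by rw [hη]; positivity
  have hη1 : η ≤ 1/64 := min_le_left _ _
  have hη2 : η ≤ δ / 544 := min_le_right _ _
  obtain ⟨M1, hM1⟩ := eventually_atTop.1 (zero_of_small χ S h1 δ η hη0 hη1 (by linarith))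
  by_cases hex : ∃ m ∈ S, max M1 1 ≤ m ∧ LS (χ m) 1 < (m:ℝ) ^ (-δ)
  swap
  · filter_upwards [eventually_ge_atTop (max M1 1)] with m hm hmS
    by_contra hc
    exact hex ⟨m, hmS, hm, not_le.1 hc⟩
  obtain ⟨m1, hm1S, hm1, hm1L⟩ := hex
  have hm1pos : 0 < m1 := by have := le_max_right M1 1; omega
  obtain ⟨β, hβ1, hβ2, hβ0⟩ := hM1 m1 ((le_max_left _ _).trans hm1) hm1S hm1L
  obtain ⟨C, hC1, hC⟩ := lemC (h1 m1 hm1S) β (by linarith) hβ2 hβ0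
  set a := δ / 4 with ha
  have ha0 : 0 < a := by positivity
  set C' := 4 + (8 * m1 : ℝ) ^ a / a with hC'
  have hm1r : (0:ℝ) < m1 := by exact_mod_cast hm1pos
  have hC'0 : 0 < C' := by positivity
  filter_upwards [ev_small (C * 64 * m1) (1/8) (1/2) (by norm_num) (by norm_num),
    ev_small (2 * C * C') (2 * a) 1 (by linarith) one_pos,
    eventually_gt_atTop m1] with m e1 e2 hm hmS
  have hm0 : (0:ℝ) < m := by exact_mod_cast (show 0 < m by omega)
  have hm1' : (1:ℝ) ≤ m := by exact_mod_cast (show 1 ≤ m by omega)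
  have hmn : 0 < m := by omega
  have hRC2 := h1 m hmS
  have hRC12 := h2 m hmS m1 hm1S (by omega)
  have key := hC (χ m) _ _ hRC2 hRC12 (m ^ 17) (by positivity)
  have hx : ∀ c : ℝ, ((m ^ 17 : ℕ):ℝ) ^ c = (m:ℝ) ^ (17 * c) := by
    intro c
    push_cast
    rw [← Real.rpow_natCast, ← Real.rpow_mul hm0.le]; norm_num
  rw [hx, hx] at key
  have hL2 := L1_pos hRC2
  have hL12 := L1_le (8 * m * m1) (by positivity) hRC12
  set L2 := LS (χ m) 1
  set L12 := LS (fun n => χ m n * χ m1 n) 1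
  have c1 : C * ((8 * (m:ℝ)) * ((8 * m * m1 : ℕ):ℝ)) * (m:ℝ) ^ (17 * (-(1/8):ℝ)) ≤ 1/2 := by
    refine le_trans (le_of_eq ?_) e1
    push_cast
    have : (m:ℝ) ^ (-(1/8):ℝ) = (m:ℝ) ^ (2:ℝ) * (m:ℝ) ^ (17 * (-(1/8):ℝ)) := by
      rw [← Real.rpow_add hm0]; norm_num
    rw [this]
    have : (m:ℝ) ^ (2:ℝ) = (m:ℝ) ^ (2:ℕ) := by rw [← Real.rpow_natCast]; norm_num
    rw [this]; ring
  have c2 : L12 ≤ C' * (m:ℝ) ^ a := by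
    have l1 : Real.log ((8 * m * m1 : ℕ):ℝ) ≤ ((8 * m * m1 : ℕ):ℝ) ^ a / a :=
      Real.log_le_rpow_div (by positivity) ha0
    have l2 : ((8 * m * m1 : ℕ):ℝ) ^ a = (8 * m1 : ℝ) ^ a * (m:ℝ) ^ a := by
      rw [← Real.mul_rpow (by positivity) (by positivity)]
      push_cast; congr 1; ring
    rw [l2] at l1
    have l3 : 1 ≤ (m:ℝ) ^ a := Real.one_le_rpow hm1' ha0.le
    rw [hC', add_mul]
    have : (8 * m1 : ℝ) ^ a / a * (m:ℝ) ^ a = (8 * m1 : ℝ) ^ a * (m:ℝ) ^ a / a := by ring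
    linarith
  have c3 : (m:ℝ) ^ (17 * (8 * (1 - β))) ≤ (m:ℝ) ^ a :=
    Real.rpow_le_rpow_of_exponent_le hm1' (by linarith)
  have c4 : C * (m:ℝ) ^ (17 * (8 * (1 - β))) * (L2 * L12) ≤ C * (m:ℝ) ^ a * (L2 * (C' * (m:ℝ) ^ a)) := by
    have hL12p : 0 < L12 := L1_pos hRC12
    gcongr
  have c5 : C * (m:ℝ) ^ a * (L2 * (C' * (m:ℝ) ^ a)) = C * C' * (m:ℝ) ^ (2 * a) * L2 := by
    rw [two_mul, Real.rpow_add hm0]; ring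
  have c6 : 1/2 ≤ C * C' * (m:ℝ) ^ (2 * a) * L2 := by linarith
  have c7 : (m:ℝ) ^ (2 * a) * (m:ℝ) ^ (-(2 * a)) = 1 := by
    rw [← Real.rpow_add hm0]; simp
  have c8 : (m:ℝ) ^ (-δ) = (m:ℝ) ^ (-(2 * a)) * (m:ℝ) ^ (-(2 * a)) := by
    rw [← Real.rpow_add hm0]; congr 1; rw [ha]; ring
  rw [c8]
  set u := (m:ℝ) ^ (-(2 * a))
  have hu : 0 < u := by positivity
  calc u * u ≤ u * u * (2 * (C * C' * (m:ℝ) ^ (2 * a) * L2)) :=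
        le_mul_of_one_le_right (by positivity) (by linarith)
    _ = (2 * C * C' * u) * L2 * ((m:ℝ) ^ (2 * a) * u) := by ring
    _ = (2 * C * C' * u) * L2 := by rw [c7, mul_one]
    _ ≤ 1 * L2 := by gcongr
    _ = L2 := one_mul _

end HB
end

section
open Finset Filter Topology
namespace HB

theorem jac_sq_left (b e : ℕ) (h : b.Coprime e) : jacobiSym ((b:ℤ) ^ 2) e = 1 := by
  rw [jacobiSym.pow_left, jacobiSym.sq_one]
  simpa [Int.gcd_natCast_natCast] using h

/-- odd prime case -/
theorem exists_neg_prime (σ : ℤ) (hσ : σ = 1 ∨ σ = -1) (b p a : ℕ) (hb : b ≠ 0) (ha : a ≠ 0)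
    (hp : p.Prime) (hp2 : p ≠ 2) (hpa : ¬ p ∣ a) :
    ∃ e : ℕ, Odd e ∧ jacobiSym (σ * ((b:ℤ) ^ 2 * (p * a))) e = -1 := by
  have : Fact p.Prime := ⟨hp⟩
  obtain ⟨r, hr⟩ := FiniteField.exists_nonsquare (F := ZMod p) (by rwa [ZMod.ringChar_zmod_n])
  obtain ⟨i, b', hb', hbb⟩ := Nat.exists_eq_pow_mul_and_not_dvd hb p hp.one_lt.ne'
  have hb'0 : b' ≠ 0 := by rintro rfl; simp at hb'
  have hpodd : Odd p := hp.odd_of_ne_two hp2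
  have hcop : Nat.Coprime (8 * a * b') p := by
    rw [Nat.coprime_comm, hp.coprime_iff_not_dvd]
    intro h
    rcases (hp.dvd_mul).1 h with h | h
    · rcases (hp.dvd_mul).1 h with h | h
      · have : p ∣ 2 := hp.dvd_of_dvd_pow (show p ∣ 2 ^ 3 by simpa using h)
        exact hp2 ((Nat.prime_dvd_prime_iff_eq hp Nat.prime_two).1 this)
      · exact hpa h
    · exact hb' h
  obtain ⟨e, he1, he2⟩ := Nat.chineseRemainder hcop 1 r.val
  have he4 : e % 4 = 1 := by
    have : e ≡ 1 [MOD 4] := he1.of_dvd ⟨2 * a * b', by ring⟩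
    simpa [Nat.ModEq] using this
  have heodd : Odd e := by rw [Nat.odd_iff]; omega
  have hJp : jacobiSym (p:ℤ) e = -1 := by
    rw [jacobiSym.quadratic_reciprocity_one_mod_four' hpodd he4, ← jacobiSym.legendreSym.to_jacobiSym,
      legendreSym.eq_neg_one_iff]
    have : ((e:ℤ) : ZMod p) = r := by
      have h3 := (ZMod.natCast_eq_natCast_iff e r.val p).2 he2
      rw [ZMod.natCast_zmod_val] at h3
      simpa using h3
    rwa [this]
  have hpe : p.Coprime e := by
    rw [Nat.coprime_iff_gcd_eq_one]
    by_contra hc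
    have : NeZero e := ⟨by rintro rfl; simp at heodd⟩
    have := (jacobiSym.eq_zero_iff_not_coprime (a := (p:ℤ)) (b := e)).2
      (by simpa [Int.gcd_natCast_natCast] using hc)
    rw [this] at hJp
    norm_num at hJp
  have hb'e : b'.Coprime e := by
    have : e ≡ 1 [MOD b'] := he1.of_dvd ⟨8 * a, by ring⟩
    have := this.gcd_eq
    rw [Nat.gcd_one_left, Nat.gcd_comm] at this
    exact this
  have hbe : b.Coprime e := by
    rw [hbb]; exact Nat.Coprime.mul_left (hpe.pow_left i) hb'e
  have hJa : jacobiSym (a:ℤ) e = 1 := by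
    have h1 : e ≡ 1 [MOD (4 * (a:ℤ).natAbs)] := he1.of_dvd ⟨2 * b', by simp; ring⟩
    rw [jacobiSym.mod_right _ heodd, h1, ← jacobiSym.mod_right _ odd_one, jacobiSym.one_right]
  have hJσ : jacobiSym σ e = 1 := by
    rcases hσ with rfl | rfl
    · exact jacobiSym.one_left e
    · rw [jacobiSym.at_neg_one heodd, ZMod.χ₄_nat_one_mod_four he4]
  refine ⟨e, heodd, ?_⟩
  rw [jacobiSym.mul_left, jacobiSym.mul_left, jacobiSym.mul_left, hJσ, hJa, hJp, jac_sq_left b e hbe]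
  norm_num

theorem exists_neg (D : ℤ) (hD : ¬ IsSquare D) : ∃ e : ℕ, Odd e ∧ jacobiSym D e = -1 := by
  have hD0 : D ≠ 0 := by rintro rfl; exact hD ⟨0, by simp⟩
  obtain ⟨a, b, hab, hsq⟩ := Nat.sq_mul_squarefree D.natAbs
  have hb : b ≠ 0 := by
    rintro rfl; simp at hab; exact hD0 (Int.natAbs_eq_zero.1 hab.symm)
  obtain ⟨σ, hσ, hDσ⟩ : ∃ σ : ℤ, (σ = 1 ∨ σ = -1) ∧ D = σ * ((b:ℤ) ^ 2 * a) := by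
    have : ((D.natAbs : ℕ):ℤ) = (b:ℤ) ^ 2 * a := by rw [← hab]; push_cast; ring
    rcases Int.natAbs_eq D with h | h
    · exact ⟨1, Or.inl rfl, by rw [one_mul, ← this, ← h]⟩
    · exact ⟨-1, Or.inr rfl, by rw [← this, neg_one_mul, ← h]⟩
  by_cases hex : ∃ p : ℕ, p.Prime ∧ p ≠ 2 ∧ p ∣ a
  · obtain ⟨p, hp, hp2, a', rfl⟩ := hex
    have hpa : ¬ p ∣ a' := by
      intro h
      have : p * p ∣ p * a' := mul_dvd_mul_left p h
      exact hp.one_lt.ne' (Nat.isUnit_iff.1 (hsq p this))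
    have ha' : a' ≠ 0 := by rintro rfl; simp at hpa
    obtain ⟨e, h1, h2⟩ := exists_neg_prime σ hσ b p a' hb ha' hp hp2 hpa
    exact ⟨e, h1, by rw [hDσ]; push_cast; exact h2⟩
  have ha12 : a = 1 ∨ a = 2 := by
    by_cases ha1 : a = 1
    · exact Or.inl ha1
    obtain ⟨p, hp, c, rfl⟩ := Nat.exists_prime_and_dvd ha1
    have hp2 : p = 2 := by
      by_contra h; exact hex ⟨p, hp, h, dvd_mul_right _ _⟩
    subst hp2
    right
    by_cases hc1 : c = 1
    · rw [hc1]
    obtain ⟨r, hr, c', rfl⟩ := Nat.exists_prime_and_dvd hc1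
    have hr2 : r = 2 := by
      by_contra h; exact hex ⟨r, hr, h, ⟨2 * c', by ring⟩⟩
    subst hr2
    have := hsq 2 ⟨c', by ring⟩
    simp at this
  obtain ⟨i, k, hk, hbk⟩ := Nat.exists_eq_pow_mul_and_not_dvd hb 2 (by norm_num)
  have hk0 : 0 < k := Nat.pos_of_ne_zero (by rintro rfl; simp at hk)
  rcases hσ with rfl | rfl
  · have ha2 : a = 2 := by
      rcases ha12 with rfl | rfl
      · exact absurd ⟨(b:ℤ), by rw [hDσ]; push_cast; ring⟩ hD
      · rfl
    subst ha2
    have h8 : (4 * k ^ 2 + 1) % 8 = 5 := by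
      have : k % 2 = 1 := by omega
      obtain ⟨j, rfl⟩ : ∃ j, k = 2 * j + 1 := ⟨k / 2, by omega⟩
      ring_nf; omega
    have hodd : Odd (4 * k ^ 2 + 1) := by rw [Nat.odd_iff]; omega
    refine ⟨4 * k ^ 2 + 1, hodd, ?_⟩
    have hc : b.Coprime (4 * k ^ 2 + 1) := by
      rw [hbk]
      apply Nat.Coprime.mul_left
      · exact (Nat.coprime_two_left.2 hodd).pow_left i
      · rw [Nat.coprime_comm]
        have : 4 * k ^ 2 + 1 = 1 + (4 * k) * k := by ring
        rw [this, Nat.coprime_add_mul_right_left]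
        simp
    rw [hDσ, one_mul, jacobiSym.mul_left, jac_sq_left _ _ hc, one_mul]
    push_cast
    rw [jacobiSym.at_two hodd, ZMod.χ₈_nat_eq_if_mod_eight]
    rw [if_neg (by omega), if_neg (by omega)]
  · have hb1 : 1 ≤ b ^ 2 := Nat.one_le_pow _ _ (by omega)
    set e := 8 * b ^ 2 - 1 with he
    have he1 : e + 1 = 8 * b ^ 2 := by omega
    have hodd : Odd e := by rw [Nat.odd_iff]; omega
    refine ⟨e, hodd, ?_⟩
    have hc : b.Coprime e := by
      have h2 : Nat.Coprime (e + 1) e := by simp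
      rw [he1] at h2
      exact Nat.Coprime.coprime_dvd_left ⟨8 * b, by ring⟩ h2
    have hJa : jacobiSym (a:ℤ) e = 1 := by
      rcases ha12 with rfl | rfl
      · push_cast; exact jacobiSym.one_left e
      · push_cast
        rw [jacobiSym.at_two hodd, ZMod.χ₈_nat_eq_if_mod_eight]
        rw [if_neg (by omega), if_pos (by omega)]
    rw [hDσ, jacobiSym.mul_left, jacobiSym.mul_left, jac_sq_left _ _ hc, hJa,
      jacobiSym.at_neg_one hodd, ZMod.χ₄_nat_three_mod_four (by omega)]
    norm_num

/-- the real character `n ↦ (D/n)` on odd `n` -/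
noncomputable def kr (D : ℤ) (n : ℕ) : ℝ := if Odd n then (jacobiSym D n : ℝ) else 0

theorem kr_mul (D : ℤ) (a b : ℕ) : kr D (a * b) = kr D a * kr D b := by
  unfold kr
  by_cases ha : Odd a
  · by_cases hb : Odd b
    · rw [if_pos (ha.mul hb), if_pos ha, if_pos hb, jacobiSym.mul_right' _ ha.pos.ne' hb.pos.ne']
      push_cast; rfl
    · rw [if_neg (by rw [Nat.odd_mul]; tauto), if_neg hb, mul_zero]
  · rw [if_neg (by rw [Nat.odd_mul]; tauto), if_neg ha, zero_mul]

theorem kr_period (D : ℤ) (n : ℕ) : kr D (n + 4 * D.natAbs) = kr D n := by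
  unfold kr
  have : Odd (n + 4 * D.natAbs) ↔ Odd n := by
    rw [Nat.odd_iff, Nat.odd_iff]; omega
  by_cases h : Odd n
  · rw [if_pos h, if_pos (this.2 h), jacobiSym.mod_right _ (this.2 h), Nat.add_mod_right,
      ← jacobiSym.mod_right _ h]
  · rw [if_neg h, if_neg (fun h' => h (this.1 h'))]

theorem kr_mod (D : ℤ) (n : ℕ) : kr D (n % (4 * D.natAbs)) = kr D n := by
  conv_rhs => rw [← Nat.mod_add_div n (4 * D.natAbs)]
  generalize n % (4 * D.natAbs) = r
  generalize n / (4 * D.natAbs) = t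
  induction t with
  | zero => simp
  | succ t ih => rw [Nat.mul_succ, ← add_assoc, kr_period, ih]

theorem kr_zero_sum (D : ℤ) (hD : ¬ IsSquare D) : ∑ n ∈ range (4 * D.natAbs), kr D n = 0 := by
  have hD0 : D ≠ 0 := by rintro rfl; exact hD ⟨0, by simp⟩
  obtain ⟨e, he, hJ⟩ := exists_neg D hD
  have hke : kr D e = -1 := by unfold kr; rw [if_pos he, hJ]; norm_num
  set q := 4 * D.natAbs with hq
  have hq0 : 0 < q := by have := Int.natAbs_pos.2 hD0; omega
  have hcop : Nat.Coprime q e := by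
    apply Nat.Coprime.mul_left
    · exact (Nat.coprime_two_left.2 he).pow_left 2
    · by_contra hc
      have : NeZero e := ⟨he.pos.ne'⟩
      have := (jacobiSym.eq_zero_iff_not_coprime (a := D) (b := e)).2 (by
        rw [Int.gcd_eq_natAbs]; simpa using hc)
      rw [this] at hJ
      norm_num at hJ
  have hinj : Set.InjOn (fun n => (e * n) % q) (range q : Finset ℕ) := by
    intro a ha b hb hab
    have ha' := mem_range.1 (Finset.mem_coe.1 ha)
    have hb' := mem_range.1 (Finset.mem_coe.1 hb)
    have h1 : e * a ≡ e * b [MOD q] := hab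
    have h2 := Nat.ModEq.cancel_left_of_coprime (by simpa using hcop) h1
    exact Nat.ModEq.eq_of_lt_of_lt h2 ha' hb'
  have himg : (range q).image (fun n => (e * n) % q) = range q := by
    apply Finset.eq_of_subset_of_card_le
    · intro x hx
      obtain ⟨n, _, rfl⟩ := mem_image.1 hx
      exact mem_range.2 (Nat.mod_lt _ hq0)
    · rw [Finset.card_image_of_injOn hinj]
  have : ∑ n ∈ range q, kr D n = - ∑ n ∈ range q, kr D n := by
    conv_lhs => rw [← himg, Finset.sum_image hinj]
    rw [← Finset.sum_neg_distrib]
    apply Finset.sum_congr rfl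
    intro n _
    rw [hq, kr_mod, kr_mul, hke]; ring
  linarith

theorem kr_val (D : ℤ) (n : ℕ) : kr D n = 0 ∨ kr D n = 1 ∨ kr D n = -1 := by
  unfold kr
  split_ifs
  · rcases jacobiSym.trichotomy D n with h | h | h <;> simp [h]
  · simp

theorem kr_abs (D : ℤ) (n : ℕ) : |kr D n| ≤ 1 := by
  rcases kr_val D n with h | h | h <;> simp [h]

theorem kr_RC (D : ℤ) (hD : ¬ IsSquare D) : RC (kr D) ((4 * D.natAbs : ℕ):ℝ) := by
  have hD0 : D ≠ 0 := by rintro rfl; exact hD ⟨0, by simp⟩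
  have hq0 : 0 < 4 * D.natAbs := by have := Int.natAbs_pos.2 hD0; omega
  refine ⟨by simp [kr], kr_mul D, kr_val D, fun y => ?_, by exact_mod_cast hq0⟩
  have e1 : ∑ n ∈ Icc 1 y, kr D n = ∑ n ∈ range y, kr D (1 + n) := by
    rw [Finset.range_eq_Ico, Finset.sum_Ico_add (kr D) 0 y 1]
    congr 1
  rw [e1, sum_reduce (kr D) _ hq0 (kr_period D) (kr_zero_sum D hD)]
  refine (Finset.abs_sum_le_sum_abs _ _).trans ?_
  calc _ ≤ ∑ n ∈ range (y % (4 * D.natAbs)), (1:ℝ) := Finset.sum_le_sum fun n _ => kr_abs D _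
    _ = ((y % (4 * D.natAbs) : ℕ):ℝ) := by simp
    _ ≤ _ := by exact_mod_cast (Nat.mod_lt _ hq0).le

theorem RC.mono {χ : ℕ → ℝ} {q q' : ℝ} (h : RC χ q) (hq : q ≤ q') : RC χ q' :=
  ⟨h.one, h.mul, h.val, fun y => (h.sum y).trans hq, h.q1.trans hq⟩

theorem sf_sq_aux (m m' : ℕ) (h : Squarefree m) (h' : Squarefree m') (hs : IsSquare (m * m')) : m = m' := by
  obtain ⟨r, hr⟩ := hs
  have h1 : m ∣ r := (h.dvd_pow_iff_dvd (two_ne_zero)).1 ⟨m', by rw [hr]; ring⟩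
  obtain ⟨s, rfl⟩ := h1
  have hm0 : 0 < m := Nat.pos_of_ne_zero h.ne_zero
  have h2 : m' = m * (s * s) := by
    apply Nat.eq_of_mul_eq_mul_left hm0
    rw [hr]; ring
  have h3 : IsUnit s := h' s ⟨m, by rw [h2]; ring⟩
  rw [Nat.isUnit_iff] at h3
  rw [h2, h3]; ring

theorem sf_sq (m m' : ℕ) (h : Squarefree m) (h' : Squarefree m') (hs : IsSquare (m * m')) : m = m' :=
  sf_sq_aux m m' h h' hs

theorem siegel_kr (δ : ℝ) (hδ : 0 < δ) :
    ∀ᶠ m : ℕ in atTop, Squarefree m → (m:ℝ) ^ (-δ) ≤ LS (kr (-(m:ℤ))) 1 := by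
  apply siegel {m | Squarefree m} (fun m => kr (-(m:ℤ))) _ _ δ hδ
  · intro m hm
    have hm0 : 0 < m := Nat.pos_of_ne_zero (Squarefree.ne_zero hm)
    refine (kr_RC (-(m:ℤ)) ?_).mono ?_
    · intro h
      have := h.nonneg
      omega
    · push_cast; simp; linarith
  · intro m hm m' hm' hne
    have e : (fun n => kr (-(m:ℤ)) n * kr (-(m':ℤ)) n) = kr ((m * m' : ℕ):ℤ) := by
      funext n
      unfold kr
      split_ifs
      · have : ((m * m' : ℕ):ℤ) = -(m:ℤ) * -(m':ℤ) := by push_cast; ring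
        rw [this, jacobiSym.mul_left]; push_cast; rfl
      · simp
    rw [e]
    refine (kr_RC _ ?_).mono ?_
    · rw [Int.isSquare_natCast_iff]
      exact fun h => hne (sf_sq m m' hm hm' h)
    · rw [Int.natAbs_natCast]
      exact_mod_cast (show 4 * (m * m') ≤ 8 * m * m' by nlinarith [Nat.zero_le (m * m')])

end HB
end

section
open Finset Filter Topology
namespace HB

theorem sum_pow_le (δ : ℝ) (h0 : 0 < δ) (h1 : δ < 1) (x Y : ℕ) :
    ∑ e ∈ Icc 1 Y, ((x / e : ℕ):ℝ) ^ (1 - δ) ≤ (x:ℝ) ^ (1 - δ) * (Y:ℝ) ^ δ / δ := by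
  rcases Nat.eq_zero_or_pos Y with rfl | hY
  · simp; positivity
  obtain ⟨z, -, -, hz, -⟩ := zeta_ex (1 - δ) (by linarith) (by linarith)
  have := hz Y hY
  rw [show (1:ℝ) - (1 - δ) = δ by ring] at this
  calc _ ≤ ∑ e ∈ Icc 1 Y, (x:ℝ) ^ (1 - δ) * (e:ℝ) ^ (-(1 - δ)) := by
        apply Finset.sum_le_sum
        intro e he
        rw [mem_Icc] at he
        have he0 : (0:ℝ) < e := by exact_mod_cast he.1
        rw [Real.rpow_neg he0.le, ← div_eq_mul_inv, ← Real.div_rpow (Nat.cast_nonneg x) he0.le]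
        exact Real.rpow_le_rpow (Nat.cast_nonneg _) Nat.cast_div_le (by linarith)
    _ = (x:ℝ) ^ (1 - δ) * ∑ e ∈ Icc 1 Y, (e:ℝ) ^ (-(1 - δ)) := by rw [Finset.mul_sum]
    _ ≤ (x:ℝ) ^ (1 - δ) * ((Y:ℝ) ^ δ / δ) := by gcongr
    _ = _ := by ring

theorem hyp_first (δ : ℝ) (h0 : 0 < δ) (h1 : δ < 1) (α β : ℕ → ℝ) (B : ℝ) (hB : 0 ≤ B)
    (hα : ∀ n, |α n| ≤ 1) (hβ : ∀ y : ℕ, |∑ n ∈ Icc 1 y, β n| ≤ B * (y:ℝ) ^ (1 - δ)) (x E : ℕ) :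
    |∑ e ∈ Icc 1 E, α e * ∑ f ∈ Icc 1 (x / e), β f| ≤ B / δ * ((x:ℝ) ^ (1 - δ) * (E:ℝ) ^ δ) := by
  refine (Finset.abs_sum_le_sum_abs _ _).trans ?_
  calc _ ≤ ∑ e ∈ Icc 1 E, B * ((x / e : ℕ):ℝ) ^ (1 - δ) := by
        apply Finset.sum_le_sum
        intro e _
        rw [abs_mul]
        calc _ ≤ 1 * |∑ f ∈ Icc 1 (x / e), β f| := by gcongr; exact hα e
          _ ≤ _ := by rw [one_mul]; exact hβ _
    _ = B * ∑ e ∈ Icc 1 E, ((x / e : ℕ):ℝ) ^ (1 - δ) := by rw [Finset.mul_sum]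
    _ ≤ B * ((x:ℝ) ^ (1 - δ) * (E:ℝ) ^ δ / δ) := by gcongr; exact sum_pow_le δ h0 h1 x E
    _ = _ := by ring

theorem hyp_second (δ : ℝ) (h0 : 0 < δ) (h1 : δ < 1) (α β : ℕ → ℝ) (A : ℝ) (hA : 0 ≤ A)
    (hβ : ∀ n, |β n| ≤ 1) (hα : ∀ y : ℕ, |∑ n ∈ Icc 1 y, α n| ≤ A * (y:ℝ) ^ (1 - δ)) (x E : ℕ) :
    |∑ f ∈ Icc 1 (x / (E + 1)), β f * ∑ e ∈ Ioc E (x / f), α e| ≤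
      2 * A / δ * ((x:ℝ) * ((E + 1 : ℕ):ℝ) ^ (-δ)) := by
  refine (Finset.abs_sum_le_sum_abs _ _).trans ?_
  have hE : (0:ℝ) < ((E + 1 : ℕ):ℝ) := by positivity
  calc _ ≤ ∑ f ∈ Icc 1 (x / (E + 1)), (2 * A) * ((x / f : ℕ):ℝ) ^ (1 - δ) := by
        apply Finset.sum_le_sum
        intro f hf
        rw [mem_Icc] at hf
        rw [abs_mul]
        have hle : E ≤ x / f := by
          rw [Nat.le_div_iff_mul_le hf.1]
          have := (Nat.le_div_iff_mul_le (show 0 < E + 1 by omega)).1 hf.2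
          nlinarith
        have hp : (E:ℝ) ^ (1 - δ) ≤ ((x / f : ℕ):ℝ) ^ (1 - δ) :=
          Real.rpow_le_rpow (Nat.cast_nonneg _) (by exact_mod_cast hle) (by linarith)
        have hp' := mul_le_mul_of_nonneg_left hp hA
        calc _ ≤ 1 * |∑ e ∈ Ioc E (x / f), α e| := by gcongr; exact hβ f
          _ = |∑ n ∈ Icc 1 (x / f), α n - ∑ n ∈ Icc 1 E, α n| := by rw [one_mul, sum_Ioc_eq _ _ _ hle]
          _ ≤ |∑ n ∈ Icc 1 (x / f), α n| + |∑ n ∈ Icc 1 E, α n| := abs_sub _ _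
          _ ≤ _ := by linarith [hα (x / f), hα E]
    _ = 2 * A * ∑ f ∈ Icc 1 (x / (E + 1)), ((x / f : ℕ):ℝ) ^ (1 - δ) := by rw [Finset.mul_sum]
    _ ≤ 2 * A * ((x:ℝ) ^ (1 - δ) * ((x / (E + 1) : ℕ):ℝ) ^ δ / δ) := by
        gcongr; exact sum_pow_le δ h0 h1 x _
    _ ≤ 2 * A * ((x:ℝ) ^ (1 - δ) * ((x:ℝ) / ((E + 1 : ℕ):ℝ)) ^ δ / δ) := by
        gcongr; exact Nat.cast_div_le
    _ = 2 * A / δ * (((x:ℝ) ^ (1 - δ) * (x:ℝ) ^ δ) * ((E + 1 : ℕ):ℝ) ^ (-δ)) := by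
        rw [Real.div_rpow (Nat.cast_nonneg x) hE.le, Real.rpow_neg hE.le]; ring
    _ = _ := by
        rcases Nat.eq_zero_or_pos x with rfl | hx
        · rw [Nat.cast_zero, Real.zero_rpow h0.ne']; ring
        · rw [← Real.rpow_add (by exact_mod_cast hx), sub_add_cancel, Real.rpow_one]

theorem hyp_alg (δ X A B : ℝ) (h0 : 0 < δ) (hX : 0 < X) (hA : 0 < A) (hB : 0 < B) :
    ∃ Y : ℝ, 0 < Y ∧ B * (X ^ (1 - δ) * Y ^ δ) = X ^ (1 - δ/2) * (A * B) ^ (1/2:ℝ) ∧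
      A * (X * Y ^ (-δ)) = X ^ (1 - δ/2) * (A * B) ^ (1/2:ℝ) := by
  have hY : 0 < X ^ (1/2:ℝ) * (A / B) ^ (1 / (2 * δ)) := by positivity
  refine ⟨X ^ (1/2:ℝ) * (A / B) ^ (1 / (2 * δ)), hY, ?_, ?_⟩
  · rw [Real.mul_rpow (by positivity) (by positivity), ← Real.rpow_mul hX.le,
      ← Real.rpow_mul (by positivity), show 1 / (2 * δ) * δ = (1/2:ℝ) by field_simp,
      ← mul_assoc (X ^ (1 - δ)), ← Real.rpow_add hX, show 1 - δ + 1/2 * δ = 1 - δ/2 by ring,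
      Real.div_rpow hA.le hB.le, Real.mul_rpow hA.le hB.le]
    have : B = B ^ (1/2:ℝ) * B ^ (1/2:ℝ) := by
      rw [← Real.rpow_add hB]; norm_num
    have hb : 0 < B ^ (1/2:ℝ) := by positivity
    generalize X ^ (1 - δ/2) = u
    generalize A ^ (1/2:ℝ) = v
    generalize B ^ (1/2:ℝ) = w at *
    rw [this]; field_simp
  · rw [Real.mul_rpow (by positivity) (by positivity), ← Real.rpow_mul hX.le,
      ← Real.rpow_mul (by positivity), show 1 / (2 * δ) * (-δ) = -(1/2:ℝ) by field_simp,
      ← mul_assoc X]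
    nth_rewrite 1 [← Real.rpow_one X]
    rw [← Real.rpow_add hX, show 1 + 1/2 * (-δ) = 1 - δ/2 by ring,
      Real.rpow_neg (by positivity),
      Real.div_rpow hA.le hB.le, Real.mul_rpow hA.le hB.le]
    have : A = A ^ (1/2:ℝ) * A ^ (1/2:ℝ) := by
      rw [← Real.rpow_add hA]; norm_num
    have hb : 0 < A ^ (1/2:ℝ) := by positivity
    have hb : 0 < B ^ (1/2:ℝ) := by positivity
    generalize X ^ (1 - δ/2) = u
    generalize A ^ (1/2:ℝ) = v at *
    generalize B ^ (1/2:ℝ) = w at *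
    rw [this]; field_simp

theorem hyp_main (δ : ℝ) (h0 : 0 < δ) (h1 : δ < 1) (α β : ℕ → ℝ) (A B : ℝ) (hA : 0 < A) (hB : 0 < B)
    (hα1 : ∀ n, |α n| ≤ 1) (hβ1 : ∀ n, |β n| ≤ 1)
    (hα : ∀ y : ℕ, |∑ n ∈ Icc 1 y, α n| ≤ A * (y:ℝ) ^ (1 - δ))
    (hβ : ∀ y : ℕ, |∑ n ∈ Icc 1 y, β n| ≤ B * (y:ℝ) ^ (1 - δ)) (x : ℕ) (hx : 0 < x) :
    |∑ n ∈ Icc 1 x, cv α β n| ≤ 3 / δ * ((x:ℝ) ^ (1 - δ/2) * (A * B) ^ (1/2:ℝ)) := by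
  obtain ⟨Y, hY, e1, e2⟩ := hyp_alg δ x A B h0 (by exact_mod_cast hx) hA hB
  rw [hyperbola α β x ⌊Y⌋₊]
  have f1 := hyp_first δ h0 h1 α β B hB.le hα1 hβ x ⌊Y⌋₊
  have f2 := hyp_second δ h0 h1 α β A hA.le hβ1 hα x ⌊Y⌋₊
  have g1 : B / δ * ((x:ℝ) ^ (1 - δ) * (⌊Y⌋₊:ℝ) ^ δ) ≤ 1 / δ * (B * ((x:ℝ) ^ (1 - δ) * Y ^ δ)) := by
    have : (⌊Y⌋₊:ℝ) ^ δ ≤ Y ^ δ :=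
      Real.rpow_le_rpow (Nat.cast_nonneg _) (Nat.floor_le hY.le) h0.le
    calc _ ≤ B / δ * ((x:ℝ) ^ (1 - δ) * Y ^ δ) := by gcongr
      _ = _ := by ring
  have g2 : 2 * A / δ * ((x:ℝ) * ((⌊Y⌋₊ + 1 : ℕ):ℝ) ^ (-δ)) ≤ 2 / δ * (A * (x * Y ^ (-δ))) := by
    have : ((⌊Y⌋₊ + 1 : ℕ):ℝ) ^ (-δ) ≤ Y ^ (-δ) := by
      apply rpow_neg_anti _ h0.le _ _ hY
      push_cast; exact (Nat.lt_floor_add_one Y).le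
    calc _ ≤ 2 * A / δ * ((x:ℝ) * Y ^ (-δ)) := by gcongr
      _ = _ := by ring
  rw [e1] at g1; rw [e2] at g2
  refine (abs_add_le _ _).trans ?_
  calc _ ≤ 1 / δ * ((x:ℝ) ^ (1 - δ/2) * (A * B) ^ (1/2:ℝ)) + 2 / δ * ((x:ℝ) ^ (1 - δ/2) * (A * B) ^ (1/2:ℝ)) :=
        add_le_add (f1.trans g1) (f2.trans g2)
    _ = _ := by ring

end HB
end

section
open Finset Filter Topology
namespace HB

/-- twisted character -/
noncomputable def FF (D : ℤ) (k n : ℕ) : ℝ := kr D n * (jacobiSym (n:ℤ) k : ℝ)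

theorem jac_real_abs (a : ℤ) (k : ℕ) : |(jacobiSym a k : ℝ)| ≤ 1 := by
  exact_mod_cast abs_jacobi_le a k

theorem FF_abs (D : ℤ) (k n : ℕ) : |FF D k n| ≤ 1 := by
  unfold FF
  rw [abs_mul]
  exact mul_le_one₀ (kr_abs D n) (abs_nonneg _) (jac_real_abs _ _)

theorem FF_mul (D : ℤ) (k a b : ℕ) : FF D k (a * b) = FF D k a * FF D k b := by
  unfold FF
  rw [kr_mul]
  push_cast
  rw [jacobiSym.mul_left]
  push_cast; ring

/-- the four small twists -/
def Small (D : ℤ) : Prop := D = 1 ∨ D = -1 ∨ D = 2 ∨ D = -2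

theorem kr_eight (D : ℤ) (hD : Small D) (j r : ℕ) : kr D (8 * j + r) = kr D r := by
  have : ∀ j r : ℕ, kr D (4 * D.natAbs * j + r) = kr D r := by
    intro j r
    rw [← kr_mod D (4 * D.natAbs * j + r), Nat.mul_add_mod, kr_mod]
  rcases hD with rfl | rfl | rfl | rfl
  · rw [← this (2 * j) r]; congr 1; norm_num; ring
  · rw [← this (2 * j) r]; congr 1; norm_num; ring
  · rw [← this j r]; congr 1
  · rw [← this j r]; congr 1

theorem sum_range_eight (f : ℕ → ℝ) (M : ℕ) :
    ∑ n ∈ range (8 * M), f n = ∑ r ∈ range 8, ∑ j ∈ range M, f (8 * j + r) := by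
  induction M with
  | zero => simp
  | succ M ih =>
    rw [show 8 * (M + 1) = 8 * M + 8 by ring, Finset.sum_range_add, ih, ← Finset.sum_add_distrib]
    apply Finset.sum_congr rfl
    intro r _
    rw [Finset.sum_range_succ]

theorem jac_ap (k : ℕ) (hk : Odd k) (r : ℕ) : ∃ h : ℕ, ∀ j : ℕ,
    jacobiSym ((8 * j + r : ℕ):ℤ) k = jacobiSym 8 k * jacobiSym ((h + j : ℕ):ℤ) k := by
  have hc : Nat.Coprime 8 k := (Nat.coprime_two_left.2 hk).pow_left 3
  have hk0 : 0 < k := hk.pos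
  obtain ⟨u, hu⟩ : ∃ u, 8 * u ≡ 1 [MOD k] := by
    obtain ⟨z, hz1, hz2⟩ := Nat.chineseRemainder hc 0 1
    obtain ⟨u, rfl⟩ := (Nat.modEq_zero_iff_dvd).1 hz1
    exact ⟨u, hz2⟩
  refine ⟨u * r, fun j => ?_⟩
  rw [← jacobiSym.mul_left]
  apply jacobiSym.mod_left'
  have : (8 * (u * r + j)) ≡ 8 * j + r [MOD k] := by
    have h2 : 8 * u ≡ 1 [MOD k] := hu
    calc 8 * (u * r + j) = 8 * j + (8 * u) * r := by ring
      _ ≡ 8 * j + 1 * r [MOD k] := Nat.ModEq.add_left _ (h2.mul_right r)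
      _ = _ := by ring
  have := (Int.natCast_modEq_iff.2 this).symm
  push_cast at this ⊢
  exact this

theorem FF_sum : ∃ C : ℝ, 1 ≤ C ∧ ∀ (D : ℤ) (k : ℕ), Small D → Squarefree k → Odd k →
    (1 < k ∨ D ≠ 1) → ∀ y : ℕ,
    |∑ n ∈ Icc 1 y, FF D k n| ≤ C * ((y:ℝ) ^ (999/1000:ℝ) * (k:ℝ) ^ (13/40000:ℝ)) := by
  obtain ⟨C, hC, hb⟩ := burgess
  refine ⟨16 * C, by linarith, fun D k hD hk ho hor y => ?_⟩
  rcases Nat.eq_zero_or_pos y with rfl | hy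
  · simp
  have hy1 : (1:ℝ) ≤ (y:ℝ) ^ (999/1000:ℝ) := Real.one_le_rpow (by exact_mod_cast hy) (by norm_num)
  have hk1 : (1:ℝ) ≤ (k:ℝ) ^ (13/40000:ℝ) := Real.one_le_rpow (by exact_mod_cast ho.pos) (by norm_num)
  have hyk : (1:ℝ) ≤ (y:ℝ) ^ (999/1000:ℝ) * (k:ℝ) ^ (13/40000:ℝ) := one_le_mul_of_one_le_of_one_le hy1 hk1
  rcases Nat.lt_or_ge 1 k with hk2 | hk2
  · have hz : FF D k 0 = 0 := by simp [FF, kr]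
    have e1 : ∑ n ∈ Icc 1 y, FF D k n = ∑ n ∈ range (y + 1), FF D k n := by
      rw [Finset.sum_range_succ', hz, add_zero, Finset.range_eq_Ico,
        Finset.sum_Ico_add' (FF D k) 0 y 1]
      congr 1
    set M := (y + 1) / 8 with hM
    have e2 : y + 1 = 8 * M + (y + 1) % 8 := by omega
    rw [e1, e2, Finset.sum_range_add, sum_range_eight]
    have hMy : ((M:ℕ):ℝ) ≤ y := by exact_mod_cast (by omega : M ≤ y)
    have b1 : |∑ r ∈ range 8, ∑ j ∈ range M, FF D k (8 * j + r)| ≤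
        8 * (C * ((y:ℝ) ^ (999/1000:ℝ) * (k:ℝ) ^ (13/40000:ℝ))) := by
      refine (Finset.abs_sum_le_sum_abs _ _).trans ?_
      calc _ ≤ ∑ r ∈ range 8, C * ((y:ℝ) ^ (999/1000:ℝ) * (k:ℝ) ^ (13/40000:ℝ)) := by
            apply Finset.sum_le_sum
            intro r _
            obtain ⟨h, hh⟩ := jac_ap k ho r
            have : ∑ j ∈ range M, FF D k (8 * j + r) =
                (kr D r * (jacobiSym 8 k : ℝ)) * ∑ j ∈ range M, (jacobiSym ((h + j : ℕ):ℤ) k : ℝ) := by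
              rw [Finset.mul_sum]
              apply Finset.sum_congr rfl
              intro j _
              unfold FF
              rw [hh j, kr_eight D hD]
              push_cast; ring
            rw [this, abs_mul, abs_mul]
            calc _ ≤ 1 * 1 * (C * ((M:ℝ) ^ (999/1000:ℝ) * (k:ℝ) ^ (13/40000:ℝ))) := by
                  gcongr
                  · exact kr_abs D r
                  · exact jac_real_abs _ _
                  · exact hb k hk ho hk2 h M
              _ ≤ _ := by rw [one_mul, one_mul]; gcongr
        _ = _ := by simp
    have b2 : |∑ j ∈ range ((y + 1) % 8), FF D k (8 * M + j)| ≤ 8 := by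
      refine (Finset.abs_sum_le_sum_abs _ _).trans ?_
      calc _ ≤ ∑ j ∈ range ((y + 1) % 8), (1:ℝ) := Finset.sum_le_sum fun j _ => FF_abs D k _
        _ = (((y + 1) % 8 : ℕ):ℝ) := by simp
        _ ≤ 8 := by exact_mod_cast (Nat.mod_lt _ (by norm_num)).le
    refine (abs_add_le _ _).trans ?_
    nlinarith
  · have hk1' : k = 1 := by have := ho.pos; omega
    subst hk1'
    have hD1 : D ≠ 1 := by rcases hor with h | h; exact absurd h (by omega); exact h
    have hs : ¬ IsSquare D := by
      rcases hD with rfl | rfl | rfl | rfl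
      · exact absurd rfl hD1
      · rintro ⟨r, hr⟩; nlinarith
      · rintro ⟨r, hr⟩
        have h1 : r ≤ 1 := by nlinarith
        have h2 : -1 ≤ r := by nlinarith
        interval_cases r <;> omega
      · rintro ⟨r, hr⟩; nlinarith
    have := (kr_RC D hs).sum y
    have e : ∑ n ∈ Icc 1 y, FF D 1 n = ∑ n ∈ Icc 1 y, kr D n := by
      apply Finset.sum_congr rfl; intro n _; simp [FF]
    rw [e]
    have h8 : ((4 * D.natAbs : ℕ):ℝ) ≤ 8 := by
      rcases hD with rfl | rfl | rfl | rfl <;> norm_num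
    nlinarith

/-- coprime-restricted twisted character -/
noncomputable def FA (Q : ℕ) (D : ℤ) (k n : ℕ) : ℝ := if n.Coprime Q then FF D k n else 0

theorem FA_abs (Q : ℕ) (D : ℤ) (k n : ℕ) : |FA Q D k n| ≤ 1 := by
  unfold FA; split_ifs
  · exact FF_abs D k n
  · simp

theorem FA_sum : ∃ C : ℝ, 1 ≤ C ∧ ∀ (D : ℤ) (Q k : ℕ), Q ≠ 0 → Small D → Squarefree k → Odd k →
    (1 < k ∨ D ≠ 1) → ∀ y : ℕ,
    |∑ n ∈ Icc 1 y, FA Q D k n| ≤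
      (C * Q.divisors.card * (k:ℝ) ^ (13/40000:ℝ)) * (y:ℝ) ^ (1 - 1/1000:ℝ) := by
  obtain ⟨C, hC, hb⟩ := FF_sum
  refine ⟨C, hC, fun D Q k hQ hD hk ho hor y => ?_⟩
  unfold FA
  rw [sum_coprime (FF D k) Q y hQ]
  refine (Finset.abs_sum_le_sum_abs _ _).trans ?_
  calc _ ≤ ∑ g ∈ Q.divisors, C * ((y:ℝ) ^ (999/1000:ℝ) * (k:ℝ) ^ (13/40000:ℝ)) := by
        apply Finset.sum_le_sum
        intro g hg
        have : ∑ n ∈ Icc 1 (y / g), FF D k (g * n) = FF D k g * ∑ n ∈ Icc 1 (y / g), FF D k n := by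
          rw [Finset.mul_sum]; exact Finset.sum_congr rfl fun n _ => FF_mul D k g n
        rw [this, abs_mul, abs_mul]
        have hyg : ((y / g : ℕ):ℝ) ≤ y := by exact_mod_cast Nat.div_le_self y g
        calc _ ≤ 1 * (1 * (C * (((y / g : ℕ):ℝ) ^ (999/1000:ℝ) * (k:ℝ) ^ (13/40000:ℝ)))) := by
              gcongr
              · exact abs_moeb_le g
              · exact FF_abs D k g
              · exact hb D k hD hk ho hor (y / g)
          _ ≤ _ := by rw [one_mul, one_mul]; gcongr
    _ = _ := by
        rw [Finset.sum_const, nsmul_eq_mul]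
        norm_num; ring

end HB
end

section
open Finset Filter Topology
namespace HB

theorem recip (P : ℕ) (hP : Odd P) : ∃ s : ℤ, (s = 1 ∨ s = -1) ∧ ∀ n : ℕ, Odd n →
    jacobiSym (P:ℤ) n = jacobiSym s n * jacobiSym (n:ℤ) P := by
  have h2 := Nat.odd_iff.1 hP
  rcases (by omega : P % 4 = 1 ∨ P % 4 = 3) with h | h
  · refine ⟨1, Or.inl rfl, fun n hn => ?_⟩
    rw [jacobiSym.quadratic_reciprocity_one_mod_four h hn, jacobiSym.one_left, one_mul]
  · refine ⟨-1, Or.inr rfl, fun n hn => ?_⟩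
    have h3 := Nat.odd_iff.1 hn
    rw [jacobiSym.at_neg_one hn]
    rcases (by omega : n % 4 = 1 ∨ n % 4 = 3) with h' | h'
    · rw [jacobiSym.quadratic_reciprocity_one_mod_four' hP h', ZMod.χ₄_nat_one_mod_four h', one_mul]
    · rw [jacobiSym.quadratic_reciprocity_three_mod_four h h', ZMod.χ₄_nat_three_mod_four h']; ring

theorem twist_ex (m P : ℕ) (hP : Odd P) (hm : m = P ∨ m = 2 * P) :
    ∃ D : ℤ, Small D ∧ ∀ n, kr (-(m:ℤ)) n = FF D P n := by
  obtain ⟨s, hs, hr⟩ := recip P hP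
  have key : ∀ t : ℤ, -(m:ℤ) = t * P → ∀ n, kr (-(m:ℤ)) n = FF (t * s) P n := by
    intro t ht n
    unfold FF kr
    by_cases hn : Odd n
    · rw [if_pos hn, if_pos hn, ht, jacobiSym.mul_left, hr n hn, jacobiSym.mul_left]
      push_cast; ring
    · rw [if_neg hn, if_neg hn, zero_mul]
  rcases hm with h | h
  · refine ⟨-1 * s, ?_, key _ (by rw [h]; ring)⟩
    unfold Small; rcases hs with rfl | rfl <;> norm_num
  · refine ⟨-2 * s, ?_, key _ (by rw [h]; push_cast; ring)⟩
    unfold Small; rcases hs with rfl | rfl <;> norm_num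

theorem jac_sq_one (e d : ℕ) (h : e.Coprime d) :
    (jacobiSym (e:ℤ) d : ℝ) * (jacobiSym (e:ℤ) d : ℝ) = 1 := by
  have := jacobiSym.sq_one (a := (e:ℤ)) (b := d) (by simpa using h)
  rw [sq] at this
  exact_mod_cast this

theorem cv_FA (P d k : ℕ) (hdk : d * k = P) (hP : Odd P) (D : ℤ) (n : ℕ) :
    cv (FA (2 * P) D k) (FA (2 * P) 1 d) n =
      if n.Coprime (2 * P) then (jacobiSym (n:ℤ) d : ℝ) * cv (FF D P) (fun _ => 1) n else 0 := by
  have hP0 := hP.pos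
  have hd : d ≠ 0 := by rintro rfl; simp at hdk; omega
  have hk : k ≠ 0 := by rintro rfl; simp at hdk; omega
  unfold cv
  split_ifs with hn
  · rw [Finset.mul_sum]
    apply Finset.sum_congr rfl
    rintro ⟨e, f⟩ hp
    obtain ⟨h1, h2⟩ := Nat.mem_divisorsAntidiagonal.1 hp
    simp only at h1 ⊢
    have he : e.Coprime (2 * P) := Nat.Coprime.coprime_dvd_left ⟨f, h1.symm⟩ hn
    have hf : f.Coprime (2 * P) := Nat.Coprime.coprime_dvd_left ⟨e, by rw [← h1]; ring⟩ hn
    unfold FA FF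
    rw [if_pos he, if_pos hf]
    have hfo : Odd f := Nat.coprime_two_right.1 (hf.coprime_dvd_right ⟨P, rfl⟩)
    have hk1 : kr 1 f = 1 := by unfold kr; rw [if_pos hfo, jacobiSym.one_left]; norm_num
    have hed : e.Coprime d := he.coprime_dvd_right ⟨2 * k, by rw [← hdk]; ring⟩
    have := jac_sq_one e d hed
    rw [hk1, ← h1, ← hdk, jacobiSym.mul_right' _ hd hk]
    push_cast
    rw [jacobiSym.mul_left]
    push_cast
    linear_combination (-(jacobiSym (f:ℤ) d : ℝ) * kr D e * (jacobiSym (e:ℤ) k : ℝ)) * this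
  · apply Finset.sum_eq_zero
    rintro ⟨e, f⟩ hp
    obtain ⟨h1, h2⟩ := Nat.mem_divisorsAntidiagonal.1 hp
    simp only at h1 ⊢
    unfold FA
    by_cases he : e.Coprime (2 * P)
    · by_cases hf : f.Coprime (2 * P)
      · exact absurd (h1 ▸ Nat.Coprime.mul_left he hf) hn
      · rw [if_neg hf, mul_zero]
    · rw [if_neg he, zero_mul]

/-- sum of symbols over divisors -/
noncomputable def SS (P n : ℕ) : ℝ := ∑ d ∈ P.divisors, (jacobiSym (n:ℤ) d : ℝ)

theorem SS_prod (P n : ℕ) (hP : Squarefree P) :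
    SS P n = ∏ p ∈ P.primeFactors, (1 + (jacobiSym (n:ℤ) p : ℝ)) := by
  have hm : (AF (fun d => (jacobiSym (n:ℤ) d : ℝ))).IsMultiplicative := by
    rw [ArithmeticFunction.IsMultiplicative.iff_ne_zero]
    refine ⟨by rw [AF_apply _ _ one_ne_zero]; simp, ?_⟩
    intro a b ha hb _
    rw [AF_apply _ _ ha, AF_apply _ _ hb, AF_apply _ _ (mul_ne_zero ha hb), jacobiSym.mul_right' _ ha hb]
    push_cast; rfl
  have := hm.prodPrimeFactors_one_add_of_squarefree hP
  unfold SS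
  rw [show ∑ d ∈ P.divisors, (jacobiSym (n:ℤ) d : ℝ) =
    ∑ d ∈ P.divisors, (AF (fun d => (jacobiSym (n:ℤ) d : ℝ))) d from ?_, ← this]
  · apply Finset.prod_congr rfl
    intro p hp
    rw [AF_apply _ _ (Nat.prime_of_mem_primeFactors hp).ne_zero]
  · apply Finset.sum_congr rfl
    intro d hd
    rw [AF_apply _ _ (Nat.pos_of_mem_divisors hd).ne']

theorem SS_nonneg (P n : ℕ) (hP : Squarefree P) : 0 ≤ SS P n := by
  rw [SS_prod P n hP]
  apply Finset.prod_nonneg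
  intro p _
  have := jac_real_abs (n:ℤ) p
  rw [abs_le] at this
  linarith

theorem SS_ne (P n : ℕ) (hP : Squarefree P) (h : SS P n ≠ 0) (hc : n.Coprime P) (p : ℕ)
    (hp : p.Prime) (hpP : p ∣ P) : jacobiSym (n:ℤ) p = 1 := by
  rw [SS_prod P n hP, Finset.prod_ne_zero_iff] at h
  have h1 := h p (Nat.mem_primeFactors.2 ⟨hp, hpP, hP.ne_zero⟩)
  rcases jacobiSym.trichotomy (n:ℤ) p with h2 | h2 | h2
  · have : NeZero p := ⟨hp.ne_zero⟩
    rw [jacobiSym.eq_zero_iff_not_coprime] at h2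
    exact absurd (by simpa using hc.coprime_dvd_right hpP) h2
  · exact h2
  · rw [h2] at h1; norm_num at h1

theorem sq_crt (A : ℤ) : ∀ N : ℕ, Squarefree N → (∀ p : ℕ, p.Prime → p ∣ N → ∃ c : ℤ, (p:ℤ) ∣ c ^ 2 - A) →
    ∃ c : ℤ, (N:ℤ) ∣ c ^ 2 - A := by
  intro N
  induction N using induction_on_primes with
  | zero => intro h; exact absurd rfl h.ne_zero
  | one => intro _ _; exact ⟨0, by simp⟩
  | prime_mul p a hp ih =>
    intro hsq hh
    obtain ⟨c1, hc1⟩ := hh p hp ⟨a, rfl⟩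
    obtain ⟨c2, hc2⟩ := ih (hsq.squarefree_of_dvd ⟨p, by ring⟩)
      (fun q hq hqa => hh q hq (hqa.mul_left p))
    have hcop : p.Coprime a := Nat.coprime_of_squarefree_mul hsq
    have hcop' : IsCoprime (p:ℤ) (a:ℤ) := Nat.isCoprime_iff_coprime.2 hcop
    obtain ⟨u, v, huv⟩ := hcop'
    refine ⟨c1 * (v * a) + c2 * (u * p), ?_⟩
    push_cast
    apply IsCoprime.mul_dvd (Nat.isCoprime_iff_coprime.2 hcop)
    · obtain ⟨w, hw⟩ := hc1
      have : c1 * (v * a) + c2 * (u * p) = c1 + p * (u * (c2 - c1)) := by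
        linear_combination c1 * huv
      rw [this]
      exact ⟨w + 2 * c1 * (u * (c2 - c1)) + p * (u * (c2 - c1)) ^ 2, by linear_combination hw⟩
    · obtain ⟨w, hw⟩ := hc2
      have : c1 * (v * a) + c2 * (u * p) = c2 + a * (v * (c1 - c2)) := by
        linear_combination c2 * huv
      rw [this]
      exact ⟨w + 2 * c2 * (v * (c1 - c2)) + a * (v * (c1 - c2)) ^ 2, by linear_combination hw⟩

theorem sq_of_jac (a : ℤ) (p : ℕ) (hp : p.Prime) (h : jacobiSym a p = 1) : ∃ c : ℤ, (p:ℤ) ∣ c ^ 2 - a := by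
  haveI : Fact p.Prime := ⟨hp⟩
  obtain ⟨r, hr⟩ := ZMod.isSquare_of_jacobiSym_eq_one h
  refine ⟨(r.val : ℤ), ?_⟩
  rw [← ZMod.intCast_zmod_eq_zero_iff_dvd]
  push_cast
  rw [ZMod.natCast_zmod_val, hr]; ring

/-- the good auxiliary integers -/
def Good (m n : ℕ) : Prop := Squarefree n ∧ 1 < n ∧ n.Coprime (2 * m) ∧
  (∃ b : ℤ, (n:ℤ) ∣ b ^ 2 + m) ∧ ∃ c : ℤ, (m:ℤ) ∣ c ^ 2 - n

theorem good_of_ne (m P n : ℕ) (hm : Squarefree m) (hmP : m = P ∨ m = 2 * P) (q : ℝ)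
    (hRC : RC (kr (-(m:ℤ))) q) (hP : Squarefree P)
    (hn : n.Coprime (2 * P)) (hn0 : n ≠ 0) (hS : SS P n ≠ 0)
    (hr : cv (kr (-(m:ℤ))) (fun _ => 1) n ≠ 0) (hsq : ¬ IsSquare n) : ∃ n0, n0 ≤ n ∧ Good m n0 := by
  obtain ⟨n0, b, hab, hsf⟩ := Nat.sq_mul_squarefree n
  have hb0 : b ≠ 0 := by rintro rfl; simp at hab; omega
  have hn1 : n0 ≠ 0 := hsf.ne_zero
  have hd : n0 ∣ n := ⟨b ^ 2, by rw [← hab]; ring⟩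
  have hbd : b ∣ n := ⟨b * n0, by rw [← hab]; ring⟩
  have hodd : n.Coprime 2 := hn.coprime_dvd_right ⟨P, rfl⟩
  have hnP : n.Coprime P := hn.coprime_dvd_right ⟨2, by ring⟩
  have hnm : n.Coprime m := by
    rcases hmP with h | h
    · rw [h]; exact hnP
    · rw [h]; exact hn
  refine ⟨n0, Nat.le_of_dvd (Nat.pos_of_ne_zero hn0) hd, hsf, ?_, ?_, ?_, ?_⟩
  · have : n0 ≠ 1 := by rintro rfl; exact hsq ⟨b, by rw [← hab]; ring⟩
    omega
  · exact Nat.Coprime.coprime_dvd_left hd (Nat.Coprime.mul_right hodd hnm)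
  · obtain ⟨c, hc⟩ := sq_crt (-(m:ℤ)) n0 hsf (by
      intro p hp hpn
      apply sq_of_jac _ _ hp
      have hpo : Odd p := Nat.coprime_two_right.1 (Nat.Coprime.coprime_dvd_left (hpn.trans hd) hodd)
      rcases jacobiSym.trichotomy (-(m:ℤ)) p with h2 | h2 | h2
      · have : NeZero p := ⟨hp.ne_zero⟩
        rw [jacobiSym.eq_zero_iff_not_coprime] at h2
        refine absurd ?_ h2
        have := (Nat.Coprime.coprime_dvd_left (hpn.trans hd) hnm).symm
        simpa using this
      · exact h2
      · exfalso; apply hr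
        have hk : kr (-(m:ℤ)) p = -1 := by unfold kr; rw [if_pos hpo, h2]; norm_num
        obtain ⟨c0, rfl⟩ := hpn
        obtain ⟨i, b', hb', rfl⟩ := Nat.exists_eq_pow_mul_and_not_dvd hb0 p hp.ne_one
        have hpc : p.Coprime c0 := Nat.coprime_of_squarefree_mul hsf
        have e : n = p ^ (2 * i + 1) * (b' ^ 2 * c0) := by rw [← hab]; ring
        have hcop : Nat.Coprime (p ^ (2 * i + 1)) (b' ^ 2 * c0) := by
          apply Nat.Coprime.pow_left
          apply Nat.Coprime.mul_right _ hpc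
          exact ((Nat.Prime.coprime_iff_not_dvd hp).2 hb').pow_right 2
        rw [cv_AF, e, (r_mult hRC).map_mul_of_coprime hcop, ← cv_AF, r_pp hRC _ _ hp, hk,
          neg_one_geom_sum, if_pos (by rw [Nat.even_iff]; omega), zero_mul])
    exact ⟨c, by simpa using hc⟩
  · apply sq_crt _ _ hm
    intro p hp hpm
    by_cases hp2 : p = 2
    · subst hp2
      refine ⟨n0, ?_⟩
      have : ((n0:ℤ)) ^ 2 - n0 = n0 * (n0 - 1) := by ring
      rw [this]
      have := Int.even_mul_pred_self (n0:ℤ)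
      exact this.two_dvd
    · have hpP : p ∣ P := by
        rcases hmP with h | h
        · rwa [← h]
        · rw [h] at hpm
          rcases (Nat.Prime.dvd_mul hp).1 hpm with h' | h'
          · exact absurd ((Nat.prime_dvd_prime_iff_eq hp Nat.prime_two).1 h') hp2
          · exact h'
      apply sq_of_jac _ _ hp
      have h1 := SS_ne P n hP hS hnP p hp hpP
      rw [← hab] at h1
      push_cast at h1
      rw [jacobiSym.mul_left, jacobiSym.pow_left, jacobiSym.sq_one, one_mul] at h1
      · exact h1
      · have : b.Coprime p := Nat.Coprime.coprime_dvd_left hbd (hnP.coprime_dvd_right hpP)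
        simpa using this

end HB
end

section
open Finset Filter Topology
namespace HB

theorem U1_est (δ : ℝ) (h0 : 0 < δ) (h1 : δ < 1) (χ : ℕ → ℝ) (hχ1 : ∀ n, |χ n| ≤ 1) (B : ℝ) (hB : 0 ≤ B)
    (hχ : ∀ y : ℕ, |∑ n ∈ Icc 1 y, χ n| ≤ B * (y:ℝ) ^ (1 - δ)) (Q : ℕ) (hQ : Q ≠ 0) (x E : ℕ) :
    |∑ n ∈ Icc 1 x, cv χ (fun n => if n.Coprime Q then 1 else 0) n - rho Q * x * LS χ 1| ≤
      E * (1 + Q.divisors.card) + (2 + 3 / δ) * B * (x * ((E + 1 : ℕ):ℝ) ^ (-δ)) := by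
  have hT : (0:ℝ) ≤ Q.divisors.card := Nat.cast_nonneg _
  have hρ1 := rho_le Q hQ
  have hρ0 : 0 ≤ rho Q := by
    have := rho_ge Q hQ
    by_contra hneg
    push Not at hneg
    nlinarith
  rw [hyperbola χ _ x E]
  set β : ℕ → ℝ := fun n => if n.Coprime Q then 1 else 0 with hβ
  have hβ1 : ∀ n, |β n| ≤ 1 := by intro n; simp only [hβ]; split_ifs <;> simp
  have s2 := hyp_second δ h0 h1 χ β B hB hβ1 hχ x E
  have s3 := LS_tail χ B (1 - δ) 1 (by linarith) (by linarith) (fun y _ => hχ y) E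
  rw [show (1:ℝ) - (1 - δ) = δ by ring, show (1:ℝ) - δ - 1 = -δ by ring] at s3
  have s1 : |∑ e ∈ Icc 1 E, χ e * ∑ f ∈ Icc 1 (x / e), β f - rho Q * x * PS χ 1 E| ≤
      E * (1 + Q.divisors.card) := by
    unfold PS
    rw [Finset.mul_sum, ← Finset.sum_sub_distrib]
    refine (Finset.abs_sum_le_sum_abs _ _).trans ?_
    calc _ ≤ ∑ e ∈ Icc 1 E, ((1:ℝ) + Q.divisors.card) := by
          apply Finset.sum_le_sum
          intro e he
          rw [mem_Icc] at he
          have he0 : (0:ℝ) < e := by exact_mod_cast he.1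
          have c1 := count_coprime Q (x / e) hQ
          have e1 : χ e * ∑ f ∈ Icc 1 (x / e), β f - rho Q * x * (χ e * (e:ℝ) ^ (-(1:ℝ))) =
              χ e * ((∑ f ∈ Icc 1 (x / e), β f - rho Q * ((x / e : ℕ):ℝ)) -
                rho Q * ((x:ℝ) / e - ((x / e : ℕ):ℝ))) := by
            rw [Real.rpow_neg_one]; ring
          rw [e1, abs_mul]
          have d1 : ((x / e : ℕ):ℝ) ≤ (x:ℝ) / e := Nat.cast_div_le
          have d2 : (x:ℝ) / e < ((x / e : ℕ):ℝ) + 1 := by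
            rw [div_lt_iff₀ he0]
            have := Nat.lt_mul_div_succ x (show 0 < e by omega)
            have h' : ((x:ℕ):ℝ) < ((e * (x / e + 1) : ℕ):ℝ) := by exact_mod_cast this
            push_cast at h' ⊢
            linarith
          have d3 : |rho Q * ((x:ℝ) / e - ((x / e : ℕ):ℝ))| ≤ 1 := by
            rw [abs_mul, abs_of_nonneg hρ0, abs_of_nonneg (by linarith)]
            exact mul_le_one₀ hρ1 (by linarith) (by linarith)
          calc _ ≤ 1 * |(∑ f ∈ Icc 1 (x / e), β f - rho Q * ((x / e : ℕ):ℝ)) -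
                rho Q * ((x:ℝ) / e - ((x / e : ℕ):ℝ))| := by gcongr; exact hχ1 e
            _ ≤ |∑ f ∈ Icc 1 (x / e), β f - rho Q * ((x / e : ℕ):ℝ)| +
                |rho Q * ((x:ℝ) / e - ((x / e : ℕ):ℝ))| := by rw [one_mul]; exact abs_sub _ _
            _ ≤ _ := by rw [add_comm]; exact add_le_add d3 c1
      _ = _ := by simp; ring
  have s4 : |rho Q * x * PS χ 1 E - rho Q * x * LS χ 1| ≤
      1 * x * (B * (2 + 1 / δ) * ((E + 1 : ℕ):ℝ) ^ (-δ)) := by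
    rw [← mul_sub, abs_mul, abs_mul, abs_of_nonneg hρ0, Nat.abs_cast, abs_sub_comm]
    gcongr
  set A1 := ∑ e ∈ Icc 1 E, χ e * ∑ f ∈ Icc 1 (x / e), β f
  set A2 := ∑ f ∈ Icc 1 (x / (E + 1)), β f * ∑ e ∈ Ioc E (x / f), χ e
  calc |A1 + A2 - rho Q * x * LS χ 1| =
        |(A1 - rho Q * x * PS χ 1 E) + (rho Q * x * PS χ 1 E - rho Q * x * LS χ 1) + A2| := by
          congr 1; ring
    _ ≤ |A1 - rho Q * x * PS χ 1 E| + |rho Q * x * PS χ 1 E - rho Q * x * LS χ 1| + |A2| := by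
        refine (abs_add_le _ _).trans ?_
        gcongr
        exact abs_add_le _ _
    _ ≤ E * (1 + Q.divisors.card) + 1 * x * (B * (2 + 1 / δ) * ((E + 1 : ℕ):ℝ) ^ (-δ)) +
        2 * B / δ * (x * ((E + 1 : ℕ):ℝ) ^ (-δ)) := by gcongr
    _ = _ := by ring

theorem r_le_card {χ : ℕ → ℝ} (h : ∀ n, |χ n| ≤ 1) (n : ℕ) : cv χ (fun _ => 1) n ≤ n.divisors.card := by
  unfold cv
  rw [← Nat.map_div_right_divisors, Finset.sum_map]
  calc _ ≤ ∑ d ∈ n.divisors, (1:ℝ) := by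
        apply Finset.sum_le_sum; intro d _
        simp only [mul_one]
        exact (le_abs_self _).trans (h _)
    _ = _ := by simp

theorem sum_sq_le (f : ℕ → ℝ) (x : ℕ) (M : ℝ) (hM : 0 ≤ M) (h1 : ∀ n, 0 < n → n ≤ x → f n ≤ M)
    (h2 : ∀ n, 0 < n → n ≤ x → ¬ IsSquare n → f n = 0) :
    ∑ n ∈ Icc 1 x, f n ≤ Nat.sqrt x * M := by
  classical
  calc ∑ n ∈ Icc 1 x, f n ≤ ∑ n ∈ (Icc 1 x).filter IsSquare, f n := by
        rw [Finset.sum_filter]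
        apply Finset.sum_le_sum
        intro n hn
        rw [mem_Icc] at hn
        split_ifs with h
        · exact le_rfl
        · rw [h2 n (by omega) hn.2 h]
    _ ≤ ((Icc 1 x).filter IsSquare).card • M := by
        apply Finset.sum_le_card_nsmul
        intro n hn
        rw [mem_filter, mem_Icc] at hn
        exact h1 n (by omega) hn.1.2
    _ ≤ _ := by
        rw [nsmul_eq_mul]
        gcongr
        calc _ ≤ ((Icc 1 (Nat.sqrt x)).image (fun r => r * r)).card := by
              apply Finset.card_le_card
              intro n hn
              rw [mem_filter, mem_Icc] at hn
              obtain ⟨⟨a, b⟩, r, rfl⟩ := hn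
              refine mem_image.2 ⟨r, mem_Icc.2 ⟨?_, Nat.le_sqrt.2 b⟩, rfl⟩
              by_contra h
              have : r = 0 := by omega
              subst this; omega
          _ ≤ _ := by
              refine Finset.card_image_le.trans ?_
              simp

end HB
end

section
open Finset Filter Topology
namespace HB

theorem FF_zero (m P : ℕ) (D : ℤ) (hP : Odd P) (hDn : ∀ n, kr (-(m:ℤ)) n = FF D P n) (n : ℕ)
    (hn : ¬ n.Coprime (2 * P)) : FF D P n = 0 := by
  unfold FF kr
  by_cases h2 : Odd n
  · have hnP : ¬ n.Coprime P := fun h => hn (Nat.Coprime.mul_right (Nat.coprime_two_right.2 h2) h)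
    have : NeZero P := ⟨hP.pos.ne'⟩
    have h0 : jacobiSym (n:ℤ) P = 0 := by
      rw [jacobiSym.eq_zero_iff_not_coprime]
      simpa using hnP
    rw [h0]; simp
  · rw [if_neg h2, zero_mul]

theorem FA_top (m P : ℕ) (D : ℤ) (hP : Odd P) (hDn : ∀ n, kr (-(m:ℤ)) n = FF D P n) :
    FA (2 * P) D P = kr (-(m:ℤ)) := by
  funext n
  rw [hDn]
  unfold FA
  split_ifs with h
  · rfl
  · rw [FF_zero m P D hP hDn n h]

theorem FA_bot (P : ℕ) : FA (2 * P) 1 1 = fun n => if n.Coprime (2 * P) then 1 else 0 := by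
  funext n
  unfold FA
  split_ifs with h
  · have : Odd n := Nat.coprime_two_right.1 (h.coprime_dvd_right ⟨P, rfl⟩)
    simp [FF, kr, this, jacobiSym.one_left]
  · rfl

theorem pow_alg (C T k d : ℝ) (hC : 0 < C) (hT : 0 < T) (hk : 0 < k) (hd : 0 < d) :
    ((C * T * k ^ (13/40000:ℝ)) * (C * T * d ^ (13/40000:ℝ))) ^ (1/2:ℝ) =
      C * T * (d * k) ^ (13/80000:ℝ) := by
  have e : (C * T * k ^ (13/40000:ℝ)) * (C * T * d ^ (13/40000:ℝ)) =
      (C * T * (d * k) ^ (13/80000:ℝ)) ^ (2:ℝ) := by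
    rw [Real.mul_rpow (x := C * T) (by positivity) (by positivity), ← Real.rpow_mul (by positivity),
      show (13/80000:ℝ) * 2 = 13/40000 by norm_num, Real.mul_rpow hd.le hk.le, Real.rpow_two]
    ring
  rw [e, ← Real.rpow_mul (by positivity)]
  norm_num

theorem main_ineq : ∃ C : ℝ, 1 ≤ C ∧ ∀ (m P x E : ℕ) (R : ℝ), Squarefree m → Squarefree P → Odd P → 1 < P →
    (m = P ∨ m = 2 * P) → 0 < x → (∀ n, 0 < n → n ≤ x → (n.divisors.card:ℝ) ≤ R) →
    (∀ n, n ≤ x → ¬ Good m n) →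
    rho (2 * P) * x * LS (kr (-(m:ℤ))) 1 ≤ Nat.sqrt x * ((2 * P).divisors.card * R) +
      E * (1 + (2 * P).divisors.card) +
      C * (2 * P).divisors.card * (P:ℝ) ^ (13/40000:ℝ) * (x * ((E + 1 : ℕ):ℝ) ^ (-(1/1000:ℝ))) +
      C * ((2 * P).divisors.card:ℝ) ^ 2 * ((P:ℝ) ^ (13/80000:ℝ) * (x:ℝ) ^ (1 - 1/2000:ℝ)) := by
  obtain ⟨C, hC, hb⟩ := FA_sum
  refine ⟨3002 * C, by linarith, fun m P x E R hm hP hPo hP1 hmP hx hR hbad => ?_⟩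
  obtain ⟨D, hD, hDn⟩ := twist_ex m P hPo hmP
  have hQ : 2 * P ≠ 0 := by omega
  have hdiv : P.divisors.card ≤ (2 * P).divisors.card :=
    Finset.card_le_card (Nat.divisors_subset_of_dvd hQ ⟨2, by ring⟩)
  set T : ℝ := ((2 * P).divisors.card : ℝ) with hT
  have hdivT : (P.divisors.card : ℝ) ≤ T := by rw [hT]; exact_mod_cast hdiv
  have hT1 : 1 ≤ T := by
    rw [hT]; exact_mod_cast Finset.card_pos.2 ⟨1, Nat.one_mem_divisors.2 hQ⟩
  have hR0 : 0 ≤ R := (Nat.cast_nonneg _).trans (hR 1 one_pos hx)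
  have hm0 : 0 < m := Nat.pos_of_ne_zero hm.ne_zero
  have hns : ¬ IsSquare (-(m:ℤ)) := by
    rintro ⟨r, hr⟩
    have : (0:ℤ) < m := by exact_mod_cast hm0
    nlinarith
  have hRC := kr_RC _ hns
  set χ := kr (-(m:ℤ)) with hχ
  have hFP : FF D P = χ := by funext n; rw [hDn]
  have hr0 : ∀ n, 0 ≤ cv χ (fun _ => 1) n := r_nonneg hRC
  -- the weighted sum
  set U : ℕ → ℝ := fun d => ∑ n ∈ Icc 1 x, cv (FA (2 * P) D (P / d)) (FA (2 * P) 1 d) n with hU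
  have hcv : ∀ d ∈ P.divisors, ∀ n, cv (FA (2 * P) D (P / d)) (FA (2 * P) 1 d) n =
      if n.Coprime (2 * P) then (jacobiSym (n:ℤ) d : ℝ) * cv χ (fun _ => 1) n else 0 := by
    intro d hd n
    rw [cv_FA P d (P / d) (Nat.mul_div_cancel' (Nat.dvd_of_mem_divisors hd)) hPo D n, hFP]
  have htot : ∑ d ∈ P.divisors, U d =
      ∑ n ∈ Icc 1 x, (if n.Coprime (2 * P) then SS P n * cv χ (fun _ => 1) n else 0) := by
    simp only [hU]
    rw [Finset.sum_comm]
    apply Finset.sum_congr rfl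
    intro n _
    rw [Finset.sum_congr rfl (fun d hd => hcv d hd n)]
    split_ifs with h
    · rw [SS, Finset.sum_mul]
    · simp
  have hSS : ∀ n, SS P n ≤ T := by
    intro n
    refine le_trans ?_ hdivT
    unfold SS
    calc _ ≤ ∑ d ∈ P.divisors, (1:ℝ) :=
          Finset.sum_le_sum fun d _ => (le_abs_self _).trans (jac_real_abs _ _)
      _ = _ := by simp
  have hupper : ∑ d ∈ P.divisors, U d ≤ Nat.sqrt x * (T * R) := by
    rw [htot]
    apply sum_sq_le
    · positivity
    · intro n hn hnx
      split_ifs with h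
      · exact mul_le_mul (hSS n) ((r_le_card hRC.abs n).trans (hR n hn hnx)) (hr0 n) (by linarith)
      · positivity
    · intro n hn hnx hsq
      split_ifs with h
      · by_contra hne
        have := mul_ne_zero_iff.1 hne
        obtain ⟨n0, hn0, hg⟩ := good_of_ne m P n hm hmP _ hRC hP h (by omega) this.1 this.2 hsq
        exact hbad n0 (hn0.trans hnx) hg
      · rfl
  have hU1 := U1_est (1/1000) (by norm_num) (by norm_num) χ hRC.abs
    (C * T * (P:ℝ) ^ (13/40000:ℝ)) (by positivity) (by
      intro y
      have := hb D (2 * P) P hQ hD hP hPo (Or.inl hP1) y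
      rw [FA_top m P D hPo hDn] at this
      exact this) (2 * P) hQ x E
  have hU1' : U 1 = ∑ n ∈ Icc 1 x, cv χ (fun n => if n.Coprime (2 * P) then 1 else 0) n := by
    simp only [hU]
    rw [Nat.div_one, FA_top m P D hPo hDn, FA_bot P]
  rw [← hU1', abs_le] at hU1
  set bd : ℝ := 3000 * (C * T * ((P:ℝ) ^ (13/80000:ℝ) * (x:ℝ) ^ (1 - 1/2000:ℝ))) with hbd
  have hbd0 : 0 ≤ bd := by positivity
  have hUd : ∀ d ∈ P.divisors.erase 1, -bd ≤ U d := by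
    intro d hd
    rw [mem_erase] at hd
    obtain ⟨hd1, hd2⟩ := hd
    have hdP := Nat.dvd_of_mem_divisors hd2
    have hd0 := Nat.pos_of_mem_divisors hd2
    have hdk : d * (P / d) = P := Nat.mul_div_cancel' hdP
    have hkP : P / d ∣ P := ⟨d, by rw [mul_comm]; exact hdk.symm⟩
    have hk0 : 0 < P / d := Nat.pos_of_dvd_of_pos hkP hPo.pos
    by_cases hcase : 1 < P / d ∨ D ≠ 1
    · have := hyp_main (1/1000) (by norm_num) (by norm_num) (FA (2 * P) D (P / d)) (FA (2 * P) 1 d)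
        (C * T * ((P / d : ℕ):ℝ) ^ (13/40000:ℝ)) (C * T * (d:ℝ) ^ (13/40000:ℝ))
        (by positivity) (by positivity) (FA_abs _ _ _) (FA_abs _ _ _)
        (hb D (2 * P) (P / d) hQ hD (hP.squarefree_of_dvd hkP) (Odd.of_dvd_nat hPo hkP) hcase)
        (hb 1 (2 * P) d hQ (Or.inl rfl) (hP.squarefree_of_dvd hdP) (Odd.of_dvd_nat hPo hdP)
          (Or.inl (by omega))) x hx
      rw [pow_alg C T _ _ (by linarith) (by linarith) (by exact_mod_cast hk0) (by exact_mod_cast hd0)] at this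
      have e : (d:ℝ) * ((P / d : ℕ):ℝ) = P := by exact_mod_cast hdk
      rw [e] at this
      have h2 := (abs_le.1 this).1
      refine le_trans (le_of_eq ?_) h2
      rw [hbd, show (3 / (1/1000:ℝ)) = 3000 by norm_num, show (1 - 1/1000/2:ℝ) = 1 - 1/2000 by norm_num]; ring
    · push Not at hcase
      obtain ⟨hk1, hD1⟩ := hcase
      have hk1' : P / d = 1 := by omega
      have hdP' : d = P := by rw [hk1', mul_one] at hdk; exact hdk
      have : 0 ≤ U d := by
        simp only [hU]
        apply Finset.sum_nonneg
        intro n _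
        rw [hk1', hdP', cv_comm, hD1]
        have h3 := cv_FA P 1 P (one_mul P) hPo 1 n
        rw [h3]
        rw [hD1] at hFP
        rw [hFP]
        split_ifs
        · simpa using hr0 n
        · exact le_rfl
      linarith
  have hrest : -(T * bd) ≤ ∑ d ∈ P.divisors.erase 1, U d := by
    calc -(T * bd) ≤ -(((P.divisors.erase 1).card : ℝ) * bd) := by
          have : ((P.divisors.erase 1).card : ℝ) ≤ T := by
            refine le_trans ?_ hdivT
            exact_mod_cast Finset.card_erase_le
          have := mul_le_mul_of_nonneg_right this hbd0
          linarith
      _ = (P.divisors.erase 1).card • (-bd) := by rw [nsmul_eq_mul]; ring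
      _ ≤ _ := Finset.card_nsmul_le_sum _ _ _ hUd
  have hsplit := Finset.add_sum_erase P.divisors U (Nat.one_mem_divisors.2 hPo.pos.ne')
  have h5 := hU1.1
  have e6 : T * bd ≤ 3002 * C * T ^ 2 * ((P:ℝ) ^ (13/80000:ℝ) * (x:ℝ) ^ (1 - 1/2000:ℝ)) := by
    have h0 : 0 ≤ C * T ^ 2 * ((P:ℝ) ^ (13/80000:ℝ) * (x:ℝ) ^ (1 - 1/2000:ℝ)) := by positivity
    rw [hbd]
    linarith
  have e7 : (2 + 3 / (1/1000:ℝ)) * (C * T * (P:ℝ) ^ (13/40000:ℝ)) * (x * ((E + 1 : ℕ):ℝ) ^ (-(1/1000:ℝ))) =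
      3002 * C * T * (P:ℝ) ^ (13/40000:ℝ) * (x * ((E + 1 : ℕ):ℝ) ^ (-(1/1000:ℝ))) := by
    rw [show (2 + 3 / (1/1000:ℝ)) = 3002 by norm_num]; ring
  rw [e7] at h5
  linarith

end HB
end

section
open Finset Filter Topology
namespace HB

theorem final_alg (M C d ρ x s T R E E1 L P : ℝ) (hM : 1 ≤ M) (hC : 1 ≤ C) (hd : 1 ≤ d)
    (hx0 : M ^ (33/100:ℝ) / 2 ≤ x) (hx1 : x ≤ M ^ (33/100:ℝ)) (hs0 : 0 ≤ s) (hs : s ≤ x ^ (1/2:ℝ))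
    (hT1 : 1 ≤ T) (hT : T ≤ 2 * d * M ^ (1/10000000:ℝ)) (hR0 : 0 ≤ R) (hR : R ≤ d * M ^ (1/10000000:ℝ))
    (hE : E ≤ M ^ (131/400:ℝ)) (hE0 : 0 ≤ E) (hE1 : M ^ (131/400:ℝ) ≤ E1) (hL : M ^ (-(1/10000000):ℝ) ≤ L)
    (hρ : 1 ≤ ρ * T) (hP0 : 0 ≤ P) (hP : P ≤ M)
    (h : ρ * x * L ≤ s * (T * R) + E * (1 + T) + C * T * P ^ (13/40000:ℝ) * (x * E1 ^ (-(1/1000:ℝ))) +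
      C * T ^ 2 * (P ^ (13/80000:ℝ) * x ^ (1 - 1/2000:ℝ))) :
    1 ≤ (4 * d * (2 * d ^ 2 + 4 * d + 2 * C * d + 4 * C * d ^ 2)) * M ^ (-(21/10000000):ℝ) := by
  have hM0 : 0 < M := by linarith
  have hX0 : 0 < M ^ (33/100:ℝ) := by positivity
  have hx : 0 < x := by linarith
  have hT0 : 0 < T := by linarith
  have t1 : s * (T * R) ≤ 2 * d ^ 2 * M ^ (33/100 - 23/10000000:ℝ) := by
    calc s * (T * R) ≤ M ^ (165/1000:ℝ) * ((2 * d * M ^ (1/10000000:ℝ)) * (d * M ^ (1/10000000:ℝ))) := by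
          gcongr
          refine hs.trans ?_
          calc x ^ (1/2:ℝ) ≤ (M ^ (33/100:ℝ)) ^ (1/2:ℝ) := by gcongr
            _ = _ := by rw [← Real.rpow_mul hM0.le]; norm_num
      _ = 2 * d ^ 2 * (M ^ (165/1000:ℝ) * M ^ (1/10000000:ℝ) * M ^ (1/10000000:ℝ)) := by ring
      _ = 2 * d ^ 2 * M ^ (165/1000 + 1/10000000 + 1/10000000:ℝ) := by
          rw [Real.rpow_add hM0, Real.rpow_add hM0]
      _ ≤ _ := by
          gcongr
          norm_num
  have t2 : E * (1 + T) ≤ 4 * d * M ^ (33/100 - 23/10000000:ℝ) := by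
    calc E * (1 + T) ≤ M ^ (131/400:ℝ) * (2 * (2 * d * M ^ (1/10000000:ℝ))) := by
          apply mul_le_mul hE _ (by linarith) (by positivity)
          linarith
      _ = 4 * d * (M ^ (131/400:ℝ) * M ^ (1/10000000:ℝ)) := by ring
      _ = 4 * d * M ^ (131/400 + 1/10000000:ℝ) := by rw [Real.rpow_add hM0]
      _ ≤ _ := by
          gcongr
          norm_num
  have t3 : C * T * P ^ (13/40000:ℝ) * (x * E1 ^ (-(1/1000:ℝ))) ≤
      2 * C * d * M ^ (33/100 - 23/10000000:ℝ) := by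
    have e1 : E1 ^ (-(1/1000:ℝ)) ≤ M ^ (-(131/400000):ℝ) := by
      calc _ ≤ (M ^ (131/400:ℝ)) ^ (-(1/1000:ℝ)) := rpow_neg_anti _ (by norm_num) _ _ (by positivity) hE1
        _ = _ := by rw [← Real.rpow_mul hM0.le]; norm_num
    have hE1' : 0 < E1 := lt_of_lt_of_le (by positivity) hE1
    calc _ ≤ C * (2 * d * M ^ (1/10000000:ℝ)) * M ^ (13/40000:ℝ) * (M ^ (33/100:ℝ) * M ^ (-(131/400000):ℝ)) := by
          gcongr
      _ = 2 * C * d * (M ^ (1/10000000:ℝ) * M ^ (13/40000:ℝ) * M ^ (33/100:ℝ) * M ^ (-(131/400000):ℝ)) := by ring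
      _ = 2 * C * d * M ^ (1/10000000 + 13/40000 + 33/100 + -(131/400000):ℝ) := by
          rw [Real.rpow_add hM0, Real.rpow_add hM0, Real.rpow_add hM0]
      _ ≤ _ := by
          gcongr
          norm_num
  have t4 : C * T ^ 2 * (P ^ (13/80000:ℝ) * x ^ (1 - 1/2000:ℝ)) ≤
      4 * C * d ^ 2 * M ^ (33/100 - 23/10000000:ℝ) := by
    have e1 : x ^ (1 - 1/2000:ℝ) ≤ M ^ (33/100 * (1 - 1/2000):ℝ) := by
      rw [Real.rpow_mul hM0.le]
      exact Real.rpow_le_rpow hx.le hx1 (by norm_num)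
    calc _ ≤ C * (2 * d * M ^ (1/10000000:ℝ)) ^ 2 * (M ^ (13/80000:ℝ) * M ^ (33/100 * (1 - 1/2000):ℝ)) := by
          gcongr
      _ = 4 * C * d ^ 2 * (M ^ (1/10000000:ℝ) * M ^ (1/10000000:ℝ) * M ^ (13/80000:ℝ) * M ^ (33/100 * (1 - 1/2000):ℝ)) := by ring
      _ = 4 * C * d ^ 2 * M ^ (1/10000000 + 1/10000000 + 13/80000 + 33/100 * (1 - 1/2000):ℝ) := by
          rw [Real.rpow_add hM0, Real.rpow_add hM0, Real.rpow_add hM0]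
      _ ≤ _ := by
          gcongr
          norm_num
  have hL0 : 0 < L := lt_of_lt_of_le (by positivity) hL
  have l1 : M ^ (33/100:ℝ) / 2 * M ^ (-(1/10000000):ℝ) ≤ T * (ρ * x * L) := by
    calc _ ≤ x * L := by gcongr
      _ = 1 * (x * L) := by ring
      _ ≤ (ρ * T) * (x * L) := by gcongr
      _ = _ := by ring
  set K := 2 * d ^ 2 + 4 * d + 2 * C * d + 4 * C * d ^ 2 with hK
  have hK0 : 0 < K := by rw [hK]; positivity
  have l2 : ρ * x * L ≤ K * M ^ (33/100 - 23/10000000:ℝ) := by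
    rw [hK]; linarith
  have l3 : M ^ (33/100:ℝ) / 2 * M ^ (-(1/10000000):ℝ) ≤
      (2 * d * M ^ (1/10000000:ℝ)) * (K * M ^ (33/100 - 23/10000000:ℝ)) := by
    refine l1.trans ?_
    calc _ ≤ T * (K * M ^ (33/100 - 23/10000000:ℝ)) := by gcongr
      _ ≤ _ := by gcongr
  have l4 := mul_le_mul_of_nonneg_right l3 (show 0 ≤ 2 * M ^ (-(33/100) + 1/10000000:ℝ) by positivity)
  calc (1:ℝ) = M ^ (33/100 + -(1/10000000) + (-(33/100) + 1/10000000):ℝ) := by norm_num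
    _ = M ^ (33/100:ℝ) / 2 * M ^ (-(1/10000000):ℝ) * (2 * M ^ (-(33/100) + 1/10000000:ℝ)) := by
        rw [Real.rpow_add hM0 (33/100 + -(1/10000000)) , Real.rpow_add hM0 (33/100) (-(1/10000000))]; ring
    _ ≤ _ := l4
    _ = (4 * d * K) * (M ^ (1/10000000:ℝ) * M ^ (33/100 - 23/10000000:ℝ) * M ^ (-(33/100) + 1/10000000:ℝ)) := by ring
    _ = (4 * d * K) * M ^ (1/10000000 + (33/100 - 23/10000000) + (-(33/100) + 1/10000000):ℝ) := by
        rw [Real.rpow_add hM0 (1/10000000 + (33/100 - 23/10000000)), Real.rpow_add hM0 (1/10000000)]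
    _ = _ := by norm_num

theorem exists_good : ∀ᶠ m : ℕ in atTop, Squarefree m → ∃ n, Good m n ∧ 4 * n ^ 3 < m := by
  obtain ⟨C, hC, hmain⟩ := main_ineq
  obtain ⟨d, hd, hdiv⟩ := div_bound (1/10000000) (by norm_num)
  have ev1 := ev_small (4 * d * (2 * d ^ 2 + 4 * d + 2 * C * d + 4 * C * d ^ 2)) (21/10000000) (1/2)
    (by norm_num) (by norm_num)
  have ev2 := ev_small 4 (1/100) (1/2) (by norm_num) (by norm_num)
  filter_upwards [ev1, ev2, siegel_kr (1/10000000) (by norm_num), eventually_ge_atTop 10] with m h1 h2 h3 h10 hm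
  have hm10 : (10:ℝ) ≤ m := by exact_mod_cast h10
  have hm0 : (0:ℝ) < m := by linarith
  have hm1 : (1:ℝ) ≤ m := by linarith
  set x := ⌊(m:ℝ) ^ (33/100:ℝ)⌋₊ with hx
  set E := ⌊(m:ℝ) ^ (131/400:ℝ)⌋₊ with hE
  have hX1 : (1:ℝ) ≤ (m:ℝ) ^ (33/100:ℝ) := Real.one_le_rpow hm1 (by norm_num)
  have hx1 : (x:ℝ) ≤ (m:ℝ) ^ (33/100:ℝ) := Nat.floor_le (by positivity)
  have hx1' : (m:ℝ) ^ (33/100:ℝ) < x + 1 := Nat.lt_floor_add_one _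
  have hx0 : 0 < x := Nat.floor_pos.2 hX1
  have hx0' : (1:ℝ) ≤ x := by exact_mod_cast hx0
  have hxm : x ≤ m := by
    have : (x:ℝ) ≤ m := hx1.trans (by
      calc (m:ℝ) ^ (33/100:ℝ) ≤ (m:ℝ) ^ (1:ℝ) := Real.rpow_le_rpow_of_exponent_le hm1 (by norm_num)
        _ = m := Real.rpow_one _)
    exact_mod_cast this
  by_contra hcon
  push Not at hcon
  have hbad : ∀ n, n ≤ x → ¬ Good m n := by
    intro n hn hg
    have h4 := hcon n hg
    have hnx : (n:ℝ) ≤ (m:ℝ) ^ (33/100:ℝ) := le_trans (by exact_mod_cast hn) hx1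
    have : (m:ℝ) ≤ 4 * (n:ℝ) ^ 3 := by exact_mod_cast h4
    have h5 : (n:ℝ) ^ 3 ≤ (m:ℝ) ^ (99/100:ℝ) := by
      calc (n:ℝ) ^ 3 ≤ ((m:ℝ) ^ (33/100:ℝ)) ^ 3 := by gcongr
        _ = _ := by rw [← Real.rpow_natCast, ← Real.rpow_mul hm0.le]; norm_num
    have h6 : (m:ℝ) ^ (99/100:ℝ) = m * (m:ℝ) ^ (-(1/100):ℝ) := by
      nth_rewrite 2 [← Real.rpow_one (m:ℝ)]
      rw [← Real.rpow_add hm0]; norm_num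
    nlinarith
  obtain ⟨P, hPo, hmP⟩ : ∃ P, Odd P ∧ (m = P ∨ m = 2 * P) := by
    rcases Nat.even_or_odd m with he | ho
    · obtain ⟨P, rfl⟩ := he.two_dvd
      refine ⟨P, ?_, Or.inr rfl⟩
      by_contra hne
      rw [Nat.not_odd_iff_even] at hne
      obtain ⟨t, rfl⟩ := hne.two_dvd
      have := hm 2 ⟨t, by ring⟩
      simp at this
    · exact ⟨m, ho, Or.inl rfl⟩
  have hPm : P ∣ m := by
    rcases hmP with h | h
    · rw [h]
    · exact ⟨2, by rw [h]; ring⟩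
  have hP1 : 1 < P := by rcases hmP with h | h <;> omega
  have hPle : P ≤ m := by rcases hmP with h | h <;> omega
  have hPleR : (P:ℝ) ≤ m := by exact_mod_cast hPle
  have hR : ∀ n, 0 < n → n ≤ x → (n.divisors.card:ℝ) ≤ d * (m:ℝ) ^ (1/10000000:ℝ) := by
    intro n hn hnx
    refine (hdiv n hn.ne').trans ?_
    have : (n:ℝ) ≤ m := by exact_mod_cast hnx.trans hxm
    gcongr
  have hQ : 2 * P ≠ 0 := by omega
  have key := hmain m P x E _ hm (hm.squarefree_of_dvd hPm) hPo hP1 hmP hx0 hR hbad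
  have hT : (((2 * P).divisors.card : ℕ):ℝ) ≤ 2 * d * (m:ℝ) ^ (1/10000000:ℝ) := by
    refine (hdiv (2 * P) hQ).trans ?_
    have e : (((2 * P : ℕ)):ℝ) ^ (1/10000000:ℝ) ≤ 2 * (m:ℝ) ^ (1/10000000:ℝ) := by
      push_cast
      rw [Real.mul_rpow (by norm_num) (by positivity)]
      have h22 : (2:ℝ) ^ (1/10000000:ℝ) ≤ 2 := by
        calc (2:ℝ) ^ (1/10000000:ℝ) ≤ 2 ^ (1:ℝ) := Real.rpow_le_rpow_of_exponent_le (by norm_num) (by norm_num)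
          _ = 2 := Real.rpow_one _
      gcongr
    nlinarith
  have hT1 : (1:ℝ) ≤ (((2 * P).divisors.card : ℕ):ℝ) := by
    exact_mod_cast Finset.card_pos.2 ⟨1, Nat.one_mem_divisors.2 hQ⟩
  have fin := final_alg m C d (rho (2 * P)) x (Nat.sqrt x) ((2 * P).divisors.card) (d * (m:ℝ) ^ (1/10000000:ℝ))
    E ((E + 1 : ℕ):ℝ) (LS (kr (-(m:ℤ))) 1) P hm1 hC hd (by linarith) hx1 (Nat.cast_nonneg _) (sqrt_bounds x).1
    hT1 hT (by positivity) le_rfl (Nat.floor_le (by positivity)) (Nat.cast_nonneg _)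
    (by push_cast; exact (Nat.lt_floor_add_one _).le) (h3 hm) (rho_ge _ hQ) (Nat.cast_nonneg _) hPleR key
  linarith

end HB
end

section
open Finset
namespace HB

theorem not_sq (m : ℕ) (hm : Squarefree m) (h1 : 1 < m) (z : ℤ) : z ^ 2 ≠ m := by
  intro h
  have : z.natAbs * z.natAbs = m := by
    zify; rw [← h]; rw [← sq, sq_abs]
  have hu := hm z.natAbs (dvd_of_eq this)
  rw [Nat.isUnit_iff] at hu
  rw [hu] at this; omega

theorem pigeon (m n : ℕ) (hm : 0 < m) (hn : 0 < n) (b c : ℤ) :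
    ∃ x y z : ℤ, (x, y, z) ≠ (0, 0, 0) ∧ x ^ 2 ≤ m * n ∧ y ^ 2 ≤ n ∧ z ^ 2 ≤ m ∧
      (n:ℤ) ∣ x - b * y ∧ (m:ℤ) ∣ x - c * z := by
  have : NeZero m := ⟨hm.ne'⟩
  have : NeZero n := ⟨hn.ne'⟩
  set s := (range (Nat.sqrt (m * n) + 1) ×ˢ (range (Nat.sqrt n + 1) ×ˢ range (Nat.sqrt m + 1))) with hs
  set f : ℕ × ℕ × ℕ → ZMod n × ZMod m := fun p =>
    (((p.1 : ℤ) - b * (p.2.1 : ℤ) : ℤ), ((p.1 : ℤ) - c * (p.2.2 : ℤ) : ℤ)) with hf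
  have hcard : (Finset.univ : Finset (ZMod n × ZMod m)).card < s.card := by
    rw [hs, Finset.card_product, Finset.card_product, Finset.card_univ, Fintype.card_prod, ZMod.card, ZMod.card]
    simp only [card_range]
    have h1 := Nat.lt_succ_sqrt' (m * n)
    have h2 := Nat.lt_succ_sqrt' n
    have h3 := Nat.lt_succ_sqrt' m
    simp only [Nat.succ_eq_add_one] at h1 h2 h3
    set A := Nat.sqrt (m * n) + 1
    set B := Nat.sqrt n + 1
    set D := Nat.sqrt m + 1
    have h4 : (n * m) ^ 2 < (A * (B * D)) ^ 2 := by
      calc (n * m) ^ 2 = (m * n) * (n * m) := by ring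
        _ < A ^ 2 * (B ^ 2 * D ^ 2) := by
            apply Nat.mul_lt_mul_of_lt_of_le h1 _ (by positivity)
            exact Nat.mul_le_mul h2.le h3.le
        _ = _ := by ring
    exact lt_of_pow_lt_pow_left₀ 2 (Nat.zero_le _) h4
  obtain ⟨p, hp, q, hq, hne, heq⟩ := Finset.exists_ne_map_eq_of_card_lt_of_maps_to hcard
    (fun p _ => Finset.mem_coe.2 (Finset.mem_univ (f p)))
  obtain ⟨p1, p2, p3⟩ := p
  obtain ⟨q1, q2, q3⟩ := q
  simp only [hs, mem_product, mem_range] at hp hq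
  have bound : ∀ (a p q : ℕ), p < Nat.sqrt a + 1 → q < Nat.sqrt a + 1 → ((p:ℤ) - q) ^ 2 ≤ a := by
    intro a p q hp hq
    have h1 : ((Nat.sqrt a : ℕ):ℤ) ^ 2 ≤ a := by exact_mod_cast Nat.sqrt_le' a
    have h2 : (p:ℤ) ≤ Nat.sqrt a := by exact_mod_cast Nat.lt_succ_iff.1 hp
    have h3 : (q:ℤ) ≤ Nat.sqrt a := by exact_mod_cast Nat.lt_succ_iff.1 hq
    have h4 : (0:ℤ) ≤ p := Nat.cast_nonneg _
    have h5 : (0:ℤ) ≤ q := Nat.cast_nonneg _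
    refine le_trans (sq_le_sq' ?_ ?_) h1 <;> linarith
  simp only [hf, Prod.mk.injEq] at heq
  obtain ⟨e1, e2⟩ := heq
  rw [ZMod.intCast_eq_intCast_iff_dvd_sub] at e1 e2
  refine ⟨(q1:ℤ) - p1, (q2:ℤ) - p2, (q3:ℤ) - p3, ?_, ?_, ?_, ?_, ?_, ?_⟩
  · intro h
    simp only [Prod.mk.injEq] at h
    apply hne
    simp only [Prod.mk.injEq]
    omega
  · have := bound (m * n) q1 p1 hq.1 hp.1
    push_cast at this; exact this
  · exact bound n q2 p2 hq.2.1 hp.2.1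
  · exact bound m q3 p3 hq.2.2 hp.2.2
  · convert e1 using 1; ring
  · convert e2 using 1; ring

theorem legendre (m n : ℕ) (hm : Squarefree m) (hm1 : 1 < m) (hg : Good m n) :
    ∃ x y z t : ℤ, z ^ 2 + m * t ^ 2 ≠ 0 ∧ x ^ 2 + m * y ^ 2 = n * (z ^ 2 + m * t ^ 2) := by
  obtain ⟨hn, hn1, hcop, ⟨b, hb⟩, c, hc⟩ := hg
  obtain ⟨x, y, z, hne, hx, hy, hz, h1, h2⟩ := pigeon m n (by omega) (by omega) b c
  have hmn : IsCoprime (n:ℤ) (m:ℤ) := Nat.isCoprime_iff_coprime.2 (hcop.coprime_dvd_right ⟨2, by ring⟩)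
  have hdn : (n:ℤ) ∣ x ^ 2 + m * y ^ 2 - n * z ^ 2 := by
    obtain ⟨u, hu⟩ := h1
    obtain ⟨v, hv⟩ := hb
    exact ⟨u * (x + b * y) + v * y ^ 2 - z ^ 2, by linear_combination (x + b * y) * hu + y ^ 2 * hv⟩
  have hdm : (m:ℤ) ∣ x ^ 2 + m * y ^ 2 - n * z ^ 2 := by
    obtain ⟨u, hu⟩ := h2
    obtain ⟨v, hv⟩ := hc
    exact ⟨u * (x + c * z) + v * z ^ 2 + y ^ 2, by linear_combination (x + c * z) * hu + z ^ 2 * hv⟩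
  obtain ⟨k, hk⟩ := hmn.mul_dvd hdn hdm
  have hm0 : (0:ℤ) < m := by exact_mod_cast (by omega : 0 < m)
  have hn0 : (0:ℤ) < n := by exact_mod_cast (by omega : 0 < n)
  have hy' : y ^ 2 < n := lt_of_le_of_ne hy (not_sq n hn hn1 y)
  have hz' : z ^ 2 < m := lt_of_le_of_ne hz (not_sq m hm hm1 z)
  have hpos : 0 < (n:ℤ) * m := mul_pos hn0 hm0
  have hk1 : k < 2 := by
    by_contra h; push Not at h
    nlinarith [sq_nonneg z, mul_lt_mul_of_pos_left hy' hm0]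
  have hk0 : -1 < k := by
    by_contra h; push Not at h
    nlinarith [sq_nonneg x, sq_nonneg y, mul_lt_mul_of_pos_left hz' hn0, mul_nonneg hm0.le (sq_nonneg y)]
  interval_cases k
  · refine ⟨x, y, z, 0, ?_, by linear_combination hk⟩
    intro h0
    apply hne
    have hz0 : z = 0 := by nlinarith
    subst hz0
    have hx0 : x = 0 := by nlinarith [mul_nonneg hm0.le (sq_nonneg y)]
    subst hx0
    have hy0 : y = 0 := by nlinarith
    rw [hy0]
  · refine ⟨x, y, z, 1, ?_, by linear_combination hk⟩
    nlinarith [sq_nonneg z]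

end HB
end

section
open Finset
namespace HB

section ideal
variable {R : Type*} [CommRing R] [IsDedekindDomain R] [CharZero R]

theorem dvd_of_quad (y g T' N' : R) (h : y ^ 2 - g * T' * y + g ^ 2 * N' = 0) : g ∣ y := by
  by_cases hg : g = 0
  · subst hg
    have : y ^ 2 = 0 := by linear_combination h
    rw [pow_eq_zero_iff (by norm_num)] at this
    rw [this]
  · let F := FractionRing R
    have hg' : algebraMap R F g ≠ 0 := by
      intro h0; exact hg ((IsFractionRing.injective R F) (by rw [h0, map_zero]))
    have hintg : IsIntegral R (algebraMap R F y / algebraMap R F g) := by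
      refine ⟨Polynomial.X ^ 2 - Polynomial.C T' * Polynomial.X + Polynomial.C N', ?_, ?_⟩
      · monicity!
      · simp only [Polynomial.eval₂_add, Polynomial.eval₂_sub, Polynomial.eval₂_mul, Polynomial.eval₂_pow,
          Polynomial.eval₂_X, Polynomial.eval₂_C]
        have h2 := congrArg (algebraMap R F) h
        simp only [map_add, map_sub, map_mul, map_pow, map_zero] at h2
        have e : (algebraMap R F y / algebraMap R F g) ^ 2 - algebraMap R F T' * (algebraMap R F y / algebraMap R F g)
            + algebraMap R F N' = ((algebraMap R F y) ^ 2 - algebraMap R F g * algebraMap R F T' * algebraMap R F y +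
              (algebraMap R F g) ^ 2 * algebraMap R F N') / (algebraMap R F g) ^ 2 := by
          rw [eq_div_iff (pow_ne_zero 2 hg')]
          have e2 := div_mul_cancel₀ (algebraMap R F y) hg'
          set q := algebraMap R F y / algebraMap R F g
          rw [← e2]; ring
        rw [e, h2, zero_div]
    obtain ⟨r, hr⟩ := IsIntegrallyClosed.isIntegral_iff.1 hintg
    refine ⟨r, IsFractionRing.injective R F ?_⟩
    rw [map_mul, hr, mul_div_cancel₀ _ hg']

theorem norm_ideal (σ : R ≃+* R) (hσ : ∀ x, σ (σ x) = x) (hfix : ∀ x, σ x = x → ∃ z : ℤ, x = z)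
    (I : Ideal R) : ∃ g : ℤ, I * I.map σ = Ideal.span {(g : R)} := by
  set J := (I * I.map σ).comap (Int.castRingHom R) with hJ
  obtain ⟨g, hg⟩ := (IsPrincipalIdealRing.principal J).principal
  have hmem : ∀ z : ℤ, (z : R) ∈ I * I.map σ → g ∣ z := by
    intro z hz
    have : z ∈ J := hz
    rw [hg] at this
    exact Ideal.mem_span_singleton.1 this
  refine ⟨g, le_antisymm ?_ ?_⟩
  · rw [Ideal.mul_le]
    intro α hα β' hβ'
    obtain ⟨β, hβ, rfl⟩ := (Ideal.mem_map_of_equiv σ β').1 hβ'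
    have hσα := Ideal.mem_map_of_mem (σ : R →+* R) hα
    have hσβ := Ideal.mem_map_of_mem (σ : R →+* R) hβ
    obtain ⟨a, ha⟩ := hfix (α * σ α) (by rw [map_mul, hσ, mul_comm])
    obtain ⟨b, hb⟩ := hfix (β * σ β) (by rw [map_mul, hσ, mul_comm])
    obtain ⟨t, ht⟩ := hfix (α * σ β + β * σ α) (by rw [map_add, map_mul, map_mul, hσ, hσ]; ring)
    obtain ⟨a', ha'⟩ := hmem a (ha ▸ Ideal.mul_mem_mul hα hσα)
    obtain ⟨b', hb'⟩ := hmem b (hb ▸ Ideal.mul_mem_mul hβ hσβ)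
    obtain ⟨t', ht'⟩ := hmem t (ht ▸ Ideal.add_mem _ (Ideal.mul_mem_mul hα hσβ) (Ideal.mul_mem_mul hβ hσα))
    rw [Ideal.mem_span_singleton]
    apply dvd_of_quad _ _ (t' : R) (a' * b' : R)
    rw [ha'] at ha; rw [hb'] at hb; rw [ht'] at ht
    push_cast at ha hb ht
    linear_combination (α * σ β) * ht - β * σ β * ha - g * a' * hb
  · rw [Ideal.span_singleton_le_iff_mem]
    have : g ∈ J := by rw [hg]; exact Ideal.mem_span_singleton_self g
    exact this

theorem int_dvd (σ : R ≃+* R) (hfix : ∀ x, σ x = x → ∃ z : ℤ, x = z) (a b : ℤ) (h : (a : R) ∣ b) : a ∣ b := by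
  by_cases ha : a = 0
  · subst ha
    simp only [Int.cast_zero, zero_dvd_iff, Int.cast_eq_zero] at h
    rw [h]
  obtain ⟨r, hr⟩ := h
  have : σ r = r := by
    have h2 := congrArg σ hr
    simp only [map_intCast, map_mul] at h2
    have ha' : (a : R) ≠ 0 := Int.cast_ne_zero.2 ha
    exact mul_left_cancel₀ ha' (by rw [← h2, hr])
  obtain ⟨z, rfl⟩ := hfix r this
  exact ⟨z, by exact_mod_cast hr⟩

theorem sq_dvd_aux (m : ℕ) (hm : Squarefree m) (w s : ℤ) (h : w ^ 2 = m * s) : (m : ℤ) ∣ w := by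
  have h2 : (m : ℤ) ∣ w ^ 2 := ⟨s, h⟩
  have h3 : m ∣ w.natAbs ^ 2 := by
    rw [← Int.natAbs_pow]; exact Int.natCast_dvd.1 h2
  exact Int.natCast_dvd.2 ((hm.dvd_pow_iff_dvd (by norm_num)).1 h3)

set_option maxHeartbeats 1000000 in
theorem main_ideal (σ : R ≃+* R) (hσ : ∀ x, σ (σ x) = x) (hfix : ∀ x, σ x = x → ∃ z : ℤ, x = z)
    (m n : ℕ) (θ : R) (hθ : θ ^ 2 = -m) (hσθ : σ θ = -θ)
    (h6 : ∀ I : Ideal R, ∃ x, I ^ 6 = Ideal.span {x}) (hm : Squarefree m) (hm1 : 1 < m) (hg : Good m n) :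
    m ≤ 4 * n ^ 3 := by
  obtain ⟨x, y, z, t, hzt, hxy⟩ := legendre m n hm hm1 hg
  obtain ⟨hn, hn1, hcop, ⟨b, hb⟩, -⟩ := hg
  have hn0 : (n : R) ≠ 0 := Nat.cast_ne_zero.2 (by omega)
  set a : Ideal R := Ideal.span {(n : R), b + θ} with ha
  have hσa : a.map σ = Ideal.span {(n : R), b - θ} := by
    rw [ha, Ideal.map_span, Set.image_pair]
    congr 2
    · simp
    · simp [hσθ, sub_eq_add_neg]
  -- norm of a
  have hcopb : IsCoprime (n : ℤ) (2 * b) := by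
    have h2m : IsCoprime (n : ℤ) (2 * m) := by
      have := Nat.isCoprime_iff_coprime.2 hcop
      push_cast at this; exact this
    have hmn : IsCoprime (n : ℤ) m := h2m.of_mul_right_right
    have h2 : IsCoprime (n : ℤ) 2 := h2m.of_mul_right_left
    obtain ⟨k, hk⟩ := hb
    have : IsCoprime (n : ℤ) (b ^ 2) := by
      have e : b ^ 2 = -m + n * k := by linear_combination hk
      rw [e]
      exact (IsCoprime.neg_right hmn).add_mul_left_right k
    exact h2.mul_right ((IsCoprime.pow_right_iff (by norm_num)).1 this)
  have haa : a * a.map σ = Ideal.span {(n : R)} := by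
    rw [hσa, ha]
    apply le_antisymm
    · rw [Ideal.mul_le]
      intro p hp q hq
      rw [Ideal.mem_span_pair] at hp hq
      obtain ⟨p1, p2, rfl⟩ := hp
      obtain ⟨q1, q2, rfl⟩ := hq
      rw [Ideal.mem_span_singleton]
      obtain ⟨k, hk⟩ := hb
      have hk' : (b : R) ^ 2 + m = n * k := by exact_mod_cast congrArg (Int.cast : ℤ → R) hk
      refine ⟨p1 * q1 * n + p1 * q2 * (b - θ) + p2 * q1 * (b + θ) + p2 * q2 * k, ?_⟩
      linear_combination p2 * q2 * hk' - p2 * q2 * hθ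
    · rw [Ideal.span_singleton_le_iff_mem]
      obtain ⟨u, v, huv⟩ := hcopb
      have huv' : (u : R) * n + v * (2 * b) = 1 := by exact_mod_cast congrArg (Int.cast : ℤ → R) huv
      have m1 : (n : R) ∈ Ideal.span {(n : R), b + θ} := Ideal.subset_span (by simp)
      have m2 : (b + θ : R) ∈ Ideal.span {(n : R), b + θ} := Ideal.subset_span (by simp)
      have m3 : (n : R) ∈ Ideal.span {(n : R), b - θ} := Ideal.subset_span (by simp)
      have m4 : (b - θ : R) ∈ Ideal.span {(n : R), b - θ} := Ideal.subset_span (by simp)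
      have e : (n : R) = u * (n * n) + v * (n * (b - θ) + (b + θ) * n) := by linear_combination -n * huv'
      have key := Ideal.add_mem _ (Ideal.mul_mem_left _ (u : R) (Ideal.mul_mem_mul m1 m3))
        (Ideal.mul_mem_left _ (v : R) (Ideal.add_mem _ (Ideal.mul_mem_mul m1 m4) (Ideal.mul_mem_mul m2 m3)))
      rwa [← e] at key
  -- genus
  set U : R := x + y * θ with hU
  set W : R := z + t * θ with hW
  have hσU : σ U = x - y * θ := by simp [hU, hσθ, sub_eq_add_neg]
  have hσW : σ W = z - t * θ := by simp [hW, hσθ, sub_eq_add_neg]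
  have hNU : U * σ U = n * (W * σ W) := by
    rw [hσU, hσW, hU, hW]
    have : (x : R) ^ 2 + m * y ^ 2 = n * (z ^ 2 + m * t ^ 2) := by exact_mod_cast congrArg (Int.cast : ℤ → R) hxy
    linear_combination this + (n * t ^ 2 - y ^ 2) * hθ
  have hWW : W * σ W ≠ 0 := by
    have : W * σ W = ((z ^ 2 + m * t ^ 2 : ℤ) : R) := by
      rw [hσW, hW]; push_cast; linear_combination (- t ^ 2) * hθ
    rw [this]; exact Int.cast_ne_zero.2 hzt
  have hW0 : W ≠ 0 := left_ne_zero_of_mul hWW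
  have hUU : U * σ U ≠ 0 := by rw [hNU]; exact mul_ne_zero hn0 hWW
  have hU0 : U ≠ 0 := left_ne_zero_of_mul hUU
  have hσU0 : σ U ≠ 0 := right_ne_zero_of_mul hUU
  set B : Ideal R := Ideal.span {U} ⊔ a * Ideal.span {W} with hB
  have hσB : B.map σ = Ideal.span {σ U} ⊔ a.map σ * Ideal.span {σ W} := by
    rw [hB, Ideal.map_sup, Ideal.map_mul, Ideal.map_span σ {U}, Ideal.map_span σ {W}, Set.image_singleton, Set.image_singleton]
  have hB2 : a * Ideal.span {W} * B.map σ = Ideal.span {σ U} * B := by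
    rw [hσB, hB, Ideal.mul_sup, Ideal.mul_sup]
    have e1 : a * Ideal.span {W} * (a.map σ * Ideal.span {σ W}) = Ideal.span {σ U} * Ideal.span {U} := by
      rw [mul_mul_mul_comm, haa, Ideal.span_singleton_mul_span_singleton, Ideal.span_singleton_mul_span_singleton,
        Ideal.span_singleton_mul_span_singleton, ← hNU, mul_comm U]
    rw [e1, sup_comm, mul_comm (a * _)]
  obtain ⟨g, hg⟩ := norm_ideal σ hσ hfix B
  have hB3 : a * Ideal.span {W * g} = Ideal.span {σ U} * B ^ 2 := by
    rw [sq, ← mul_assoc, ← hB2, mul_assoc, mul_comm (B.map σ), hg, mul_assoc, Ideal.span_singleton_mul_span_singleton]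
  have hBne : B ≠ ⊥ := by
    intro h
    have : U ∈ B := (le_sup_left : _ ≤ B) (Ideal.mem_span_singleton_self U)
    rw [h] at this
    exact hU0 this
  have hWg : W * g ≠ 0 := by
    intro h
    rw [h, Ideal.span_singleton_eq_bot.2 rfl, Ideal.mul_bot] at hB3
    have := hB3.symm
    rw [← Ideal.zero_eq_bot, mul_eq_zero] at this
    rcases this with h | h
    · rw [Ideal.zero_eq_bot, Ideal.span_singleton_eq_bot] at h; exact hσU0 h
    · exact hBne (eq_zero_of_pow_eq_zero h)
  obtain ⟨β, hβ⟩ := h6 B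
  have hcube : a ^ 3 * Ideal.span {(W * g) ^ 3} = Ideal.span {σ U ^ 3 * β} := by
    rw [← Ideal.span_singleton_pow, ← mul_pow, hB3, mul_pow, ← pow_mul, hβ, Ideal.span_singleton_pow,
      Ideal.span_singleton_mul_span_singleton]
  obtain ⟨γ, hγ⟩ : ∃ γ, a ^ 3 = Ideal.span {γ} := by
    have : σ U ^ 3 * β ∈ Ideal.span {(W * g) ^ 3} := by
      have h1 : σ U ^ 3 * β ∈ a ^ 3 * Ideal.span {(W * g) ^ 3} := by
        rw [hcube]; exact Ideal.mem_span_singleton_self _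
      exact (Ideal.mul_le_right (I := a ^ 3) (J := Ideal.span {(W * g) ^ 3})) h1
    obtain ⟨γ, hγ⟩ := Ideal.mem_span_singleton.1 this
    refine ⟨γ, ?_⟩
    rw [hγ, mul_comm _ γ, ← Ideal.span_singleton_mul_span_singleton] at hcube
    refine mul_right_cancel₀ ?_ hcube
    rw [Ideal.zero_eq_bot, Ne, Ideal.span_singleton_eq_bot]
    exact pow_ne_zero _ hWg
  -- norm of γ
  obtain ⟨N, hN⟩ := hfix (γ * σ γ) (by rw [map_mul, hσ, mul_comm])
  have hNN : Ideal.span {(N : R)} = Ideal.span {((n ^ 3 : ℤ) : R)} := by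
    have h1 : (a * a.map σ) ^ 3 = Ideal.span {γ * σ γ} := by
      rw [mul_pow, ← Ideal.map_pow, hγ, Ideal.map_span, Set.image_singleton, Ideal.span_singleton_mul_span_singleton]
    rw [← hN, ← h1, haa, Ideal.span_singleton_pow]; push_cast; rfl
  have hd1 : N ∣ (n : ℤ) ^ 3 := by
    apply int_dvd σ hfix
    exact Ideal.span_singleton_le_span_singleton.1 hNN.ge
  have hd2 : (n : ℤ) ^ 3 ∣ N := by
    apply int_dvd σ hfix
    exact Ideal.span_singleton_le_span_singleton.1 hNN.le
  have hNabs := Int.natAbs_eq_of_dvd_dvd hd1 hd2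
  have hNle : N ≤ (n : ℤ) ^ 3 := Int.le_of_dvd (by positivity) hd1
  obtain ⟨T, hT⟩ := hfix (γ + σ γ) (by rw [map_add, hσ, add_comm])
  obtain ⟨w, hw⟩ := hfix ((γ - σ γ) * θ) (by rw [map_mul, map_sub, hσ, hσθ]; ring)
  have hm0 : 0 < (m : ℤ) := by exact_mod_cast (by omega : 0 < m)
  have hws : w ^ 2 = m * (4 * N - T ^ 2) := by
    have : (w : R) ^ 2 = m * (4 * N - T ^ 2) := by
      rw [← hw, ← hN, ← hT]
      linear_combination (γ - σ γ) ^ 2 * hθ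
    exact_mod_cast this
  obtain ⟨v, hv⟩ := sq_dvd_aux m hm _ _ hws
  have h4 : 4 * N = T ^ 2 + m * v ^ 2 := by
    rw [hv] at hws
    have : (m : ℤ) * (m * v ^ 2) = m * (4 * N - T ^ 2) := by linear_combination hws
    have := mul_left_cancel₀ hm0.ne' this
    linear_combination -this
  by_cases hv0 : v = 0
  · exfalso
    rw [hv0, mul_zero] at hv
    rw [hv, Int.cast_zero] at hw
    have hθ0 : θ ≠ 0 := by
      intro h0
      rw [h0] at hθ
      have : (m : R) = 0 := by linear_combination hθ
      rw [Nat.cast_eq_zero] at this; omega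
    have hfγ : σ γ = γ := by
      have := (mul_eq_zero.1 hw).resolve_right hθ0
      linear_combination -this
    obtain ⟨e, he⟩ := hfix γ hfγ
    have hNe : N = e ^ 2 := by
      rw [hfγ, he] at hN
      have : (N : R) = (e : R) ^ 2 := by rw [← hN]; ring
      exact_mod_cast this
    rw [hNe, Int.natAbs_pow, Int.natAbs_pow, Int.natAbs_natCast] at hNabs
    -- e^2 = n^3
    have hne : n ∣ e.natAbs := (hn.dvd_pow_iff_dvd (n := 2) (by norm_num)).1 ⟨n ^ 2, by rw [hNabs]; ring⟩
    obtain ⟨k, hk⟩ := hne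
    rw [hk] at hNabs
    have : n ^ 2 * (k * k) = n ^ 2 * n := by linarith [hNabs, mul_pow n k 2]
    have := Nat.eq_of_mul_eq_mul_left (by positivity) this
    have hu := hn k ⟨1, by rw [this]; ring⟩
    rw [Nat.isUnit_iff] at hu
    rw [hu] at this; omega
  · have : 1 ≤ v ^ 2 := by
      have := sq_pos_of_ne_zero hv0; omega
    have : (m : ℤ) ≤ 4 * n ^ 3 := by nlinarith [sq_nonneg T]
    exact_mod_cast this

end ideal
end HB
end

section
open Finset
namespace HB
open NumberField

theorem card_le_of_pow {F : Type*} [Field F] [Finite F] (N : ℕ) (hN : 1 < N) (h : ∀ x : F, x ^ N = x) :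
    Nat.card F ≤ N := by
  classical
  have := Fintype.ofFinite F
  set p : Polynomial F := Polynomial.X ^ N - Polynomial.X with hp
  have hd : p.natDegree = N := FiniteField.X_pow_card_sub_X_natDegree_eq F hN
  have hp0 : p ≠ 0 := FiniteField.X_pow_card_sub_X_ne_zero F hN
  rw [Nat.card_eq_fintype_card, ← Finset.card_univ]
  calc _ ≤ p.roots.toFinset.card := by
        apply Finset.card_le_card
        intro x _
        rw [Multiset.mem_toFinset, Polynomial.mem_roots hp0]
        simp [hp, h x]
    _ ≤ p.natDegree := (Multiset.toFinset_card_le _).trans (Polynomial.card_roots' p)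
    _ = N := hd

variable {k K : Type*} [Field k] [Field K] [NumberField k] [NumberField K] [Algebra k K] [IsGalois k K]

theorem cube_principal (h3 : Monoid.exponent (ClassGroup (𝓞 K)) ∣ 3) (I : Ideal (𝓞 K)) :
    ∃ x, I ^ 3 = Ideal.span {x} := by
  by_cases hI : I = ⊥
  · exact ⟨0, by rw [hI, Ideal.span_singleton_eq_bot.2 rfl]; exact Ideal.bot_pow (by norm_num)⟩
  have hI' : I ∈ nonZeroDivisors (Ideal (𝓞 K)) := mem_nonZeroDivisors_of_ne_zero hI
  have h := Monoid.exponent_dvd_iff_forall_pow_eq_one.1 h3 (ClassGroup.mk0 ⟨I, hI'⟩)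
  rw [← map_pow, ClassGroup.mk0_eq_one_iff] at h
  obtain ⟨x, hx⟩ := h.principal
  exact ⟨x, hx⟩

theorem prime_six (hG : ∀ g : K ≃ₐ[k] K, g * g = 1) (h3 : Monoid.exponent (ClassGroup (𝓞 K)) ∣ 3)
    (p : Ideal (𝓞 k)) [hp : p.IsMaximal] : ∃ x, p ^ 6 = Ideal.span {x} := by
  obtain ⟨P, hP, hPp⟩ := Ideal.exists_maximal_ideal_liesOver_of_isIntegral (S := 𝓞 K) p
  have hPb : P ≠ ⊥ := NeZero.ne P
  have hfin : Finite (𝓞 K ⧸ P) := Ring.HasFiniteQuotients.finiteQuotient hPb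
  obtain ⟨σ, hσ⟩ := IsArithFrobAt.exists_of_isInvariant (𝓞 k) (K ≃ₐ[k] K) P
  have hpu : P.under (𝓞 k) = p := hPp.over.symm
  set q := Nat.card (𝓞 k ⧸ p) with hq
  have hfr : ∀ x : 𝓞 K, Ideal.Quotient.mk P (σ • x) = Ideal.Quotient.mk P x ^ q := by
    intro x
    have := hσ.mk_apply x
    rw [hpu] at this
    exact this
  have hpow : ∀ x : 𝓞 K ⧸ P, x ^ (q ^ 2) = x := by
    intro x
    obtain ⟨x, rfl⟩ := Ideal.Quotient.mk_surjective x
    rw [sq, pow_mul, ← hfr, ← hfr, ← mul_smul, hG, one_smul]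
  obtain ⟨s, hs⟩ := Ideal.exists_relNorm_eq_pow_of_isPrime P p
  have hfink : Finite (𝓞 k ⧸ p) := Ring.HasFiniteQuotients.finiteQuotient (NeZero.ne p)
  have hq1 : 1 < q := by
    rw [hq]
    have := Ideal.Quotient.nontrivial_iff.2 hp.ne_top
    exact Finite.one_lt_card
  have hcard : Nat.card (𝓞 K ⧸ P) ≤ q ^ 2 := by
    let := Ideal.Quotient.field P
    exact card_le_of_pow (q ^ 2) (by nlinarith) hpow
  have hcard1 : 1 < Nat.card (𝓞 K ⧸ P) := by
    have := Ideal.Quotient.nontrivial_iff.2 hP.ne_top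
    exact Finite.one_lt_card
  have habs := Ideal.absNorm_relNorm (𝓞 k) (𝓞 K) P
  rw [hs, map_pow, Ideal.absNorm_apply, Ideal.absNorm_apply] at habs
  change q ^ s = Nat.card (𝓞 K ⧸ P) at habs
  have hs2 : s ≤ 2 := by
    rw [← habs] at hcard
    exact (Nat.pow_le_pow_iff_right hq1).1 hcard
  have hs0 : s ≠ 0 := by
    rintro rfl
    rw [pow_zero] at habs; omega
  obtain ⟨x, hx⟩ := cube_principal h3 P
  have h1 : p ^ (3 * s) = Ideal.span {Algebra.intNorm (𝓞 k) (𝓞 K) x} := by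
    rw [← Ideal.relNorm_singleton, ← hx, map_pow, hs, ← pow_mul, mul_comm]
  obtain ⟨c, hc⟩ : 3 * s ∣ 6 := by
    have : s = 1 ∨ s = 2 := by omega
    rcases this with rfl | rfl <;> norm_num
  rw [hc, pow_mul, h1, Ideal.span_singleton_pow]
  exact ⟨_, rfl⟩

theorem ideal_six (hG : ∀ g : K ≃ₐ[k] K, g * g = 1) (h3 : Monoid.exponent (ClassGroup (𝓞 K)) ∣ 3)
    (I : Ideal (𝓞 k)) : ∃ x, I ^ 6 = Ideal.span {x} := by
  induction I using UniqueFactorizationMonoid.induction_on_prime with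
  | h₁ => exact ⟨0, by rw [Ideal.span_singleton_eq_bot.2 rfl]; exact Ideal.bot_pow (by norm_num)⟩
  | h₂ I hI =>
    rw [Ideal.isUnit_iff] at hI
    exact ⟨1, by rw [hI, Ideal.top_pow, Ideal.span_singleton_one]⟩
  | h₃ a p ha hp ih =>
    obtain ⟨x, hx⟩ := ih
    have hpp := Ideal.isPrime_of_prime hp
    have := hpp.isMaximal hp.ne_zero
    obtain ⟨y, hy⟩ := prime_six hG h3 p
    exact ⟨y * x, by rw [mul_pow, hx, hy, Ideal.span_singleton_mul_span_singleton]⟩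

end HB
end

section
open Finset
namespace HB
open NumberField

theorem quad_bound {k : Type*} [Field k] [NumberField k] [IsGalois ℚ k] (θ : k) (m n : ℕ)
    (hθ : θ ^ 2 = -m) (hext : ∀ g h : k ≃ₐ[ℚ] k, g θ = h θ → g = h)
    (h6 : ∀ I : Ideal (𝓞 k), ∃ x, I ^ 6 = Ideal.span {x}) (hm : Squarefree m) (hm1 : 1 < m) (hg : Good m n) :
    m ≤ 4 * n ^ 3 := by
  have hpm : ∀ g : k ≃ₐ[ℚ] k, g θ = θ ∨ g θ = -θ := by
    intro g
    apply sq_eq_sq_iff_eq_or_eq_neg.1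
    rw [← map_pow, hθ, map_neg, map_natCast]
  have hex : ∃ s : k ≃ₐ[ℚ] k, s θ ≠ θ := by
    by_contra! hcon
    obtain ⟨r, hr⟩ := (IsGalois.mem_range_algebraMap_iff_fixed θ).2 hcon
    have : ((r ^ 2 : ℚ) : k) = ((-m : ℚ) : k) := by
      rw [← hr] at hθ
      rw [eq_ratCast] at hθ
      push_cast; exact hθ
    have h2 : r ^ 2 = -m := Rat.cast_injective this
    have h3 : (1 : ℚ) < m := by exact_mod_cast hm1
    nlinarith [sq_nonneg r]
  obtain ⟨s, hs⟩ := hex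
  have hs' : s θ = -θ := (hpm s).resolve_left hs
  have hss : s * s = 1 := by
    apply hext
    rw [AlgEquiv.mul_apply, hs', map_neg, hs', neg_neg, AlgEquiv.one_apply]
  have hθi : IsIntegral ℤ θ := by
    apply IsIntegral.of_pow (n := 2) (by norm_num)
    rw [hθ]
    have h := isIntegral_algebraMap (R := ℤ) (A := k) (x := (-m : ℤ))
    simpa using h
  refine main_ideal (R := 𝓞 k) (RingOfIntegers.mapRingEquiv (s : k ≃+* k)) ?_ ?_ m n ⟨θ, hθi⟩ ?_ ?_ h6 hm hm1 hg
  · intro x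
    apply RingOfIntegers.ext
    have := DFunLike.congr_fun hss (x : k)
    exact this
  · intro x hx
    have hx' : s (x : k) = x := congrArg (fun y : 𝓞 k => (y : k)) hx
    have hall : ∀ g : k ≃ₐ[ℚ] k, g (x : k) = x := by
      intro g
      rcases hpm g with h | h
      · rw [hext g 1 (by rw [h, AlgEquiv.one_apply]), AlgEquiv.one_apply]
      · rw [hext g s (by rw [h, hs']), hx']
    obtain ⟨r, hr⟩ := (IsGalois.mem_range_algebraMap_iff_fixed (x : k)).2 hall
    have hri : IsIntegral ℤ r := by
      have h1 : IsIntegral ℤ (algebraMap ℚ k r) := by rw [hr]; exact RingOfIntegers.isIntegral_coe x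
      exact (isIntegral_algebraMap_iff (algebraMap ℚ k).injective).1 h1
    obtain ⟨z, hz⟩ := IsIntegrallyClosed.isIntegral_iff.1 hri
    refine ⟨z, RingOfIntegers.ext ?_⟩
    rw [← hr, ← hz]
    simp
  · apply RingOfIntegers.ext
    have e : ((-(m : 𝓞 k) : 𝓞 k) : k) = -(m : k) := by simp
    rw [e]
    exact hθ
  · apply RingOfIntegers.ext
    exact hs'

theorem field_bound {K : Type*} [Field K] [NumberField K] [IsGalois ℚ K]
    (hG : ∀ g : K ≃ₐ[ℚ] K, g * g = 1) (h3 : Monoid.exponent (ClassGroup (𝓞 K)) ∣ 3) (θ : K) (m n : ℕ)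
    (hθ : θ ^ 2 = -m) (hm : Squarefree m) (hm1 : 1 < m) (hg : Good m n) :
    m ≤ 4 * n ^ 3 := by
  have hinv : ∀ g : K ≃ₐ[ℚ] K, g⁻¹ = g := fun g => inv_eq_of_mul_eq_one_right (hG g)
  have hcomm : IsMulCommutative (K ≃ₐ[ℚ] K) := ⟨⟨fun a b => by
    rw [← hinv (a * b), mul_inv_rev, hinv, hinv]⟩⟩
  have : IsAbelianGalois ℚ K := {}
  have hmem : θ ∈ IntermediateField.adjoin ℚ {θ} := IntermediateField.mem_adjoin_simple_self ℚ θ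
  have : IsAbelianGalois ℚ (IntermediateField.adjoin ℚ {θ}) := IsAbelianGalois.tower_bot ℚ _ K
  refine quad_bound (k := IntermediateField.adjoin ℚ {θ}) ⟨θ, hmem⟩ m n (Subtype.ext (by simpa using hθ)) ?_ ?_
    hm hm1 hg
  · intro g h hgh
    have : g.toAlgHom = h.toAlgHom := by
      apply IntermediateField.adjoin_algHom_ext
      rintro x hx
      rw [Set.mem_singleton_iff] at hx
      subst hx
      exact hgh
    ext x
    rw [show g x = h x from DFunLike.congr_fun this x]
  · apply ideal_six (K := K) _ h3
    intro g
    apply AlgEquiv.restrictScalars_injective ℚ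
    exact hG (g.restrictScalars ℚ)

end HB
end

section
open Finset
namespace HB
open NumberField

/-- the sign character of the group of order two -/
def sgn2 : Multiplicative (ZMod 2) →* ℤˣ where
  toFun z := if z = 1 then 1 else -1
  map_one' := by simp
  map_mul' := by decide

theorem exists_char {G : Type*} [Group G] {n : ℕ} (e : G ≃* (Fin n → Multiplicative (ZMod 2))) (s t : G)
    (hs : s ≠ 1) (ht : t ≠ 1) : ∃ χ : G →* ℤˣ, χ s = -1 ∧ χ t = -1 := by
  let c (i : Fin n) : G →* ℤˣ := sgn2.comp ((Pi.evalMonoidHom _ i).comp e.toMonoidHom)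
  have key : ∀ g : G, g ≠ 1 → ∃ i, c i g = -1 := by
    intro g hg
    have h1 : e g ≠ 1 := by simpa using hg
    obtain ⟨i, hi⟩ := Function.ne_iff.1 h1
    refine ⟨i, ?_⟩
    change (if e g i = 1 then (1 : ℤˣ) else -1) = -1
    exact if_neg hi
  obtain ⟨i, hi⟩ := key s hs
  obtain ⟨j, hj⟩ := key t ht
  rcases Int.units_eq_one_or (c i t) with h1 | h1
  · rcases Int.units_eq_one_or (c j s) with h2 | h2
    · exact ⟨c i * c j, by simp [hi, h2], by simp [hj, h1]⟩
    · exact ⟨c j, h2, hj⟩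
  · exact ⟨c i, hi, h1⟩

variable {K : Type*} [Field K] [NumberField K] [IsGalois ℚ K]

theorem exists_eigen (χ : (K ≃ₐ[ℚ] K) →* ℤˣ) :
    ∃ θ : K, θ ≠ 0 ∧ ∀ g : K ≃ₐ[ℚ] K, g θ = ((χ g : ℤ) : K) * θ := by
  classical
  have hli := linearIndependent_monoidHom K K
  let f : (K ≃ₐ[ℚ] K) → (K →* K) := fun g => (g : K →* K)
  have hf : Function.Injective f := by
    intro g h hgh
    ext x
    exact DFunLike.congr_fun hgh x
  have hli2 := Fintype.linearIndependent_iff.1 (hli.comp f hf) (fun g => ((χ g : ℤ) : K))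
  have hx : ∃ x : K, ∑ g : K ≃ₐ[ℚ] K, ((χ g : ℤ) : K) * g x ≠ 0 := by
    by_contra! hcon
    have := hli2 (by
      funext x
      simpa [f] using hcon x) 1
    simp at this
  obtain ⟨x, hx⟩ := hx
  refine ⟨_, hx, fun h => ?_⟩
  rw [map_sum, Finset.mul_sum]
  refine Fintype.sum_equiv (Equiv.mulLeft h) _ _ (fun g => ?_)
  simp only [Equiv.coe_mulLeft, map_mul, map_intCast, AlgEquiv.mul_apply]
  have : ((χ h : ℤ) : K) * (χ h : ℤ) = 1 := by
    rcases Int.units_eq_one_or (χ h) with h1 | h1 <;> simp [h1]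
  push_cast
  linear_combination (-((χ g : ℤ) : K) * h (g x)) * this

theorem exists_theta {n : ℕ} (e : (K ≃ₐ[ℚ] K) ≃* (Fin n → Multiplicative (ZMod 2))) (φ : K →+* ℂ)
    (him : ∃ x, (φ x).im ≠ 0) (s : K ≃ₐ[ℚ] K) (hs : s ≠ 1) :
    ∃ (θ : K) (m : ℕ), Squarefree m ∧ θ ^ 2 = -m ∧ s θ ≠ θ := by
  obtain ⟨τ0, hτ0⟩ := NumberField.ComplexEmbedding.exists_comp_symm_eq_of_comp_eq (k := ℚ) φ
    ((starRingEnd ℂ).comp φ) (Subsingleton.elim _ _)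
  set τ := τ0.symm with hτdef
  have hτ : ∀ x, φ (τ x) = (starRingEnd ℂ) (φ x) := fun x => RingHom.congr_fun hτ0 x
  have hτ1 : τ ≠ 1 := by
    intro h
    obtain ⟨x, hx⟩ := him
    have := hτ x
    rw [h, AlgEquiv.one_apply] at this
    exact hx (Complex.conj_eq_iff_im.1 this.symm)
  obtain ⟨χ, h1, h2⟩ := exists_char e s τ hs hτ1
  obtain ⟨θ, hθ0, hθ⟩ := exists_eigen χ
  have hfix : ∀ g : K ≃ₐ[ℚ] K, g (θ ^ 2) = θ ^ 2 := by
    intro g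
    rw [map_pow, hθ]
    rcases Int.units_eq_one_or (χ g) with h1 | h1 <;> simp [h1]
  obtain ⟨r, hr⟩ := (IsGalois.mem_range_algebraMap_iff_fixed (θ ^ 2)).2 hfix
  rw [eq_ratCast] at hr
  have hr0 : r < 0 := by
    have h3 := hτ θ
    rw [hθ, h2] at h3
    have h4 : (starRingEnd ℂ) (φ θ) = -(φ θ) := by rw [← h3]; simp
    have h5 : (φ θ).re = 0 := by
      have := congrArg Complex.re h4
      simp at this; linarith
    have h6 : ((r : ℝ) : ℂ) = (φ θ) ^ 2 := by
      rw [← map_pow, ← hr]; simp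
    have h7 : (r : ℝ) = -((φ θ).im) ^ 2 := by
      have := congrArg Complex.re h6
      rw [Complex.ofReal_re, sq, Complex.mul_re, h5] at this
      rw [this]; ring
    have h8 : r ≠ 0 := by
      rintro rfl
      rw [Rat.cast_zero] at hr
      exact hθ0 (eq_zero_of_pow_eq_zero hr.symm)
    have h9 : (r : ℝ) ≤ 0 := by rw [h7]; nlinarith [sq_nonneg (φ θ).im]
    exact lt_of_le_of_ne (by exact_mod_cast h9) h8
  obtain ⟨m, c, hmc, hm⟩ := Nat.sq_mul_squarefree (r.num.natAbs * r.den)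
  have hcne : c ≠ 0 := by
    rintro rfl
    have : r.num.natAbs * r.den ≠ 0 :=
      mul_ne_zero (Int.natAbs_ne_zero.2 (Rat.num_ne_zero.2 hr0.ne)) r.den_nz
    exact this (by rw [← hmc]; simp)
  have hq : r * r.den ^ 2 = -(c ^ 2 * m : ℚ) := by
    have e1 : ((c ^ 2 * m : ℕ) : ℤ) = -(r.num * r.den) := by
      rw [hmc]; push_cast
      rw [abs_of_neg (Rat.num_neg.2 hr0)]; ring
    have e2 : (c ^ 2 * m : ℚ) = -(r.num * r.den) := by exact_mod_cast congrArg (Int.cast : ℤ → ℚ) e1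
    rw [e2]
    have := Rat.mul_den_eq_num r
    rw [← this]; ring
  have hq' : (r : K) * (r.den : K) ^ 2 = -((c : K) ^ 2 * m) := by exact_mod_cast congrArg (Rat.cast : ℚ → K) hq
  have hcK : (c : K) ≠ 0 := Nat.cast_ne_zero.2 hcne
  have hdK : (r.den : K) ≠ 0 := Nat.cast_ne_zero.2 r.den_nz
  refine ⟨θ * r.den / c, m, hm, ?_, ?_⟩
  · rw [div_pow, mul_pow, ← hr, hq', div_eq_iff (pow_ne_zero _ hcK)]; ring
  · rw [map_div₀, map_mul, hθ, h1, map_natCast, map_natCast]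
    intro h
    rw [div_left_inj' hcK, mul_left_inj' hdK] at h
    have : (2 : K) * θ = 0 := by
      push_cast at h
      linear_combination -h
    simp [hθ0] at this

theorem adjoin_top {n : ℕ} (e : (K ≃ₐ[ℚ] K) ≃* (Fin n → Multiplicative (ZMod 2))) (φ : K →+* ℂ)
    (him : ∃ x, (φ x).im ≠ 0) (h3 : Monoid.exponent (ClassGroup (𝓞 K)) ∣ 3) (M : ℕ)
    (hM : ∀ m ≥ M, Squarefree m → ∃ n, Good m n ∧ 4 * n ^ 3 < m) :
    IntermediateField.adjoin ℚ {θ : K | ∃ m ≤ M + 1, θ ^ 2 = -(m : K)} = ⊤ := by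
  set L := IntermediateField.adjoin ℚ {θ : K | ∃ m ≤ M + 1, θ ^ 2 = -(m : K)} with hL
  rw [← IsGalois.fixedField_fixingSubgroup L]
  have : L.fixingSubgroup = ⊥ := by
    rw [Subgroup.eq_bot_iff_forall]
    intro s hs
    by_contra hs1
    obtain ⟨θ, m, hm, hθ, hsθ⟩ := exists_theta e φ him s hs1
    have hmM : m ≤ M + 1 := by
      by_contra! hlt
      obtain ⟨k, hk, hk2⟩ := hM m (by omega) hm
      have := field_bound (fun g => e.injective (by
        rw [map_mul, map_one]; funext i
        have : ∀ z : Multiplicative (ZMod 2), z * z = 1 := by decide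
        exact this _)) h3 θ m k hθ hm (by omega) hk
      omega
    have hmem : θ ∈ L := IntermediateField.subset_adjoin _ _ ⟨m, hmM, hθ⟩
    exact hsθ ((IntermediateField.mem_fixingSubgroup_iff _ _).1 hs θ hmem)
  rw [this, IntermediateField.fixedField_bot]

theorem finite_roots (M : ℕ) : {z : ℂ | ∃ m ≤ M, z ^ 2 = -(m : ℂ)}.Finite := by
  have : {z : ℂ | ∃ m ≤ M, z ^ 2 = -(m : ℂ)} = ⋃ m ∈ Set.Iic M, {z : ℂ | z ^ 2 = -(m : ℂ)} := by
    ext z; simp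
  rw [this]
  refine (Set.finite_Iic M).biUnion (fun m _ => ?_)
  obtain ⟨w, hw⟩ := IsAlgClosed.exists_pow_nat_eq (-(m : ℂ)) (n := 2) (by norm_num)
  refine (Set.toFinite {w, -w}).subset (fun z hz => ?_)
  have h1 : z ^ 2 = w ^ 2 := by rw [hw]; exact hz
  exact sq_eq_sq_iff_eq_or_eq_neg.1 h1

theorem final (n : ℕ) :
    {K : IntermediateField ℚ ℂ |
      (FiniteDimensional ℚ K ∧ IsGalois ℚ K ∧
    Nonempty ((K ≃ₐ[ℚ] K) ≃* (Fin n → Multiplicative (ZMod 2)))) ∧ (∃ x : K, (x : ℂ).im ≠ 0) ∧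
      Monoid.exponent (ClassGroup (𝓞 K)) ∣ 3}.Finite := by
  obtain ⟨M, hM⟩ := Filter.eventually_atTop.1 exists_good
  refine ((finite_roots (M + 1)).powerset.image (IntermediateField.adjoin ℚ)).subset ?_
  rintro K ⟨⟨h1, h2, ⟨e⟩⟩, him, h3⟩
  have : NumberField K := { to_charZero := inferInstance, to_finiteDimensional := by convert h1 }
  have htop := adjoin_top e K.subtype him h3 M hM
  let φ : K →ₐ[ℚ] ℂ := (algebraMap K ℂ).toRatAlgHom
  refine ⟨φ '' {θ : K | ∃ m ≤ M + 1, θ ^ 2 = -(m : K)}, ?_, ?_⟩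
  · rintro _ ⟨θ, ⟨m, hm, hθ⟩, rfl⟩
    exact ⟨m, hm, by rw [← map_pow, hθ, map_neg, map_natCast]⟩
  · rw [← IntermediateField.adjoin_map, htop]
    ext x
    rw [IntermediateField.mem_map]
    constructor
    · rintro ⟨y, -, rfl⟩
      exact y.2
    · intro hx
      exact ⟨⟨x, hx⟩, trivial, rfl⟩

end HB
end

/-- For every positive integer `n`, there are only finitely many imaginary `n`-quadratic
subfields of `ℂ` whose class group has exponent dividing `3`. -/
theorem stmt10 (n : ℕ) (hn : 0 < n) :
    {K : IntermediateField ℚ ℂ |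
      IsNQuadratic n K ∧ IsImaginary K ∧ Efield K ∣ 3}.Finite := by
  exact HB.final n
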